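/- Let n ≥ 2 and let ω be a positive continuous function on ℝⁿ which is a strong A∞ weight with data (p₀, K, C₀), i.e. ω is an A_{p₀} weight with constant K for some p₀ > 1 and C₀^{−1} δ_ω(x,y) ≤ d_ω(x,y) ≤ C₀ δ_ω(x,y) for all x, y ∈ ℝⁿ. Then for every 1 ≤ p < n, setting p* = np/(n−p), there exists a constant C (depending on n, p, p₀, K, C₀) such that for every f ∈ C_c^∞(ℝⁿ), (∫_{ℝⁿ} |f(x)|^{p*} ω(x) dx)^{1/p*} ≤ C (∫_{ℝⁿ} (ω(x)^{−1/n} |∇f(x)|)^{p} ω(x) dx)^{1/p}. In particular, taking p = 1 gives the weighted isoperimetric inequality. -/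

import Mathlib

open MeasureTheory Metric Set
open scoped ENNReal

/-- `c_n := 2^{n-2} Γ(n/2) π^{n/2}`. -/
noncomputable def cN (n : ℕ) : ℝ :=
  (2 : ℝ) ^ ((n : ℝ) - 2) * Real.Gamma ((n : ℝ) / 2) * Real.pi ^ ((n : ℝ) / 2)

/-- Logarithmic potential `u(x) = (1/c_n) ∫ log(|y|/|x-y|) f(y) dy`. -/
noncomputable def logPot (n : ℕ) (f : EuclideanSpace ℝ (Fin n) → ℝ)
    (x : EuclideanSpace ℝ (Fin n)) : ℝ :=
  (1 / cN n) * ∫ y, Real.log (‖y‖ / ‖x - y‖) * f y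

/-- `ω` is an `A_p` weight with constant `K` (for `p > 1`):
for every ball `B`, `(⨍_B ω) · (⨍_B ω^{-1/(p-1)})^{p-1} ≤ K`. -/
def IsApWeight (n : ℕ) (p K : ℝ) (ω : EuclideanSpace ℝ (Fin n) → ℝ) : Prop :=
  ∀ (x : EuclideanSpace ℝ (Fin n)) (r : ℝ), 0 < r →
    ((volume (ball x r)).toReal⁻¹ * ∫ y in ball x r, ω y) *
      ((volume (ball x r)).toReal⁻¹ *
        ∫ y in ball x r, (ω y) ^ (-(1 / (p - 1)) : ℝ)) ^ (p - 1) ≤ K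

/-- `δ_ω(x,y) = (∫_{B_{xy}} ω)^{1/n}`, where `B_{xy}` is the closed ball with
center `(x+y)/2` and radius `|x-y|/2`. -/
noncomputable def deltaW (n : ℕ) (ω : EuclideanSpace ℝ (Fin n) → ℝ)
    (x y : EuclideanSpace ℝ (Fin n)) : ℝ :=
  (∫ z in closedBall (midpoint ℝ x y) (dist x y / 2), ω z) ^ ((1 : ℝ) / n)

/-- `d_ω(x,y)`: infimum of `∫₀^L ω(γ(t))^{1/n} dt` over all `L ≥ 0` and all
1-Lipschitz curves `γ : [0,L] → ℝⁿ` joining `x` to `y` inside `B_{xy}`. -/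
noncomputable def dW (n : ℕ) (ω : EuclideanSpace ℝ (Fin n) → ℝ)
    (x y : EuclideanSpace ℝ (Fin n)) : ℝ :=
  sInf {d : ℝ | ∃ (L : ℝ) (γ : ℝ → EuclideanSpace ℝ (Fin n)),
    0 ≤ L ∧ LipschitzOnWith 1 γ (Set.Icc 0 L) ∧ γ 0 = x ∧ γ L = y ∧
    (∀ t ∈ Set.Icc 0 L, γ t ∈ closedBall (midpoint ℝ x y) (dist x y / 2)) ∧
    d = ∫ t in (0 : ℝ)..L, (ω (γ t)) ^ ((1 : ℝ) / n)}

/-- One-dimensional Hausdorff content: infimum of `Σᵢ diam Bᵢ` over countable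
covers of `E` by balls `Bᵢ`. -/
noncomputable def H1content {n : ℕ} (E : Set (EuclideanSpace ℝ (Fin n))) : ℝ≥0∞ :=
  ⨅ (c : ℕ → EuclideanSpace ℝ (Fin n) × ℝ) (_ : E ⊆ ⋃ i, ball (c i).1 (c i).2),
    ∑' i, ENNReal.ofReal (2 * (c i).2)

section
open MeasureTheory Metric Set
open scoped ENNReal

namespace SA

section brouwer
variable {V : Type*} [NormedAddCommGroup V] [NormedSpace ℝ V] [FiniteDimensional ℝ V]
  [MeasurableSpace V] [BorelSpace V]

lemma null_image (μ : Measure V) [μ.IsAddHaarMeasure] {f : V → V} {K : NNReal} {s : Set V}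
    (hf : LipschitzOnWith K f s) (hs : μ s = 0) : μ (f '' s) = 0 := by
  have h1 : (μH[(Module.finrank ℝ V : ℝ)] : Measure V).IsAddHaarMeasure :=
    isAddHaarMeasure_hausdorffMeasure
  have h2 : (μH[(Module.finrank ℝ V : ℝ)] : Measure V) ≪ μ :=
    Measure.absolutelyContinuous_isAddHaarMeasure _ _
  have h3 : μ ≪ (μH[(Module.finrank ℝ V : ℝ)] : Measure V) :=
    Measure.absolutelyContinuous_isAddHaarMeasure _ _
  apply h3
  have := hf.hausdorffMeasure_image_le (d := (Module.finrank ℝ V : ℝ)) (by positivity)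
  rw [h2 hs, mul_zero] at this
  exact le_antisymm this bot_le

lemma det_poly (A : V →L[ℝ] V) : ∃ P : Polynomial ℝ, P.natDegree ≤ Module.finrank ℝ V ∧
    ∀ t : ℝ, (ContinuousLinearMap.id ℝ V + t • A).det = P.eval t := by
  classical
  let b := Module.finBasis ℝ V
  let M := LinearMap.toMatrix b b (A : V →ₗ[ℝ] V)
  refine ⟨Matrix.det ((Polynomial.X : Polynomial ℝ) • M.map Polynomial.C
      + (1 : Matrix _ _ ℝ).map Polynomial.C), ?_, ?_⟩
  · have := Polynomial.natDegree_det_X_add_C_le M 1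
    simpa using this
  · intro t
    rw [ContinuousLinearMap.det]
    have : (((ContinuousLinearMap.id ℝ V + t • A) : V →L[ℝ] V) : V →ₗ[ℝ] V)
      = LinearMap.id + t • (A : V →ₗ[ℝ] V) := by ext; simp
    rw [this, ← LinearMap.det_toMatrix b, ← Polynomial.coe_evalRingHom, RingHom.map_det]
    congr 1
    rw [map_add, map_smul, LinearMap.toMatrix_id]
    ext i j
    simp [Matrix.one_apply, M]
    split_ifs <;> simp [add_comm, mul_comm]

theorem no_retract (G : V → V) {K : NNReal} (hG : LipschitzWith K G)
    (h1 : ∀ x, 2 ≤ ‖x‖ → G x = x) (h2 : ∀ x, ‖x‖ < 2 → ‖G x‖ = 2) : False := by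
  classical
  let μ : Measure V := (Module.finBasis ℝ V).addHaar
  let B : Set V := ball 0 2
  have hBm : MeasurableSet B := measurableSet_ball
  let h : V → V := fun x => G x - x
  have hh : LipschitzWith (K + 1) h := hG.sub LipschitzWith.id
  let Λ : ℝ := K + 1
  have hΛ : 0 < Λ := by positivity
  have hder : ∀ x, ‖fderiv ℝ h x‖ ≤ Λ := fun x => by
    have := norm_fderiv_le_of_lipschitz ℝ hh (x₀ := x)
    simpa [Λ] using this
  let S : Set V := {x | DifferentiableAt ℝ h x}
  have hSm : MeasurableSet S := measurableSet_of_differentiableAt ℝ h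
  have hSae : ∀ᵐ x ∂μ, x ∈ S := hh.ae_differentiableAt
  have hSc : μ Sᶜ = 0 := hSae
  -- small t
  have small : ∀ t : ℝ, 0 ≤ t → t * Λ ≤ 1/2 →
      ∫ x in B, (ContinuousLinearMap.id ℝ V + t • fderiv ℝ h x).det ∂μ = μ.real B := by
    intro t ht0 ht
    let g : V → V := fun x => x + t • h x
    have hgl : LipschitzWith (1 + ‖t‖₊ * (K+1)) g :=
      LipschitzWith.id.add ((lipschitzWith_smul t).comp hh)
    have happ : ApproximatesLinearOn g ((ContinuousLinearEquiv.refl ℝ V : V ≃L[ℝ] V) : V →L[ℝ] V)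
        univ (1/2 : NNReal) := by
      intro x _ y _
      have : g x - g y - (x - y) = t • (h x - h y) := by simp only [g, smul_sub]; abel
      simp only [ContinuousLinearEquiv.coe_refl, ContinuousLinearMap.coe_id', id_eq, this,
        norm_smul, Real.norm_eq_abs, abs_of_nonneg ht0]
      have h3 := hh.dist_le_mul x y
      rw [dist_eq_norm, dist_eq_norm] at h3
      calc t * ‖h x - h y‖ ≤ t * (Λ * ‖x - y‖) := by
            apply mul_le_mul_of_nonneg_left _ ht0; simpa [Λ] using h3
        _ = (t * Λ) * ‖x - y‖ := by ring
        _ ≤ (1/2) * ‖x - y‖ := by gcongr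
        _ = _ := by norm_num
    have hc : Subsingleton V ∨ (1/2 : NNReal) <
        ‖((ContinuousLinearEquiv.refl ℝ V).symm : V →L[ℝ] V)‖₊⁻¹ := by
      rcases subsingleton_or_nontrivial V with hs | hs
      · exact Or.inl hs
      · right
        simp only [ContinuousLinearEquiv.refl_symm, ContinuousLinearEquiv.coe_refl]
        rw [ContinuousLinearMap.nnnorm_id]
        norm_num [← NNReal.coe_lt_coe]
    have hinj : Function.Injective g := by
      exact injOn_univ.1 (happ.injOn hc)
    have hsurj : Function.Surjective g := happ.surjective hc
    have himg : g '' B = B := by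
      have hout : ∀ x, x ∉ B → g x = x := by
        intro x hx
        have : 2 ≤ ‖x‖ := by simpa [B] using hx
        simp [g, h, h1 x this]
      ext y
      constructor
      · rintro ⟨x, hx, rfl⟩
        by_contra hy
        have := hinj (hout _ hy)
        rw [this] at hy; exact hy hx
      · intro hy
        obtain ⟨x, rfl⟩ := hsurj y
        refine ⟨x, ?_, rfl⟩
        by_contra hx
        rw [hout x hx] at hy; exact hx hy
    have hdet : ∀ x, 0 < (ContinuousLinearMap.id ℝ V + t • fderiv ℝ h x).det := by
      intro x
      set A := fderiv ℝ h x
      obtain ⟨P, -, hP⟩ := det_poly A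
      have hne : ∀ r ∈ Icc 0 t, P.eval r ≠ 0 := by
        intro r hr h0
        rw [← hP] at h0
        rw [ContinuousLinearMap.det] at h0
        have := LinearMap.bot_lt_ker_of_det_eq_zero h0
        obtain ⟨v, hv, hv0⟩ := Submodule.exists_mem_ne_zero_of_ne_bot (bot_lt_iff_ne_bot.1 this)
        have hv' : v + r • A v = 0 := by simpa using hv
        have h5 : ‖v‖ ≤ (1/2) * ‖v‖ := by
          have : v = -(r • A v) := eq_neg_of_add_eq_zero_left hv'
          calc ‖v‖ = r * ‖A v‖ := by
                conv_lhs => rw [this]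
                rw [norm_neg, norm_smul, Real.norm_eq_abs, abs_of_nonneg hr.1]
            _ ≤ t * (Λ * ‖v‖) := by
                apply mul_le_mul hr.2 _ (norm_nonneg _) ht0
                exact (A.le_opNorm v).trans (by gcongr; exact hder x)
            _ = (t * Λ) * ‖v‖ := by ring
            _ ≤ _ := by gcongr
        have : 0 < ‖v‖ := norm_pos_iff.2 hv0
        linarith
      have h0 : P.eval 0 = 1 := by rw [← hP]; simp [ContinuousLinearMap.det]
      rw [hP]
      by_contra hneg
      push Not at hneg
      have := intermediate_value_Icc' ht0 (f := fun r => P.eval r)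
        (Polynomial.continuous P).continuousOn
      obtain ⟨r, hr, hr0⟩ := this ⟨hneg, by rw [h0]; norm_num⟩
      exact hne r hr hr0
    have hcv := lintegral_abs_det_fderiv_eq_addHaar_image μ (s := B ∩ S) (f := g)
      (f' := fun x => ContinuousLinearMap.id ℝ V + t • fderiv ℝ h x) (hBm.inter hSm)
      (fun x hx => by
        have : HasFDerivAt h (fderiv ℝ h x) x := DifferentiableAt.hasFDerivAt hx.2
        exact ((hasFDerivAt_id x).add (this.const_smul t)).hasFDerivWithinAt) hinj.injOn
    have e1 : μ (g '' (B ∩ S)) = μ B := by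
      apply le_antisymm
      · exact measure_mono ((image_mono inter_subset_left).trans himg.subset)
      · calc μ B ≤ μ (g '' (B ∩ S) ∪ g '' Sᶜ) := by
              apply measure_mono
              conv_lhs => rw [← himg]
              rw [← image_union]
              apply image_mono
              intro x hx
              by_cases hxS : x ∈ S
              · exact Or.inl ⟨hx, hxS⟩
              · exact Or.inr hxS
          _ ≤ μ (g '' (B ∩ S)) + μ (g '' Sᶜ) := measure_union_le _ _
          _ = _ := by rw [null_image μ hgl.lipschitzOnWith hSc, add_zero]
    rw [e1] at hcv
    rw [integral_eq_lintegral_of_nonneg_ae (Filter.Eventually.of_forall fun x => (hdet x).le)]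
    · rw [Measure.real, ← hcv]
      congr 1
      have : (B ∩ S : Set V) =ᵐ[μ] (B : Set V) := by
        filter_upwards [hSae] with x hx
        apply propext; exact ⟨fun h => h.1, fun h => ⟨h, hx⟩⟩
      rw [setLIntegral_congr this]
      congr 1; ext x; rw [abs_of_pos (hdet x)]
    · apply Measurable.aestronglyMeasurable
      have : Continuous fun A : V →L[ℝ] V => (ContinuousLinearMap.id ℝ V + t • A).det :=
        ContinuousLinearMap.continuous_det.comp (by fun_prop)
      exact this.measurable.comp (measurable_fderiv ℝ h)
  -- interpolation
  let d := Module.finrank ℝ V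
  let node : Fin (d+1) → ℝ := fun i => (i : ℝ) / (2 * Λ * (d+1))
  have hnode : Function.Injective node := by
    intro i j hij
    have : (0:ℝ) < 2 * Λ * (d+1) := by positivity
    simp only [node] at hij
    rw [div_left_inj' this.ne'] at hij
    exact Fin.ext (by exact_mod_cast hij)
  have hn0 : ∀ i, 0 ≤ node i := fun i => by positivity
  have hn1 : ∀ i, node i * Λ ≤ 1/2 := by
    intro i
    have hi : ((i : ℕ) : ℝ) ≤ d + 1 := by exact_mod_cast i.2.le
    have : node i * Λ = (i : ℝ) / (d+1) / 2 := by simp only [node]; field_simp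
    rw [this]
    have : (i : ℝ) / (d+1) ≤ 1 := by rw [div_le_one (by positivity)]; exact hi
    linarith
  let L : Fin (d+1) → ℝ := fun i => (Lagrange.basis Finset.univ node i).eval 1
  have hL1 : ∑ i, L i = 1 := by
    have := Lagrange.sum_basis (s := Finset.univ) (v := node) hnode.injOn Finset.univ_nonempty
    have := congrArg (Polynomial.eval 1) this
    simpa [Polynomial.eval_finsetSum, L] using this
  have hint : ∀ x, (ContinuousLinearMap.id ℝ V + (1:ℝ) • fderiv ℝ h x).det =
      ∑ i, L i * (ContinuousLinearMap.id ℝ V + node i • fderiv ℝ h x).det := by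
    intro x
    obtain ⟨P, hd, hP⟩ := det_poly (fderiv ℝ h x)
    have h3 := Lagrange.eq_interpolate (s := Finset.univ) (v := node) (f := P) hnode.injOn (by
      simp only [Finset.card_univ, Fintype.card_fin]
      exact lt_of_le_of_lt Polynomial.degree_le_natDegree (by exact_mod_cast Nat.lt_succ_of_le hd))
    have h4 := congrArg (Polynomial.eval 1) h3
    rw [hP, h4, Lagrange.interpolate_apply, Polynomial.eval_finsetSum]
    refine Finset.sum_congr rfl fun i _ => ?_
    rw [hP]; simp [L, mul_comm]
  have hz : ∀ x ∈ B, x ∈ S → (ContinuousLinearMap.id ℝ V + (1:ℝ) • fderiv ℝ h x).det = 0 := by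
    intro x hx hxS
    by_contra hne
    have hx2 : ‖x‖ < 2 := by simpa [B] using hx
    have hd : HasFDerivAt G (ContinuousLinearMap.id ℝ V + (1:ℝ) • fderiv ℝ h x) x := by
      have : HasFDerivAt h (fderiv ℝ h x) x := DifferentiableAt.hasFDerivAt hxS
      have := (hasFDerivAt_id x).add this
      rw [one_smul]
      refine this.congr_of_eventuallyEq (Filter.Eventually.of_forall fun y => by simp [h])
    set A := ContinuousLinearMap.id ℝ V + (1:ℝ) • fderiv ℝ h x
    have hsur : Function.Surjective (A : V →ₗ[ℝ] V) := by
      have hu : IsUnit (LinearMap.det (A : V →ₗ[ℝ] V)) := isUnit_iff_ne_zero.2 hne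
      rw [← LinearMap.isUnit_iff_isUnit_det, Module.End.isUnit_iff] at hu
      exact hu.2
    obtain ⟨u, hu⟩ := hsur (G x)
    have hu : A u = G x := hu
    -- curve
    have hcurve : HasDerivAt (fun r : ℝ => G (x + r • u)) (A u) 0 := by
      have hl : HasDerivAt (fun r : ℝ => x + r • u) u 0 := by
        simpa using ((hasDerivAt_id (0:ℝ)).smul_const u).const_add x
      have hd' : HasFDerivAt G A (x + (0:ℝ) • u) := by simpa using hd
      exact hd'.comp_hasDerivAt (0:ℝ) hl
    rw [hu] at hcurve
    have hin : ∀ᶠ r : ℝ in nhds 0, ‖x + r • u‖ < 2 := by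
      have hc : Continuous fun r : ℝ => ‖x + r • u‖ := by fun_prop
      apply hc.continuousAt.eventually_lt continuousAt_const
      simpa using hx2
    rw [hasDerivAt_iff_isLittleO_nhds_zero, Asymptotics.isLittleO_iff] at hcurve
    have h6 := hcurve (c := 1) one_pos
    obtain ⟨ε, hε, hball⟩ := Metric.eventually_nhds_iff.1 (h6.and hin)
    have hr := @hball (ε/2) (by rw [Real.dist_eq, sub_zero, abs_of_pos (by linarith)]; linarith)
    obtain ⟨a1, a2⟩ := hr
    have hGx := h2 x hx2
    have hGy := h2 _ a2
    simp only [zero_add, zero_smul, add_zero, one_mul] at a1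
    have hr0 : 0 < ε/2 := by linarith
    rw [Real.norm_eq_abs, abs_of_pos hr0] at a1
    have : ‖(1 + ε/2) • G x‖ ≤ ‖G (x + (ε/2) • u)‖ + ε/2 := by
      have e : (1 + ε/2) • G x = G (x + (ε/2) • u) - (G (x + (ε/2) • u) - G x - (ε/2) • G x) := by
        rw [add_smul, one_smul]; abel
      rw [e]
      exact (norm_sub_le _ _).trans (by gcongr)
    rw [norm_smul, Real.norm_eq_abs, abs_of_pos (by linarith), hGx, hGy] at this
    linarith
  have hI0 : ∫ x in B, (ContinuousLinearMap.id ℝ V + (1:ℝ) • fderiv ℝ h x).det ∂μ = 0 := by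
    rw [integral_eq_zero_of_ae]
    filter_upwards [ae_restrict_mem hBm, ae_restrict_of_ae hSae] with x hx hxS
    exact hz x hx hxS
  have hinteg : ∀ t : ℝ, IntegrableOn
      (fun x => (ContinuousLinearMap.id ℝ V + t • fderiv ℝ h x).det) B μ := by
    intro t
    have hc : Continuous fun A : V →L[ℝ] V => (ContinuousLinearMap.id ℝ V + t • A).det :=
      ContinuousLinearMap.continuous_det.comp (by fun_prop)
    obtain ⟨C, hC⟩ := (isCompact_closedBall (0 : V →L[ℝ] V) Λ).exists_bound_of_continuousOn hc.continuousOn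
    refine Measure.integrableOn_of_bounded (M := C) measure_ball_lt_top.ne
      (hc.measurable.comp (measurable_fderiv ℝ h)).aestronglyMeasurable ?_
    exact Filter.Eventually.of_forall fun x => hC _ (by simpa using hder x)
  have : ∫ x in B, (ContinuousLinearMap.id ℝ V + (1:ℝ) • fderiv ℝ h x).det ∂μ = μ.real B := by
    simp_rw [hint]
    rw [integral_finsetSum]
    · simp_rw [integral_const_mul]
      rw [Finset.sum_congr rfl fun i _ => by rw [small _ (hn0 i) (hn1 i)], ← Finset.sum_mul, hL1,
        one_mul]
    · intro i _
      exact (hinteg _).const_mul _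
  rw [hI0] at this
  have hpos : 0 < μ.real B := by
    rw [Measure.real, ENNReal.toReal_pos_iff]
    exact ⟨measure_ball_pos _ _ (by norm_num), measure_ball_lt_top⟩
  linarith

end brouwer

end SA
end

section
open MeasureTheory Metric Set
open scoped ENNReal

namespace SA

lemma lip_normalize {V : Type*} [NormedAddCommGroup V] [NormedSpace ℝ V] {c : ℝ} (hc : 0 < c)
    (y z : V) (hy : c ≤ ‖y‖) (hz : c ≤ ‖z‖) :
    ‖(2 / ‖y‖) • y - (2 / ‖z‖) • z‖ ≤ 4 / c * ‖y - z‖ := by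
  have hy0 : 0 < ‖y‖ := hc.trans_le hy
  have hz0 : 0 < ‖z‖ := hc.trans_le hz
  have e : (2 / ‖y‖) • y - (2 / ‖z‖) • z = (2 / ‖y‖) • (y - z) + (2/‖y‖ - 2/‖z‖) • z := by
    rw [smul_sub, sub_smul]; abel
  rw [e]
  refine (norm_add_le _ _).trans ?_
  rw [norm_smul, norm_smul, Real.norm_eq_abs, Real.norm_eq_abs, abs_of_pos (by positivity)]
  have e2 : 2/‖y‖ - 2/‖z‖ = 2 * (‖z‖ - ‖y‖) / (‖y‖ * ‖z‖) := by field_simp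
  have h1 : |2/‖y‖ - 2/‖z‖| * ‖z‖ ≤ 2 / ‖y‖ * ‖y - z‖ := by
    rw [e2, abs_div, abs_of_pos (by positivity : 0 < ‖y‖ * ‖z‖), abs_mul, abs_of_pos (by norm_num : (0:ℝ) < 2)]
    have := abs_norm_sub_norm_le z y
    rw [norm_sub_rev] at this
    calc 2 * |‖z‖ - ‖y‖| / (‖y‖ * ‖z‖) * ‖z‖ = 2 / ‖y‖ * |‖z‖ - ‖y‖| := by field_simp
      _ ≤ _ := by gcongr
  have h2 : 2 / ‖y‖ * ‖y - z‖ ≤ 2 / c * ‖y - z‖ := by gcongr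
  have : 4 / c * ‖y - z‖ = 2 / c * ‖y - z‖ + 2 / c * ‖y - z‖ := by ring
  linarith

section
variable {ι : Type*} [Fintype ι]

/-- coordinate clamp -/
noncomputable def clampV (r : ℝ) (x : ι → ℝ) : ι → ℝ := fun i => max (-r) (min r (x i))

lemma clampV_lip (r : ℝ) : LipschitzWith 1 (clampV r : (ι → ℝ) → ι → ℝ) := by
  refine LipschitzWith.of_dist_le_mul fun x y => ?_
  simp only [NNReal.coe_one, one_mul]
  rw [dist_pi_le_iff dist_nonneg]
  intro i
  refine le_trans ?_ (dist_le_pi_dist x y i)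
  simp only [clampV, Real.dist_eq]
  refine (abs_max_sub_max_le_max _ _ _ _).trans ?_
  simp only [sub_self, abs_zero]
  refine max_le (abs_nonneg _) ?_
  refine (abs_min_sub_min_le_max _ _ _ _).trans ?_
  simp

lemma clampV_mem {r : ℝ} (hr : 0 ≤ r) (x : ι → ℝ) (i : ι) : |clampV r x i| ≤ r := by
  rw [abs_le]; simp only [clampV]
  exact ⟨le_max_left _ _, max_le (by linarith) (min_le_left _ _)⟩

lemma clampV_of_le {r : ℝ} {x : ι → ℝ} (h : ∀ i, |x i| ≤ r) : clampV r x = x := by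
  ext i
  have := abs_le.1 (h i)
  simp only [clampV]
  rw [min_eq_right this.2, max_eq_right this.1]

theorem miranda (F : (ι → ℝ) → (ι → ℝ)) {K : NNReal}
    (hF : LipschitzOnWith K F {x | ∀ i, |x i| ≤ 1})
    (hlo : ∀ x, (∀ i, |x i| ≤ 1) → ∀ i, x i = -1 → F x i ≤ 0)
    (hhi : ∀ x, (∀ i, |x i| ≤ 1) → ∀ i, x i = 1 → 0 ≤ F x i) :
    ∃ x, (∀ i, |x i| ≤ 1) ∧ F x = 0 := by
  by_contra hno
  push Not at hno
  let F1 : (ι → ℝ) → (ι → ℝ) := fun x => F (clampV 1 x)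
  have hF1 : LipschitzWith K F1 := by
    have := hF.comp (clampV_lip (ι := ι) 1).lipschitzOnWith (s := univ)
      (fun x _ i => clampV_mem zero_le_one x i)
    rw [mul_one] at this
    exact lipschitzOnWith_univ.1 this
  let P : (ι → ℝ) → (ι → ℝ) := clampV 2
  have hP : LipschitzWith 1 P := clampV_lip 2
  have hP2 : ∀ x, ‖P x‖ ≤ 2 := fun x => by
    rw [pi_norm_le_iff_of_nonneg (by norm_num)]
    exact fun i => clampV_mem (by norm_num) x i
  have hPeq : ∀ x, ‖x‖ ≤ 2 → P x = x := fun x hx =>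
    clampV_of_le fun i => (norm_le_pi_norm x i).trans hx
  have hPout : ∀ x, 2 ≤ ‖x‖ → ‖P x‖ = 2 := by
    intro x hx
    apply le_antisymm (hP2 x)
    by_contra hlt
    push Not at hlt
    rw [pi_norm_lt_iff (by norm_num)] at hlt
    have : ‖x‖ < 2 := by
      rw [pi_norm_lt_iff (by norm_num)]
      intro i
      have h3 := abs_lt.1 (hlt i)
      simp only [P, clampV] at h3
      rw [Real.norm_eq_abs, abs_lt]
      constructor
      · by_contra h; push Not at h
        rw [max_eq_left (by exact (min_le_right _ _).trans h)] at h3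
        linarith
      · by_contra h; push Not at h
        rw [min_eq_left h, max_eq_right (by norm_num)] at h3
        linarith
    linarith
  obtain ⟨M, hM⟩ : ∃ M, ∀ x, ‖F1 x‖ ≤ M := by
    obtain ⟨M, hM⟩ := (isCompact_closedBall (0 : ι → ℝ) 1).exists_bound_of_continuousOn
      hF1.continuous.continuousOn
    refine ⟨M, fun x => ?_⟩
    have h1 : F1 x = F1 (clampV 1 x) := by
      simp only [F1]
      rw [clampV_of_le (x := clampV 1 x) (fun i => clampV_mem zero_le_one x i)]
    rw [h1]
    apply hM
    rw [mem_closedBall_zero_iff, pi_norm_le_iff_of_nonneg (by norm_num)]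
    exact fun i => clampV_mem (by norm_num) x i
  let θ : (ι → ℝ) → ℝ := fun x => max 0 (‖P x‖ - 1)
  have hθ0 : ∀ x, 0 ≤ θ x := fun x => le_max_left _ _
  have hθ1 : ∀ x, θ x ≤ 1 := fun x => max_le zero_le_one (by linarith [hP2 x])
  have hθL : ∀ x y, |θ x - θ y| ≤ ‖x - y‖ := by
    intro x y
    refine (abs_max_sub_max_le_max _ _ _ _).trans ?_
    simp only [sub_self, abs_zero]
    refine max_le (norm_nonneg _) ?_
    have := hP.dist_le_mul x y
    rw [dist_eq_norm, dist_eq_norm, NNReal.coe_one, one_mul] at this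
    refine le_trans ?_ this
    have e : ‖P x‖ - 1 - (‖P y‖ - 1) = ‖P x‖ - ‖P y‖ := by ring
    rw [e]
    exact abs_norm_sub_norm_le _ _
  let T : (ι → ℝ) → (ι → ℝ) := fun x => (1 - θ x) • F1 x + θ x • P x
  have hTL : ∀ x y, ‖T x - T y‖ ≤ (K + 1 + M + 2) * ‖x - y‖ := by
    intro x y
    have e : T x - T y = (1 - θ x) • (F1 x - F1 y) + θ x • (P x - P y)
        + ((θ x - θ y) • (P y - F1 y)) := by
      simp only [T]; module
    rw [e]
    have a1 : ‖(1 - θ x) • (F1 x - F1 y)‖ ≤ K * ‖x - y‖ := by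
      rw [norm_smul, Real.norm_eq_abs, abs_of_nonneg (by linarith [hθ1 x])]
      have := hF1.dist_le_mul x y
      rw [dist_eq_norm, dist_eq_norm] at this
      calc _ ≤ 1 * ‖F1 x - F1 y‖ := by gcongr; linarith [hθ0 x]
        _ ≤ _ := by rw [one_mul]; exact this
    have a2 : ‖θ x • (P x - P y)‖ ≤ 1 * ‖x - y‖ := by
      rw [norm_smul, Real.norm_eq_abs, abs_of_nonneg (hθ0 x)]
      have := hP.dist_le_mul x y
      rw [dist_eq_norm, dist_eq_norm, NNReal.coe_one, one_mul] at this
      exact mul_le_mul (hθ1 x) this (norm_nonneg _) zero_le_one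
    have a3 : ‖(θ x - θ y) • (P y - F1 y)‖ ≤ ‖x - y‖ * (2 + M) := by
      rw [norm_smul, Real.norm_eq_abs]
      refine mul_le_mul (hθL x y) ?_ (norm_nonneg _) (norm_nonneg _)
      exact (norm_sub_le _ _).trans (add_le_add (hP2 y) (hM y))
    have := norm_add₃_le (a := (1 - θ x) • (F1 x - F1 y)) (b := θ x • (P x - P y))
      (c := ((θ x - θ y) • (P y - F1 y)))
    nlinarith
  have hTne : ∀ x, T x ≠ 0 := by
    intro x h0
    by_cases hx : ‖P x‖ ≤ 1
    · have hx1 : ∀ i, |P x i| ≤ 1 := fun i => (norm_le_pi_norm (P x) i).trans hx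
      have hθx : θ x = 0 := max_eq_left (by linarith)
      simp only [T, hθx, sub_zero, one_smul, zero_smul, add_zero, F1] at h0
      exact hno (clampV 1 x) (fun i => clampV_mem zero_le_one x i) h0
    · push Not at hx
      have hne : ∃ i, 1 < |P x i| := by
        by_contra hcon
        push Not at hcon
        exact absurd ((pi_norm_le_iff_of_nonneg zero_le_one).2 hcon) (not_le.2 hx)
      obtain ⟨i, hi⟩ := hne
      have hθx : 0 < θ x := lt_max_of_lt_right (by linarith)
      have h0i := congrFun h0 i
      simp only [T, Pi.add_apply, Pi.smul_apply, smul_eq_mul, Pi.zero_apply] at h0i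
      have hm := fun j => clampV_mem (zero_le_one) x j
      rcases lt_abs.1 hi with h | h
      · have hxi : 1 < x i := by
          simp only [P, clampV] at h
          rcases lt_max_iff.1 h with h | h
          · linarith
          · exact (lt_min_iff.1 h).2
        have hc : clampV 1 x i = 1 := by
          simp only [clampV]; rw [min_eq_left hxi.le]; norm_num
        have := hhi _ hm i hc
        have h5 : 0 ≤ (1 - θ x) * F1 x i := mul_nonneg (by linarith [hθ1 x]) this
        nlinarith
      · have hxi : x i < -1 := by
          simp only [P, clampV] at h
          have h6 : max (-2) (min 2 (x i)) < -1 := by linarith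
          rcases min_lt_iff.1 (max_lt_iff.1 h6).2 with h | h
          · linarith
          · exact h
        have hc : clampV 1 x i = -1 := by
          simp only [clampV]; rw [min_eq_right (by linarith), max_eq_left hxi.le]
        have := hlo _ hm i hc
        have h5 : (1 - θ x) * F1 x i ≤ 0 := mul_nonpos_of_nonneg_of_nonpos (by linarith [hθ1 x]) this
        nlinarith
  have hTP : ∀ x, T (P x) = T x := by
    intro x
    have h1 : P (P x) = P x := hPeq _ (hP2 x)
    have h2 : clampV 1 (P x) = clampV 1 x := by
      ext i
      simp only [P, clampV]
      rcases le_total (x i) (-2) with h | h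
      · rw [min_eq_right (by linarith : x i ≤ 2), max_eq_left h, min_eq_right (by norm_num),
          min_eq_right (by linarith), max_eq_left (by norm_num), max_eq_left (by linarith)]
      · rcases le_total (x i) 2 with h' | h'
        · rw [min_eq_right h', max_eq_right h]
        · rw [min_eq_left h', max_eq_right (by norm_num), min_eq_left (by norm_num),
            min_eq_left (by linarith)]
          norm_num
    simp only [T, θ, F1, h1, h2]
  have hTc : Continuous T := by
    have : LipschitzWith (Real.toNNReal (K + 1 + M + 2)) T := LipschitzWith.of_dist_le_mul fun x y => by
      rw [dist_eq_norm, dist_eq_norm]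
      refine (hTL x y).trans ?_
      gcongr
      exact Real.le_coe_toNNReal _
    exact this.continuous
  obtain ⟨c, hc, hcT⟩ : ∃ c > 0, ∀ x, c ≤ ‖T x‖ := by
    obtain ⟨x0, -, hx0⟩ := (isCompact_closedBall (0 : ι → ℝ) 2).exists_isMinOn ⟨0, by simp⟩
      hTc.norm.continuousOn
    refine ⟨‖T x0‖, norm_pos_iff.2 (hTne x0), fun x => ?_⟩
    rw [← hTP x]
    exact hx0 (by simpa using hP2 x)
  let G : (ι → ℝ) → (ι → ℝ) := fun x => (2 / ‖T x‖) • T x + (x - P x)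
  have hG : LipschitzWith (Real.toNNReal (4 / c * (K + 1 + M + 2) + 2)) G :=
    LipschitzWith.of_dist_le_mul fun x y => by
      rw [dist_eq_norm, dist_eq_norm]
      have e : G x - G y = ((2 / ‖T x‖) • T x - (2 / ‖T y‖) • T y) + (x - y) - (P x - P y) := by
        simp only [G]; abel
      rw [e]
      have b1 := (lip_normalize hc _ _ (hcT x) (hcT y)).trans
        (mul_le_mul_of_nonneg_left (hTL x y) (by positivity))
      have b2 := hP.dist_le_mul x y
      rw [dist_eq_norm, dist_eq_norm, NNReal.coe_one, one_mul] at b2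
      have b3 := (norm_sub_le (((2 / ‖T x‖) • T x - (2 / ‖T y‖) • T y) + (x - y)) (P x - P y)).trans
        (add_le_add (norm_add_le _ _) le_rfl)
      calc _ ≤ (4 / c * (K + 1 + M + 2) + 2) * ‖x - y‖ := by nlinarith
        _ ≤ _ := by gcongr; exact Real.le_coe_toNNReal _
  refine no_retract G hG ?_ ?_
  · intro x hx
    have h1 := hPout x hx
    have hθx : θ x = 1 := by simp only [θ, h1]; norm_num
    have : T x = P x := by simp [T, hθx]
    simp [G, this, h1]
  · intro x hx
    simp only [G]
    rw [hPeq x hx.le, sub_self, add_zero, norm_smul, norm_div, norm_norm]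
    have := norm_pos_iff.2 (hTne x)
    norm_num
    field_simp
end

theorem continuation {n : ℕ} {N m : ℝ} (hN : 0 < N) (hm : 0 < m)
    (H : EuclideanSpace ℝ (Fin n) × ℝ → (Fin n → ℝ)) (G : EuclideanSpace ℝ (Fin n) → ℝ)
    {K K' : NNReal}
    (hH : LipschitzOnWith K H {z | (∀ i, |z.1 i| ≤ N) ∧ z.2 ∈ Icc 0 m})
    (hG : LipschitzOnWith K' G {x | ∀ i, |x i| ≤ N})
    (hlo : ∀ x, (∀ i, |x i| ≤ N) → ∀ t ∈ Icc 0 m, ∀ i, x i = -N → H (x, t) i ≤ 0)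
    (hhi : ∀ x, (∀ i, |x i| ≤ N) → ∀ t ∈ Icc 0 m, ∀ i, x i = N → 0 ≤ H (x, t) i)
    (h0 : ∀ x, (∀ i, |x i| ≤ N) → H (x, 0) = 0 → G x < 0)
    (h1 : ∀ x, (∀ i, |x i| ≤ N) → H (x, m) = 0 → 0 < G x) :
    ∃ x, (∀ i, |x i| ≤ N) ∧ ∃ t ∈ Icc 0 m, H (x, t) = 0 ∧ G x = 0 := by
  let X : (Option (Fin n) → ℝ) → EuclideanSpace ℝ (Fin n) := fun x =>
    WithLp.toLp 2 (fun i => N * clampV 1 x (some i))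
  let t : (Option (Fin n) → ℝ) → ℝ := fun x => m * (clampV 1 x none + 1) / 2
  have hXmem : ∀ x i, |X x i| ≤ N := by
    intro x i
    have := clampV_mem zero_le_one x (some i)
    simp only [X]
    rw [abs_mul, abs_of_pos hN]
    nlinarith
  have htmem : ∀ x, t x ∈ Icc 0 m := by
    intro x
    have := abs_le.1 (clampV_mem zero_le_one x none)
    simp only [t]
    constructor
    · have : 0 ≤ m * (clampV 1 x none + 1) := mul_nonneg hm.le (by linarith)
      linarith
    · nlinarith
  obtain ⟨KX, hX⟩ : ∃ KX, LipschitzWith KX X := by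
    let L : (Option (Fin n) → ℝ) →ₗ[ℝ] EuclideanSpace ℝ (Fin n) :=
      { toFun := fun x => WithLp.toLp 2 (fun i => N * x (some i))
        map_add' := fun x y => by ext i; simp [mul_add]
        map_smul' := fun c x => by ext i; simp; ring }
    have := (LinearMap.toContinuousLinearMap L).lipschitz.comp (clampV_lip 1)
    exact ⟨_, this⟩
  obtain ⟨Kt, ht⟩ : ∃ Kt, LipschitzWith Kt t := by
    have e1 : LipschitzWith 1 (fun x : Option (Fin n) → ℝ => clampV 1 x none) :=
      LipschitzWith.of_dist_le_mul fun x y => by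
        exact (dist_le_pi_dist (clampV 1 x) (clampV 1 y) none).trans
          ((clampV_lip 1).dist_le_mul x y)
    refine ⟨Real.toNNReal (m/2), LipschitzWith.of_dist_le_mul fun x y => ?_⟩
    have := e1.dist_le_mul x y
    rw [NNReal.coe_one, one_mul, Real.dist_eq] at this
    rw [Real.coe_toNNReal _ (by linarith), Real.dist_eq]
    have e : t x - t y = m/2 * (clampV 1 x none - clampV 1 y none) := by simp only [t]; ring
    rw [e, abs_mul, abs_of_pos (by linarith)]
    exact mul_le_mul_of_nonneg_left this (by linarith)
  let h : (Option (Fin n) → ℝ) → (Fin n → ℝ) := fun x => H (X x, t x)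
  let g : (Option (Fin n) → ℝ) → ℝ := fun x => G (X x)
  obtain ⟨Kh, hhL⟩ : ∃ Kh, LipschitzWith Kh h := by
    have := hH.comp (hX.prodMk ht).lipschitzOnWith (s := univ)
      (fun x _ => ⟨hXmem x, htmem x⟩)
    exact ⟨_, lipschitzOnWith_univ.1 this⟩
  obtain ⟨Kg, hgL⟩ : ∃ Kg, LipschitzWith Kg g := by
    have := hG.comp hX.lipschitzOnWith (s := univ) (fun x _ => hXmem x)
    exact ⟨_, lipschitzOnWith_univ.1 this⟩
  -- bounds
  have hcomp : IsCompact {x : Option (Fin n) → ℝ | ∀ i, |x i| ≤ 1} := by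
    have : {x : Option (Fin n) → ℝ | ∀ i, |x i| ≤ 1} = closedBall 0 1 := by
      ext x
      rw [mem_closedBall_zero_iff, pi_norm_le_iff_of_nonneg zero_le_one]; rfl
    rw [this]; exact isCompact_closedBall _ _
  obtain ⟨B, hB⟩ := hcomp.exists_bound_of_continuousOn hgL.continuous.continuousOn
  obtain ⟨A0, hA0, hA0'⟩ : ∃ A ≥ 0, ∀ x, (∀ i, |x i| ≤ 1) → t x = 0 → g x ≤ A * ‖h x‖ := by
    let S : Set (Option (Fin n) → ℝ) := {x | ∀ i, |x i| ≤ 1} ∩ ({x | t x = 0} ∩ {x | 0 ≤ g x})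
    have hS : IsCompact S := hcomp.inter_right ((isClosed_eq ht.continuous continuous_const).inter
      (isClosed_le continuous_const hgL.continuous))
    have hpos : ∀ x ∈ S, 0 < ‖h x‖ := by
      rintro x ⟨_, hx2, hx3⟩
      rw [norm_pos_iff]
      intro hx
      have : t x = 0 := hx2
      simp only [h, this] at hx
      exact absurd (h0 (X x) (hXmem x) hx) (not_lt.2 hx3)
    obtain ⟨C, hC⟩ := hS.exists_bound_of_continuousOn (f := fun x => g x / ‖h x‖)
      (hgL.continuous.continuousOn.div hhL.continuous.norm.continuousOn fun x hx => (hpos x hx).ne')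
    refine ⟨max C 0, le_max_right _ _, fun x hx hxt => ?_⟩
    rcases le_total 0 (g x) with hgx | hgx
    · have hxS : x ∈ S := ⟨hx, hxt, hgx⟩
      have h4 := (le_abs_self _).trans (hC x hxS)
      rw [div_le_iff₀ (hpos x hxS)] at h4
      exact h4.trans (by gcongr; exact le_max_left _ _)
    · exact hgx.trans (by positivity)
  obtain ⟨A1, hA1, hA1'⟩ : ∃ A ≥ 0, ∀ x, (∀ i, |x i| ≤ 1) → t x = m → - g x ≤ A * ‖h x‖ := by
    let S : Set (Option (Fin n) → ℝ) := {x | ∀ i, |x i| ≤ 1} ∩ ({x | t x = m} ∩ {x | g x ≤ 0})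
    have hS : IsCompact S := hcomp.inter_right ((isClosed_eq ht.continuous continuous_const).inter
      (isClosed_le hgL.continuous continuous_const))
    have hpos : ∀ x ∈ S, 0 < ‖h x‖ := by
      rintro x ⟨_, hx2, hx3⟩
      rw [norm_pos_iff]
      intro hx
      have : t x = m := hx2
      simp only [h, this] at hx
      exact absurd (h1 (X x) (hXmem x) hx) (not_lt.2 hx3)
    obtain ⟨C, hC⟩ := hS.exists_bound_of_continuousOn (f := fun x => g x / ‖h x‖)
      (hgL.continuous.continuousOn.div hhL.continuous.norm.continuousOn fun x hx => (hpos x hx).ne')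
    refine ⟨max C 0, le_max_right _ _, fun x hx hxt => ?_⟩
    rcases le_total (g x) 0 with hgx | hgx
    · have hxS : x ∈ S := ⟨hx, hxt, hgx⟩
      have h4 := (neg_le_abs _).trans (hC x hxS)
      rw [← neg_div, div_le_iff₀ (hpos x hxS)] at h4
      exact h4.trans (by gcongr; exact le_max_left _ _)
    · have : 0 ≤ max C 0 * ‖h x‖ := by positivity
      linarith
  let A : NNReal := ⟨A0 + A1, by positivity⟩
  let D : NNReal := Real.toNNReal (|B| / m)
  have hDm : (D : ℝ) * m = |B| := by
    simp only [D]; rw [Real.coe_toNNReal _ (by positivity)]; field_simp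
  let gt : (Option (Fin n) → ℝ) → ℝ := fun x =>
    g x + min ((A : ℝ) * ‖h x‖) (D * t x) - min ((A : ℝ) * ‖h x‖) (D * (m - t x))
  have smulL : ∀ (c K2 : NNReal) (u : (Option (Fin n) → ℝ) → ℝ), LipschitzWith K2 u →
      LipschitzWith (c * K2) (fun x => (c : ℝ) * u x) := by
    intro c K2 u hu
    refine LipschitzWith.of_dist_le_mul fun x y => ?_
    have := hu.dist_le_mul x y
    rw [Real.dist_eq] at this ⊢
    rw [← mul_sub, abs_mul, NNReal.abs_eq, NNReal.coe_mul, mul_assoc]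
    exact mul_le_mul_of_nonneg_left this c.2
  have hAh : LipschitzWith (A * (1 * Kh)) (fun x => (A : ℝ) * ‖h x‖) :=
    smulL _ _ _ (lipschitzWith_one_norm.comp hhL)
  have hDt : LipschitzWith (D * Kt) (fun x => (D : ℝ) * t x) := smulL _ _ _ ht
  have hDt' : LipschitzWith (D * (0 + Kt)) (fun x => (D : ℝ) * (m - t x)) :=
    smulL _ _ _ ((LipschitzWith.const m).sub ht)
  have hgt := (hgL.add (hAh.min hDt)).sub (hAh.min hDt')
  obtain ⟨Kf, hFl⟩ : ∃ Kf, LipschitzWith Kf (fun x : Option (Fin n) → ℝ =>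
      (fun o : Option (Fin n) => o.elim (gt x) (fun i => h x i))) := by
    refine ⟨max Kh (Kg + max (A * (1 * Kh)) (D * Kt) + max (A * (1 * Kh)) (D * (0 + Kt))),
      LipschitzWith.of_dist_le_mul fun x y => ?_⟩
    rw [dist_pi_le_iff (by positivity)]
    rintro (_ | i)
    · refine (hgt.dist_le_mul x y).trans ?_
      gcongr
      exact le_max_right _ _
    · refine ((dist_le_pi_dist (h x) (h y) i).trans (hhL.dist_le_mul x y)).trans ?_
      gcongr
      exact le_max_left _ _
  have hXi : ∀ x, (∀ i, |x i| ≤ 1) → ∀ i, X x i = N * x (some i) := by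
    intro x hx i
    simp only [X]; rw [clampV_of_le hx]
  have htx : ∀ x, (∀ i, |x i| ≤ 1) → t x = m * (x none + 1) / 2 := by
    intro x hx
    simp only [t]; rw [clampV_of_le hx]
  obtain ⟨x, hx, hF0⟩ := miranda _ hFl.lipschitzOnWith (by
    rintro x hx (_ | i) hxi
    · have ht0 : t x = 0 := by rw [htx x hx, hxi]; ring
      have hb := (le_abs_self _).trans (hB x hx)
      have ha := hA0' x hx ht0
      simp only [Option.elim, gt, ht0, mul_zero, sub_zero, hDm]
      have : min ((A : ℝ) * ‖h x‖) 0 = 0 := min_eq_right (by positivity)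
      rw [this]
      have h5 : g x ≤ min ((A : ℝ) * ‖h x‖) |B| := by
        refine le_min (ha.trans ?_) (hb.trans (le_abs_self _))
        have : (A : ℝ) = A0 + A1 := rfl
        rw [this]; gcongr; linarith
      linarith
    · simp only [Option.elim, h]
      exact hlo _ (hXmem x) _ (htmem x) i (by rw [hXi x hx, hxi]; ring)) (by
    rintro x hx (_ | i) hxi
    · have ht0 : t x = m := by rw [htx x hx, hxi]; ring
      have hb := (neg_le_abs _).trans (hB x hx)
      have ha := hA1' x hx ht0
      simp only [Option.elim, gt, ht0, mul_zero, sub_self, hDm]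
      have : min ((A : ℝ) * ‖h x‖) 0 = 0 := min_eq_right (by positivity)
      rw [this]
      have h5 : - g x ≤ min ((A : ℝ) * ‖h x‖) |B| := by
        refine le_min (ha.trans ?_) (hb.trans (le_abs_self _))
        have : (A : ℝ) = A0 + A1 := rfl
        rw [this]; gcongr; linarith
      linarith
    · simp only [Option.elim, h]
      exact hhi _ (hXmem x) _ (htmem x) i (by rw [hXi x hx, hxi]; ring))
  have hh0 : h x = 0 := by ext i; simpa using congrFun hF0 (some i)
  refine ⟨X x, hXmem x, t x, htmem x, hh0, ?_⟩
  have h6 := congrFun hF0 none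
  simp only [Option.elim, gt, hh0, norm_zero, mul_zero, Pi.zero_apply] at h6
  have ha : min 0 ((D : ℝ) * t x) = 0 := min_eq_left (mul_nonneg D.2 (htmem x).1)
  have hb : min 0 ((D : ℝ) * (m - t x)) = 0 :=
    min_eq_left (mul_nonneg D.2 (by linarith [(htmem x).2]))
  rw [ha, hb] at h6
  simpa [g] using h6

end SA
end

section
open MeasureTheory Metric Set
open scoped ENNReal

namespace SA

abbrev E (n : ℕ) := EuclideanSpace ℝ (Fin n)

noncomputable def mu {n : ℕ} (ω : E n → ℝ) : Measure (E n) :=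
  volume.withDensity fun x => ENNReal.ofReal (ω x)

/-- curve of cost at most d inside S -/
def Conn {n : ℕ} (ω : E n → ℝ) (S : Set (E n)) (x y : E n) (d : ℝ) : Prop :=
  ∃ (L : ℝ) (γ : ℝ → E n), 0 ≤ L ∧ LipschitzOnWith 1 γ (Icc 0 L) ∧ γ 0 = x ∧ γ L = y ∧
    (∀ t ∈ Icc 0 L, γ t ∈ S) ∧ (∫ t in (0:ℝ)..L, (ω (γ t)) ^ ((1:ℝ)/n)) ≤ d

/-- the ball with diameter ab -/
def bb {n : ℕ} (a b : E n) : Set (E n) := closedBall (midpoint ℝ a b) (dist a b / 2)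

structure SW (n : ℕ) (ω : E n → ℝ) (P KA C : ℝ) : Prop where
  hn : 2 ≤ n
  pos : ∀ x, 0 < ω x
  cont : Continuous ω
  hP : 1 ≤ P
  hKA : 0 < KA
  hC : 0 < C
  ap : ∀ x r, 0 < r → ∀ S ⊆ closedBall x r, MeasurableSet S →
    (volume.real S / volume.real (closedBall x r)) ^ P * (mu ω).real (closedBall x r)
      ≤ KA * (mu ω).real S
  lower : ∀ a b d, Conn ω (bb a b) a b d → ((mu ω).real (bb a b)) ^ ((1:ℝ)/n) ≤ C * d
  upper : ∀ a b, Conn ω (bb a b) a b (C * ((mu ω).real (bb a b)) ^ ((1:ℝ)/n))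

section
variable {n : ℕ} {ω : E n → ℝ}

lemma mu_real_eq (hpos : ∀ x, 0 < ω x) (hc : Continuous ω) {S : Set (E n)} (hS : MeasurableSet S) :
    (mu ω).real S = ∫ x in S, ω x := by
  rw [integral_eq_lintegral_of_nonneg_ae (Filter.Eventually.of_forall fun x => (hpos x).le)
    hc.aestronglyMeasurable, Measure.real, mu, withDensity_apply _ hS]

lemma mu_lt_top (hc : Continuous ω) {S : Set (E n)} (hS : Bornology.IsBounded S) :
    (mu ω) S < ∞ := by
  obtain ⟨r, hr⟩ := hS.subset_closedBall 0
  refine (measure_mono hr).trans_lt ?_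
  rw [mu, withDensity_apply _ measurableSet_closedBall]
  have h1 : IntegrableOn ω (closedBall 0 r) :=
    hc.continuousOn.integrableOn_compact (isCompact_closedBall _ _)
  refine lt_of_le_of_lt ?_ h1.2
  apply lintegral_mono
  intro x
  simp only [enorm_eq_nnnorm]
  exact Real.ofReal_le_enorm _

lemma mu_real_mono (hc : Continuous ω) {S T : Set (E n)} (hT : Bornology.IsBounded T) (h : S ⊆ T) :
    (mu ω).real S ≤ (mu ω).real T := measureReal_mono h (mu_lt_top hc hT).ne

lemma mu_pos (hpos : ∀ x, 0 < ω x) (hc : Continuous ω) {S : Set (E n)} (hS : MeasurableSet S)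
    (hv : volume S ≠ 0) : mu ω S ≠ 0 := by
  rw [mu, Ne, withDensity_apply_eq_zero hc.measurable.ennreal_ofReal]
  have : {x | ENNReal.ofReal (ω x) ≠ 0} ∩ S = S := by ext x; simp [hpos x]
  rwa [this]

lemma holder_ap (hpos : ∀ x, 0 < ω x) (hc : Continuous ω) {p : ℝ} (hp : 1 < p) {x : E n} {r : ℝ}
    {S : Set (E n)} (hS : S ⊆ closedBall x r) (hSm : MeasurableSet S) :
    volume.real S ^ p ≤ (∫ y in S, ω y) *
      (∫ y in closedBall x r, (ω y) ^ (-(1 / (p - 1)) : ℝ)) ^ (p - 1) := by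
  have hcp : ∀ s : ℝ, Continuous fun y => (ω y) ^ s := fun s =>
    hc.rpow_const fun y => Or.inl (hpos y).ne'
  have hint : ∀ s : ℝ, IntegrableOn (fun y => (ω y) ^ s) (closedBall x r) := fun s =>
    (hcp s).continuousOn.integrableOn_compact (isCompact_closedBall _ _)
  have hp0 : 0 < p := by linarith
  have hpq : p.HolderConjugate (p / (p - 1)) := Real.HolderConjugate.conjExponent hp
  have hmem : ∀ (s q : ℝ), 0 < q → MemLp (fun y => (ω y) ^ s) (ENNReal.ofReal q) (volume.restrict S) := by
    intro s q hq
    have h1 : MemLp (fun y => (ω y) ^ s) (ENNReal.ofReal q) (volume.restrict (closedBall x r)) := by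
      rw [← integrable_norm_rpow_iff (hcp s).aestronglyMeasurable]
      · have := hint (s * q)
        refine this.congr (Filter.Eventually.of_forall fun y => ?_)
        simp only
        rw [Real.norm_of_nonneg (Real.rpow_nonneg (hpos y).le _), ENNReal.toReal_ofReal hq.le,
          Real.rpow_mul (hpos y).le]
      · simpa using hq
      · simp
    exact h1.mono_measure (Measure.restrict_mono hS le_rfl)
  have key := integral_mul_le_Lp_mul_Lq_of_nonneg (μ := volume.restrict S) hpq
    (f := fun y => (ω y) ^ (1/p)) (g := fun y => (ω y) ^ (-(1/p)))
    (Filter.Eventually.of_forall fun y => Real.rpow_nonneg (hpos y).le _)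
    (Filter.Eventually.of_forall fun y => Real.rpow_nonneg (hpos y).le _)
    (hmem _ _ hp0) (hmem _ _ (by have : 0 < p - 1 := by linarith
                                 positivity))
  have hp1 : 0 < p - 1 := by linarith
  have e1 : ∀ y, (ω y) ^ (1/p) * (ω y) ^ (-(1/p)) = 1 := fun y => by
    rw [← Real.rpow_add (hpos y)]; simp
  have e2 : ∀ y, ((ω y) ^ (1/p)) ^ p = ω y := fun y => by
    rw [← Real.rpow_mul (hpos y).le, one_div, inv_mul_cancel₀ hp0.ne', Real.rpow_one]
  have e3 : ∀ y, ((ω y) ^ (-(1/p))) ^ (p/(p-1)) = (ω y) ^ (-(1/(p-1))) := fun y => by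
    rw [← Real.rpow_mul (hpos y).le]; congr 1; field_simp
  simp only [e1, e2, e3] at key
  rw [setIntegral_const, smul_eq_mul, mul_one] at key
  have hle : ∫ y in S, (ω y) ^ (-(1/(p-1))) ≤ ∫ y in closedBall x r, (ω y) ^ (-(1/(p-1))) :=
    setIntegral_mono_set (hint _) (Filter.Eventually.of_forall fun y => Real.rpow_nonneg (hpos y).le _)
      (Filter.Eventually.of_forall hS)
  have n1 : 0 ≤ ∫ y in S, ω y := integral_nonneg fun y => (hpos y).le
  have n2 : 0 ≤ ∫ y in S, (ω y) ^ (-(1/(p-1))) := integral_nonneg fun y => Real.rpow_nonneg (hpos y).le _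
  calc volume.real S ^ p ≤ ((∫ y in S, ω y) ^ (1/p) * (∫ y in S, (ω y) ^ (-(1/(p-1)))) ^ (1/(p/(p-1)))) ^ p := by
        gcongr
    _ = (∫ y in S, ω y) * (∫ y in S, (ω y) ^ (-(1/(p-1)))) ^ (p-1) := by
        rw [Real.mul_rpow (by positivity) (by positivity), ← Real.rpow_mul n1, ← Real.rpow_mul n2]
        congr 1
        · rw [one_div, inv_mul_cancel₀ hp0.ne', Real.rpow_one]
        · congr 1; field_simp
    _ ≤ _ := by gcongr

end

theorem SW.mk' (n : ℕ) (hn : 2 ≤ n) (ω : E n → ℝ)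
    (hωpos : ∀ x, 0 < ω x) (hωcont : Continuous ω)
    (p₀ K C₀ : ℝ) (hp₀ : 1 < p₀) (hAp : IsApWeight n p₀ K ω)
    (hstrong : ∀ x y : EuclideanSpace ℝ (Fin n),
      C₀⁻¹ * deltaW n ω x y ≤ dW n ω x y ∧ dW n ω x y ≤ C₀ * deltaW n ω x y) :
    ∃ KA C, SW n ω p₀ KA C := by
  have hδ : ∀ a b, deltaW n ω a b = ((mu ω).real (bb a b)) ^ ((1:ℝ)/n) := by
    intro a b
    rw [deltaW, bb, mu_real_eq hωpos hωcont measurableSet_closedBall]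
  have hnn : ∀ (γ : ℝ → E n) (L : ℝ), 0 ≤ L → 0 ≤ ∫ t in (0:ℝ)..L, (ω (γ t)) ^ ((1:ℝ)/n) := by
    intro γ L hL
    exact intervalIntegral.integral_nonneg hL fun t _ => Real.rpow_nonneg (hωpos _).le _
  have : Nonempty (Fin n) := ⟨⟨0, by omega⟩⟩
  have hδpos : ∀ a b, a ≠ b → 0 < deltaW n ω a b := by
    intro a b hab
    rw [hδ]
    apply Real.rpow_pos_of_pos
    rw [Measure.real, ENNReal.toReal_pos_iff]
    refine ⟨pos_iff_ne_zero.2 (mu_pos hωpos hωcont measurableSet_closedBall ?_),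
      mu_lt_top hωcont isBounded_closedBall⟩
    exact (measure_closedBall_pos _ _ (by have := dist_pos.2 hab; linarith)).ne'
  have hbdd : ∀ a b, BddBelow {d : ℝ | ∃ (L : ℝ) (γ : ℝ → EuclideanSpace ℝ (Fin n)),
    0 ≤ L ∧ LipschitzOnWith 1 γ (Set.Icc 0 L) ∧ γ 0 = a ∧ γ L = b ∧
    (∀ t ∈ Set.Icc 0 L, γ t ∈ closedBall (midpoint ℝ a b) (dist a b / 2)) ∧
    d = ∫ t in (0 : ℝ)..L, (ω (γ t)) ^ ((1 : ℝ) / n)} := by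
    intro a b
    refine ⟨0, ?_⟩
    rintro d ⟨L, γ, hL, -, -, -, -, rfl⟩
    exact hnn γ L hL
  have hne : ∀ a b, {d : ℝ | ∃ (L : ℝ) (γ : ℝ → EuclideanSpace ℝ (Fin n)),
    0 ≤ L ∧ LipschitzOnWith 1 γ (Set.Icc 0 L) ∧ γ 0 = a ∧ γ L = b ∧
    (∀ t ∈ Set.Icc 0 L, γ t ∈ closedBall (midpoint ℝ a b) (dist a b / 2)) ∧
    d = ∫ t in (0 : ℝ)..L, (ω (γ t)) ^ ((1 : ℝ) / n)}.Nonempty := by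
    intro a b
    by_cases hab : a = b
    · subst hab
      refine ⟨_, 0, fun _ => a, le_rfl, (LipschitzWith.const a).weaken zero_le_one |>.lipschitzOnWith, rfl, rfl, ?_, rfl⟩
      intro t _; simp
    have hd : 0 < dist a b := dist_pos.2 hab
    refine ⟨_, dist a b, fun t => a + (t / dist a b) • (b - a), dist_nonneg, ?_, by simp, ?_, ?_, rfl⟩
    · refine LipschitzWith.lipschitzOnWith (LipschitzWith.of_dist_le_mul fun s t => ?_)
      rw [dist_add_left, dist_eq_norm, ← sub_smul, norm_smul, ← dist_eq_norm b a, dist_comm b a,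
        Real.norm_eq_abs, ← sub_div, abs_div, abs_of_pos hd, Real.dist_eq]
      simp [hd.ne']
    · simp [hd.ne']
    · intro t ht
      rw [mem_closedBall, dist_eq_norm, midpoint_eq_smul_add]
      have e : a + (t / dist a b) • (b - a) - (⅟2:ℝ) • (a + b) = (t / dist a b - 1/2) • (b - a) := by
        rw [invOf_eq_inv]; module
      rw [e, norm_smul, ← dist_eq_norm b a, dist_comm b a, Real.norm_eq_abs]
      have h1 : |t / dist a b - 1/2| ≤ 1/2 := by
        rw [abs_le]
        have : 0 ≤ t / dist a b := div_nonneg ht.1 hd.le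
        have : t / dist a b ≤ 1 := (div_le_one hd).2 ht.2
        constructor <;> linarith
      nlinarith
  have hC0 : 0 < C₀ := by
    obtain ⟨b, hb⟩ : ∃ b : E n, b ≠ 0 := exists_ne 0
    by_contra h
    have h1 := hδpos b 0 hb
    have h2 := (hstrong b 0).2
    have h3 : 0 ≤ dW n ω b 0 := by
      apply Real.sInf_nonneg
      rintro d ⟨L, γ, hL, -, -, -, -, rfl⟩
      exact hnn γ L hL
    push Not at h
    have h5 : C₀ * deltaW n ω b 0 ≤ 0 := mul_nonpos_of_nonpos_of_nonneg h h1.le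
    have h6 : dW n ω b 0 = 0 := le_antisymm (h2.trans h5) h3
    obtain ⟨z, hz, hzm⟩ := (isCompact_closedBall (midpoint ℝ b 0) (dist b 0 / 2)).exists_isMinOn
      ⟨_, mem_closedBall_self (by positivity)⟩
      ((hωcont.rpow_const fun y => Or.inl (hωpos y).ne' : Continuous fun y => (ω y) ^ ((1:ℝ)/n))).continuousOn
    have hzpos : 0 < (ω z) ^ ((1:ℝ)/n) := Real.rpow_pos_of_pos (hωpos z) _
    have hd : 0 < dist b 0 := dist_pos.2 hb
    have h7 : (ω z) ^ ((1:ℝ)/n) * dist b 0 ≤ dW n ω b 0 := by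
      apply le_csInf (hne b 0)
      rintro d ⟨L, γ, hL, hγ, g0, g1, g2, rfl⟩
      have hLd : dist b 0 ≤ L := by
        have := hγ.dist_le_mul 0 (left_mem_Icc.2 hL) L (right_mem_Icc.2 hL)
        rw [g0, g1] at this
        simpa [Real.dist_eq, abs_of_nonneg hL] using this
      have hci : IntervalIntegrable (fun t => (ω (γ t)) ^ ((1:ℝ)/n)) volume 0 L := by
        apply ContinuousOn.intervalIntegrable
        rw [uIcc_of_le hL]
        exact (hωcont.rpow_const fun y => Or.inl (hωpos y).ne').comp_continuousOn hγ.continuousOn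
      have := intervalIntegral.integral_mono_on hL (intervalIntegrable_const (c := (ω z) ^ ((1:ℝ)/n))) hci
        (fun t ht => hzm (g2 t ht))
      rw [intervalIntegral.integral_const, smul_eq_mul, sub_zero] at this
      nlinarith
    nlinarith
  refine ⟨max K 1, C₀ + 1, hn, hωpos, hωcont, hp₀.le, by positivity, by linarith, ?_, ?_, ?_⟩
  · intro x r hr S hS hSm
    have h1 := hAp x r hr
    have hvb : volume (ball x r) = volume (closedBall x r) :=
      (Measure.addHaar_closedBall_eq_addHaar_ball volume x r).symm
    have hae : ball x r =ᵐ[volume] closedBall x r :=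
      ae_eq_of_subset_of_measure_ge ball_subset_closedBall hvb.ge measurableSet_ball.nullMeasurableSet
        measure_closedBall_lt_top.ne
    rw [setIntegral_congr_set hae, setIntegral_congr_set hae, hvb] at h1
    have h2 := holder_ap hωpos hωcont hp₀ hS hSm
    rw [mu_real_eq hωpos hωcont measurableSet_closedBall, mu_real_eq hωpos hωcont hSm]
    set V := volume.real (closedBall x r)
    have hV : 0 < V := by
      rw [show V = (volume (closedBall x r)).toReal from rfl, ENNReal.toReal_pos_iff]
      exact ⟨measure_closedBall_pos _ _ hr, measure_closedBall_lt_top⟩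
    change V⁻¹ * _ * (V⁻¹ * _) ^ (p₀ - 1) ≤ K at h1
    set I := ∫ y in closedBall x r, (ω y) ^ (-(1 / (p₀ - 1)) : ℝ)
    set A := ∫ y in closedBall x r, ω y
    have hI : 0 ≤ I := integral_nonneg fun y => Real.rpow_nonneg (hωpos y).le _
    have hA : 0 ≤ A := integral_nonneg fun y => (hωpos y).le
    have hs : 0 ≤ ∫ y in S, ω y := integral_nonneg fun y => (hωpos y).le
    rw [Real.mul_rpow (by positivity) hI] at h1
    have hV2 : V⁻¹ * (V⁻¹) ^ (p₀ - 1) = (V ^ p₀)⁻¹ := by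
      rw [Real.inv_rpow hV.le, Real.rpow_sub_one hV.ne', ]
      field_simp
    have h3 : A * I ^ (p₀ - 1) * (V ^ p₀)⁻¹ ≤ K := by
      rw [← hV2]; refine le_trans (le_of_eq ?_) h1; ring
    rw [Real.div_rpow measureReal_nonneg hV.le]
    calc volume.real S ^ p₀ / V ^ p₀ * A ≤ ((∫ y in S, ω y) * I ^ (p₀ - 1)) / V ^ p₀ * A := by gcongr
      _ = (∫ y in S, ω y) * (A * I ^ (p₀ - 1) * (V ^ p₀)⁻¹) := by rw [div_eq_mul_inv]; ring
      _ ≤ (∫ y in S, ω y) * K := by gcongr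
      _ ≤ max K 1 * ∫ y in S, ω y := by rw [mul_comm]; gcongr; exact le_max_left _ _
  · rintro a b d ⟨L, γ, hL, hγ, h0, h1, h2, h3⟩
    rw [← hδ]
    have h4 := (hstrong a b).1
    have h5 : dW n ω a b ≤ ∫ t in (0 : ℝ)..L, (ω (γ t)) ^ ((1 : ℝ) / n) :=
      csInf_le (hbdd a b) ⟨L, γ, hL, hγ, h0, h1, h2, rfl⟩
    have h6 : 0 ≤ d := (hnn γ L hL).trans h3
    have h7 : C₀⁻¹ * deltaW n ω a b ≤ d := h4.trans (h5.trans h3)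
    rw [inv_mul_le_iff₀ hC0] at h7
    nlinarith
  · intro a b
    rw [← hδ]
    by_cases hab : a = b
    · subst hab
      refine ⟨0, fun _ => a, le_rfl, (LipschitzWith.const a).weaken zero_le_one |>.lipschitzOnWith, rfl, rfl, ?_, ?_⟩
      · intro t _; simp [bb]
      · simp only [intervalIntegral.integral_same]
        have : 0 ≤ deltaW n ω a a := by rw [hδ]; positivity
        positivity
    · have h1 : dW n ω a b < (C₀ + 1) * deltaW n ω a b := by
        have := hδpos a b hab
        have := (hstrong a b).2
        nlinarith
      obtain ⟨d, ⟨L, γ, hL, hγ, h0, h1, h2, rfl⟩, hd⟩ := exists_lt_of_csInf_lt (hne a b) h1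
      exact ⟨L, γ, hL, hγ, h0, h1, h2, hd.le⟩

end SA
end

section
open MeasureTheory Metric Set
open scoped ENNReal

namespace SA
variable {n : ℕ} {ω : E n → ℝ}

noncomputable def wt (ω : E n → ℝ) (x : E n) : ℝ := (ω x) ^ ((1:ℝ)/n)

lemma wt_pos (hpos : ∀ x, 0 < ω x) (x : E n) : 0 < wt ω x := Real.rpow_pos_of_pos (hpos x) _

lemma wt_cont (hpos : ∀ x, 0 < ω x) (hc : Continuous ω) : Continuous (wt ω) :=
  hc.rpow_const fun y => Or.inl (hpos y).ne'

lemma Conn.mono {S T : Set (E n)} {x y : E n} {d d' : ℝ} (h : Conn ω S x y d) (hST : S ⊆ T)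
    (hd : d ≤ d') : Conn ω T x y d' := by
  obtain ⟨L, γ, a, b, c, e, f, g⟩ := h
  exact ⟨L, γ, a, b, c, e, fun t ht => hST (f t ht), g.trans hd⟩

lemma Conn.refl {S : Set (E n)} {x : E n} (hx : x ∈ S) : Conn ω S x x 0 :=
  ⟨0, fun _ => x, le_rfl, (LipschitzWith.const x).weaken zero_le_one |>.lipschitzOnWith, rfl, rfl,
    fun _ _ => hx, by simp⟩

lemma Conn.segment (hpos : ∀ x, 0 < ω x) (hc : Continuous ω) {S : Set (E n)} {x y : E n} {d : ℝ}
    (hS : segment ℝ x y ⊆ S) (hd : ∀ z ∈ segment ℝ x y, wt ω z * dist x y ≤ d) : Conn ω S x y d := by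
  by_cases hab : x = y
  · subst hab
    refine (Conn.refl (hS (left_mem_segment _ _ _))).mono le_rfl ?_
    simpa using hd x (left_mem_segment _ _ _)
  have hdp : 0 < dist x y := dist_pos.2 hab
  have hseg : ∀ t ∈ Icc 0 (dist x y), x + (t / dist x y) • (y - x) ∈ _root_.segment ℝ x y := by
    intro t ht
    rw [segment_eq_image']
    exact ⟨t / dist x y, ⟨div_nonneg ht.1 hdp.le, (div_le_one hdp).2 ht.2⟩, rfl⟩
  have hL : LipschitzOnWith 1 (fun t : ℝ => x + (t / dist x y) • (y - x)) (Icc 0 (dist x y)) := by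
    refine LipschitzWith.lipschitzOnWith (LipschitzWith.of_dist_le_mul fun s t => ?_)
    rw [dist_add_left, dist_eq_norm, ← sub_smul, norm_smul, ← dist_eq_norm y x, dist_comm y x,
      Real.norm_eq_abs, ← sub_div, abs_div, abs_of_pos hdp, Real.dist_eq]
    simp [hdp.ne']
  refine ⟨dist x y, fun t => x + (t / dist x y) • (y - x), dist_nonneg, hL, by simp,
    by simp [hdp.ne'], fun t ht => hS (hseg t ht), ?_⟩
  have hci : IntervalIntegrable (fun t : ℝ => wt ω (x + (t / dist x y) • (y - x))) volume 0 (dist x y) := by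
    apply ContinuousOn.intervalIntegrable
    rw [uIcc_of_le dist_nonneg]
    exact (wt_cont hpos hc).comp_continuousOn hL.continuousOn
  have := intervalIntegral.integral_mono_on dist_nonneg hci (intervalIntegrable_const (c := d / dist x y))
    (fun t ht => by rw [le_div_iff₀ hdp]; exact hd _ (hseg t ht))
  rw [intervalIntegral.integral_const, smul_eq_mul, sub_zero, mul_div_cancel₀ _ hdp.ne'] at this
  exact this

lemma Conn.trans (hpos : ∀ x, 0 < ω x) (hc : Continuous ω) {S : Set (E n)} {x y z : E n} {d d' : ℝ}
    (h : Conn ω S x y d) (h' : Conn ω S y z d') : Conn ω S x z (d + d') := by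
  obtain ⟨L1, γ1, a1, b1, c1, e1, f1, g1⟩ := h
  obtain ⟨L2, γ2, a2, b2, c2, e2, f2, g2⟩ := h'
  let γ : ℝ → E n := fun t => if t ≤ L1 then γ1 t else γ2 (t - L1)
  have hγ1 : ∀ t, t ≤ L1 → γ t = γ1 t := fun t ht => if_pos ht
  have hγ2 : ∀ t, L1 ≤ t → γ t = γ2 (t - L1) := by
    intro t ht
    rcases ht.eq_or_lt with rfl | ht
    · rw [hγ1 _ le_rfl, sub_self, e1, c2]
    · exact if_neg (not_le.2 ht)
  have hmono : ∀ s ∈ Icc 0 (L1 + L2), ∀ t ∈ Icc 0 (L1 + L2), s ≤ t → dist (γ s) (γ t) ≤ t - s := by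
    intro s hs t ht hst
    have d1 : ∀ s ∈ Icc 0 L1, ∀ t ∈ Icc 0 L1, s ≤ t → dist (γ1 s) (γ1 t) ≤ t - s := by
      intro s hs t ht hst
      have := b1.dist_le_mul s hs t ht
      rw [Real.dist_eq, abs_sub_comm, abs_of_nonneg (by linarith)] at this
      simpa using this
    have d2 : ∀ s ∈ Icc 0 L2, ∀ t ∈ Icc 0 L2, s ≤ t → dist (γ2 s) (γ2 t) ≤ t - s := by
      intro s hs t ht hst
      have := b2.dist_le_mul s hs t ht
      rw [Real.dist_eq, abs_sub_comm, abs_of_nonneg (by linarith)] at this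
      simpa using this
    rcases le_total t L1 with h | h
    · rw [hγ1 s (hst.trans h), hγ1 t h]
      exact d1 s ⟨hs.1, hst.trans h⟩ t ⟨ht.1, h⟩ hst
    · rcases le_total s L1 with h3 | h3
      · rw [hγ1 s h3, hγ2 t h]
        refine (dist_triangle _ y _).trans ?_
        have u1 := d1 s ⟨hs.1, h3⟩ L1 ⟨a1, le_rfl⟩ h3
        have u2 := d2 0 ⟨le_rfl, a2⟩ (t - L1) ⟨by linarith, by linarith [ht.2]⟩ (by linarith)
        rw [e1] at u1; rw [c2] at u2; linarith
      · rw [hγ2 s h3, hγ2 t h]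
        have := d2 (s - L1) ⟨by linarith, by linarith [hs.2]⟩ (t - L1) ⟨by linarith, by linarith [ht.2]⟩ (by linarith)
        linarith
  have hLip : LipschitzOnWith 1 γ (Icc 0 (L1 + L2)) := by
    refine LipschitzOnWith.of_dist_le_mul fun s hs t ht => ?_
    rw [NNReal.coe_one, one_mul, Real.dist_eq]
    rcases le_total s t with h | h
    · rw [abs_sub_comm, abs_of_nonneg (by linarith)]; exact hmono s hs t ht h
    · rw [dist_comm, abs_of_nonneg (by linarith)]; exact hmono t ht s hs h
  have hcon : ContinuousOn (fun t => (ω (γ t)) ^ ((1:ℝ)/n)) (Icc 0 (L1 + L2)) :=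
    (wt_cont hpos hc).comp_continuousOn hLip.continuousOn
  refine ⟨L1 + L2, γ, by linarith, hLip, by rw [hγ1 _ a1, c1],
    by rw [hγ2 _ (by linarith), add_sub_cancel_left, e2], ?_, ?_⟩
  · intro t ht
    rcases le_total t L1 with h | h
    · rw [hγ1 t h]; exact f1 t ⟨ht.1, h⟩
    · rw [hγ2 t h]; exact f2 _ ⟨by linarith, by linarith [ht.2]⟩
  · rw [← intervalIntegral.integral_add_adjacent_intervals (b := L1)]
    · refine add_le_add (le_trans (le_of_eq ?_) g1) (le_trans (le_of_eq ?_) g2)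
      · refine intervalIntegral.integral_congr fun t ht => ?_
        rw [uIcc_of_le a1] at ht
        simp only [hγ1 t ht.2]
      · have : ∫ t in (L1)..(L1+L2), (ω (γ t)) ^ ((1:ℝ)/n) =
            ∫ t in (L1)..(L1+L2), (fun u => (ω (γ2 u)) ^ ((1:ℝ)/n)) (t - L1) := by
          refine intervalIntegral.integral_congr fun t ht => ?_
          rw [uIcc_of_le (by linarith)] at ht
          simp only [hγ2 t ht.1]
        rw [this, intervalIntegral.integral_comp_sub_right (fun u => (ω (γ2 u)) ^ ((1:ℝ)/n)) L1]
        simp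
    · apply ContinuousOn.intervalIntegrable
      rw [uIcc_of_le a1]
      exact hcon.mono (Icc_subset_Icc le_rfl (by linarith))
    · apply ContinuousOn.intervalIntegrable
      rw [uIcc_of_le (by linarith)]
      exact hcon.mono (Icc_subset_Icc a1 le_rfl)

/-! dyadic grid -/
noncomputable def hh (N : ℝ) (k : ℕ) : ℝ := 2 * N / 2 ^ k

noncomputable def idx (N : ℝ) (k : ℕ) (x : E n) : Fin n → ℤ := fun i => ⌊(x i + N) / hh N k⌋

def cube (N : ℝ) (k : ℕ) (j : Fin n → ℤ) : Set (E n) := {y | idx N k y = j}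

lemma hh_pos {N : ℝ} (hN : 0 < N) (k : ℕ) : 0 < hh N k := by unfold hh; positivity

lemma hh_succ (N : ℝ) (k : ℕ) : hh N k = 2 * hh N (k+1) := by
  unfold hh; rw [pow_succ]; field_simp

lemma hh_anti {N : ℝ} (hN : 0 < N) {k l : ℕ} (h : k ≤ l) : hh N l ≤ hh N k := by
  unfold hh; gcongr; norm_num

lemma idx_succ (N : ℝ) (k : ℕ) (x : E n) (i : Fin n) : idx N k x i = idx N (k+1) x i / 2 := by
  unfold idx
  rw [hh_succ N k]
  have := Int.floor_div_natCast ((x i + N) / hh N (k+1)) 2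
  have e : (x i + N) / (2 * hh N (k+1)) = (x i + N) / hh N (k+1) / ((2:ℕ):ℝ) := by
    rw [div_div, mul_comm]; norm_num
  rw [e, this]; rfl

lemma idx_eq_of_le {N : ℝ} {k l : ℕ} (h : k ≤ l) {x y : E n} (hxy : idx N l x = idx N l y) :
    idx N k x = idx N k y := by
  induction l, h using Nat.le_induction with
  | base => exact hxy
  | succ l _ ih =>
    apply ih
    ext i
    rw [idx_succ N l x, idx_succ N l y, hxy]

lemma mem_cube_iff {N : ℝ} (hN : 0 < N) {k : ℕ} {j : Fin n → ℤ} {x : E n} :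
    x ∈ cube N k j ↔ ∀ i, -N + hh N k * j i ≤ x i ∧ x i < -N + hh N k * j i + hh N k := by
  have h := hh_pos hN k
  simp only [cube, mem_ofPred_eq, funext_iff, idx, Int.floor_eq_iff]
  refine forall_congr' fun i => ?_
  rw [le_div_iff₀ h, div_lt_iff₀ h]
  constructor
  · rintro ⟨a, b⟩; constructor <;> nlinarith
  · rintro ⟨a, b⟩; constructor <;> nlinarith

lemma cube_eq_preimage {N : ℝ} (hN : 0 < N) (k : ℕ) (j : Fin n → ℤ) :
    cube N k j = (WithLp.ofLp : E n → (Fin n → ℝ)) ⁻¹'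
      (univ.pi fun i => Ico (-N + hh N k * j i) (-N + hh N k * j i + hh N k)) := by
  ext x
  rw [mem_cube_iff hN]; simp

lemma cube_meas {N : ℝ} (hN : 0 < N) (k : ℕ) (j : Fin n → ℤ) : MeasurableSet (cube (n := n) N k j) := by
  rw [cube_eq_preimage hN]
  exact (MeasurableSet.univ_pi fun i => measurableSet_Ico).preimage
    (PiLp.volume_preserving_ofLp (Fin n)).measurable

lemma cube_vol {N : ℝ} (hN : 0 < N) (k : ℕ) (j : Fin n → ℤ) :
    volume (cube (n := n) N k j) = ENNReal.ofReal (hh N k ^ n) := by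
  rw [cube_eq_preimage hN, (PiLp.volume_preserving_ofLp (Fin n)).measure_preimage
    (MeasurableSet.univ_pi fun i => measurableSet_Ico).nullMeasurableSet, volume_pi_pi]
  simp [ENNReal.ofReal_pow (hh_pos hN k).le]

lemma norm_le_card {x : E n} {c : ℝ} (h : ∀ i, |x i| ≤ c) : ‖x‖ ≤ n * c := by
  rw [EuclideanSpace.norm_eq]
  rcases Nat.eq_zero_or_pos n with rfl | hn
  · simp
  have hc : 0 ≤ c := (abs_nonneg _).trans (h ⟨0, hn⟩)
  rw [Real.sqrt_le_left (by positivity)]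
  calc ∑ i, ‖x i‖ ^ 2 ≤ ∑ i : Fin n, c ^ 2 := by
        gcongr with i; exact h i
    _ = n * c ^ 2 := by simp
    _ ≤ (n * c) ^ 2 := by
        have : (1:ℝ) ≤ n := by exact_mod_cast hn
        nlinarith [mul_nonneg (by linarith : (0:ℝ) ≤ n - 1) (by positivity : 0 ≤ n * c^2)]

lemma cube_dist {N : ℝ} (hN : 0 < N) {k : ℕ} {x y : E n} (h : idx N k x = idx N k y) :
    dist x y ≤ n * hh N k := by
  rw [dist_eq_norm]
  apply norm_le_card
  intro i
  have h1 := (mem_cube_iff hN (j := idx N k y)).1 h i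
  have h2 := (mem_cube_iff hN (j := idx N k y) (x := y)).1 rfl i
  rw [PiLp.sub_apply, abs_le]
  constructor <;> linarith

lemma cube_bdd {N : ℝ} (hN : 0 < N) (k : ℕ) (j : Fin n → ℤ) :
    Bornology.IsBounded (cube (n := n) N k j) := by
  rcases (cube (n := n) N k j).eq_empty_or_nonempty with h | ⟨x, hx⟩
  · rw [h]; exact Bornology.isBounded_empty
  · refine isBounded_closedBall.subset (t := closedBall x (n * hh N k)) fun y hy => ?_
    rw [mem_closedBall]
    exact cube_dist hN (hy.trans (Eq.symm hx))

lemma SW.ap_vol {P KA C : ℝ} (hw : SW n ω P KA C) {x : E n} {R c : ℝ} (hR : 0 < R) (hc : 0 < c)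
    {S : Set (E n)} (hS : S ⊆ closedBall x R) (hSm : MeasurableSet S)
    (hv : c * R ^ n ≤ volume.real S) :
    (mu ω).real (closedBall x R) ≤
      KA * (volume.real (closedBall (0 : E n) 1) / c) ^ P * (mu ω).real S := by
  have h1 := hw.ap x R hR S hS hSm
  have h2 : volume.real (closedBall x R) = R ^ n * volume.real (closedBall (0 : E n) 1) := by
    rw [Measure.real, Measure.addHaar_closedBall' _ _ hR.le, ENNReal.toReal_mul,
      ENNReal.toReal_ofReal (by positivity)]
    simp [Measure.real]
  set v := volume.real (closedBall (0 : E n) 1)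
  have hvp : 0 < v := by
    rw [show v = (volume (closedBall (0 : E n) 1)).toReal from rfl, ENNReal.toReal_pos_iff]
    exact ⟨measure_closedBall_pos _ _ one_pos, measure_closedBall_lt_top⟩
  have h3 : c / v ≤ volume.real S / volume.real (closedBall x R) := by
    rw [h2, div_le_div_iff₀ hvp (by positivity)]
    calc c * (R ^ n * v) = c * R ^ n * v := by ring
      _ ≤ _ := by gcongr
  have h4 : (c / v) ^ P * (mu ω).real (closedBall x R) ≤ KA * (mu ω).real S := by
    refine le_trans ?_ h1
    gcongr
    linarith [hw.hP]
  have h5 : (v / c) ^ P * (c / v) ^ P = 1 := by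
    rw [← Real.mul_rpow (by positivity) (by positivity)]
    have : v / c * (c / v) = 1 := by field_simp
    rw [this, Real.one_rpow]
  calc (mu ω).real (closedBall x R) = (v / c) ^ P * ((c / v) ^ P * (mu ω).real (closedBall x R)) := by
        rw [← mul_assoc, h5, one_mul]
    _ ≤ (v / c) ^ P * (KA * (mu ω).real S) := by gcongr
    _ = _ := by ring

end SA
end

section
open MeasureTheory Metric Set
open scoped ENNReal

namespace SA
variable {n : ℕ} {ω : E n → ℝ}

def BadAt (ω : E n → ℝ) (N β : ℝ) (k : ℕ) (x : E n) : Prop :=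
  (mu ω).real (cube N k (idx N k x)) ≤ (β * hh N k ^ 2) ^ n

def UU (ω : E n → ℝ) (N β : ℝ) (κ : ℕ) : Set (E n) := {x | ∃ k, κ ≤ k ∧ BadAt ω N β k x}

def MaxBad (ω : E n → ℝ) (N β : ℝ) (κ k : ℕ) (x : E n) : Prop :=
  κ ≤ k ∧ BadAt ω N β k x ∧ ∀ k', κ ≤ k' → k' < k → ¬ BadAt ω N β k' x

lemma BadAt.congr {N β : ℝ} {k : ℕ} {x y : E n} (h : BadAt ω N β k x) (hxy : idx N k x = idx N k y) :
    BadAt ω N β k y := by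
  unfold BadAt at *; rwa [← hxy]

lemma MaxBad.congr {N β : ℝ} {κ k : ℕ} {x y : E n} (h : MaxBad ω N β κ k x)
    (hxy : idx N k x = idx N k y) : MaxBad ω N β κ k y :=
  ⟨h.1, h.2.1.congr hxy, fun k' h1 h2 h3 => h.2.2 k' h1 h2 (h3.congr (idx_eq_of_le h2.le hxy).symm)⟩

lemma BadAt.mono {N β β' : ℝ} {k : ℕ} {x : E n} (hβ : 0 ≤ β) (hb : β ≤ β') (h : BadAt ω N β k x) :
    BadAt ω N β' k x := by
  unfold BadAt at *
  refine h.trans ?_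
  gcongr

lemma exists_maxBad {N β : ℝ} {κ : ℕ} {x : E n} (h : x ∈ UU ω N β κ) : ∃ k, MaxBad ω N β κ k x := by
  classical
  have h' : ∃ k, κ ≤ k ∧ BadAt ω N β k x := h
  refine ⟨Nat.find h', (Nat.find_spec h').1, (Nat.find_spec h').2, fun k' h1 h2 h3 => ?_⟩
  exact Nat.find_min h' h2 ⟨h1, h3⟩

structure Prm where
  N : ℝ
  β1 : ℝ
  β2 : ℝ
  M : ℝ
  κ1 : ℕ
  κ2 : ℕ

def Step (ω : E n → ℝ) (s : Prm) (p q : E n) (e : ℝ) : Prop :=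
  (dist p q ≤ hh s.N s.κ2 ∧ s.M * dist p q ≤ e ∧ ∀ z ∈ segment ℝ p q, wt ω z * dist p q ≤ e) ∨
  (dist p q ≤ hh s.N s.κ2 ∧
    ((p ∉ UU ω s.N s.β1 s.κ1 ∨ q ∉ UU ω s.N s.β1 s.κ1) ∨
      (p ∉ UU ω s.N s.β2 s.κ2 ∨ q ∉ UU ω s.N s.β2 s.κ2)) ∧
    ∀ z ∈ segment ℝ p q, wt ω z * dist p q ≤ e) ∨
  (∃ k, MaxBad ω s.N s.β1 s.κ1 k p ∧ idx s.N k p = idx s.N k q ∧ s.β1 * hh s.N k ^ 2 ≤ e) ∨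
  (∃ k, MaxBad ω s.N s.β2 s.κ2 k p ∧ idx s.N k p = idx s.N k q ∧ s.β2 * hh s.N k ^ 2 ≤ e)

lemma Step.symm {s : Prm} {p q : E n} {e : ℝ} (h : Step ω s p q e) : Step ω s q p e := by
  unfold Step at *
  rw [dist_comm q p, segment_symm ℝ q p]
  rcases h with h | ⟨h1, h2, h3⟩ | ⟨k, h1, h2, h3⟩ | ⟨k, h1, h2, h3⟩
  · exact Or.inl h
  · refine Or.inr (Or.inl ⟨h1, ?_, h3⟩); tauto
  · exact Or.inr (Or.inr (Or.inl ⟨k, h1.congr h2, h2.symm, h3⟩))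
  · exact Or.inr (Or.inr (Or.inr ⟨k, h1.congr h2, h2.symm, h3⟩))

lemma bb_subset (x y : E n) : bb x y ⊆ closedBall x (dist x y) := by
  unfold bb
  apply closedBall_subset_closedBall'
  rw [dist_midpoint_left]
  simp
  linarith

lemma thales {a b z : E n} (h : dist a z ^ 2 + dist z b ^ 2 ≤ dist a b ^ 2) : z ∈ bb a b := by
  unfold bb
  rw [mem_closedBall]
  have h1 := parallelogram_law_with_norm ℝ (a - z) (b - z)
  have e1 : a - z - (b - z) = a - b := by abel
  rw [e1] at h1
  have e2 : ‖z - midpoint ℝ a b‖ = ‖a - z + (b - z)‖ / 2 := by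
    have : z - midpoint ℝ a b = (-(1/2) : ℝ) • (a - z + (b - z)) := by
      rw [midpoint_eq_smul_add, invOf_eq_inv]; module
    rw [this, norm_smul]; norm_num; ring
  rw [dist_eq_norm, dist_eq_norm z b, dist_eq_norm a b, norm_sub_rev z b] at h
  rw [dist_eq_norm, e2, dist_eq_norm]
  have : ‖a - z + (b - z)‖ ≤ ‖a - b‖ := by
    apply abs_le_of_sq_le_sq' _ (norm_nonneg _) |>.2
    nlinarith
  linarith

lemma bb_bdd (x y : E n) : Bornology.IsBounded (bb x y) := isBounded_closedBall

lemma jump_conn {P KA C : ℝ} (hw : SW n ω P KA C) : ∃ CJ > 0, ∀ (N β : ℝ), 0 < N → 0 < β →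
    ∀ (k : ℕ) (p q a b : E n), p ∈ bb a b → q ∈ bb a b → idx N k p = idx N k q →
    BadAt ω N β k p → Conn ω (bb a b) p q (CJ * (β * hh N k ^ 2)) := by
  have hn1 : (1:ℝ) ≤ n := by have := hw.hn; exact_mod_cast (by omega : 1 ≤ n)
  have hn0 : (n:ℝ) ≠ 0 := by positivity
  let c : ℝ := 1 / (3 * n) ^ n
  have hc : 0 < c := by positivity
  let C' : ℝ := KA * (volume.real (closedBall (0 : E n) 1) / c) ^ P
  have hC' : 0 ≤ C' := by have := hw.hKA; positivity
  refine ⟨3 * C * C' ^ ((1:ℝ)/n) + 1, by have := hw.hC; positivity, ?_⟩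
  intro N β hN hβ k p q a b hp hq hpq hbad
  have hC := hw.hC
  set ℓ := hh N k
  have hℓ : 0 < ℓ := hh_pos hN k
  have hX : 0 ≤ β * ℓ ^ 2 := by positivity
  by_cases hab : a = b
  · subst hab
    have hp' : p = a := by simpa [bb] using hp
    have hq' : q = a := by simpa [bb] using hq
    rw [hp', hq']
    exact (Conn.refl (by simp [bb])).mono le_rfl (by positivity)
  have hr : 0 < dist a b := dist_pos.2 hab
  set o := midpoint ℝ a b
  set R := dist a b / 2 with hRdef
  have hR : 0 < R := by positivity
  have hpR : ‖o - p‖ ≤ R := by rw [← dist_eq_norm, dist_comm]; exact hp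
  have hqR : ‖o - q‖ ≤ R := by rw [← dist_eq_norm, dist_comm]; exact hq
  set D := ‖p - q‖
  have hD0 : 0 ≤ D := norm_nonneg _
  have hDR : D ≤ 2 * R := by
    have : p - q = (o - q) - (o - p) := by abel
    simp only [D]; rw [this]
    exact (norm_sub_le _ _).trans (by linarith)
  set t := D / (2 * R) with ht
  have ht0 : 0 ≤ t := by positivity
  have ht1 : t ≤ 1 := (div_le_one (by positivity)).2 hDR
  have htR : t * R = D / 2 := by rw [ht]; field_simp
  let p' := p + t • (o - p)
  let q' := q + t • (o - q)
  have dpp : dist p p' = t * ‖o - p‖ := by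
    simp only [p']; rw [dist_self_add_right, norm_smul, Real.norm_of_nonneg ht0]
  have dqq : dist q q' = t * ‖o - q‖ := by
    simp only [q']; rw [dist_self_add_right, norm_smul, Real.norm_of_nonneg ht0]
  have dpq : dist p' q' = (1 - t) * D := by
    have : p' - q' = (1 - t) • (p - q) := by simp only [p', q']; module
    rw [dist_eq_norm, this, norm_smul, Real.norm_of_nonneg (by linarith)]
  have dpp2 : dist p p' ≤ D / 2 := by rw [dpp, ← htR]; gcongr
  have dqq2 : dist q q' ≤ D / 2 := by rw [dqq, ← htR]; gcongr
  have dpq2 : dist p' q' ≤ D := by rw [dpq]; nlinarith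
  have side : ∀ x : E n, ‖o - x‖ ≤ R → bb x (x + t • (o - x)) ⊆ bb a b := by
    intro x hx
    apply closedBall_subset_closedBall'
    have e : dist x (x + t • (o - x)) = t * ‖o - x‖ := by
      rw [dist_self_add_right, norm_smul, Real.norm_of_nonneg ht0]
    have e2 : dist (midpoint ℝ x (x + t • (o - x))) o = (1 - t/2) * ‖o - x‖ := by
      have : midpoint ℝ x (x + t • (o - x)) - o = (-(1 - t/2)) • (o - x) := by
        rw [midpoint_eq_smul_add, invOf_eq_inv]; module
      rw [dist_eq_norm, this, norm_smul, norm_neg, Real.norm_of_nonneg (by linarith)]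
    have e3 : dist (midpoint ℝ x (x + t • (o - x))) (midpoint ℝ a b) = (1 - t/2) * ‖o - x‖ := e2
    rw [e, e3]
    linarith
  have mid : bb p' q' ⊆ bb a b := by
    apply closedBall_subset_closedBall'
    have e2 : dist (midpoint ℝ p' q') o ≤ (1 - t) * R := by
      have : midpoint ℝ p' q' - o = (-(1 - t) * (1/2)) • ((o - p) + (o - q)) := by
        simp only [p', q']
        rw [midpoint_eq_smul_add, invOf_eq_inv]; module
      rw [dist_eq_norm, this, norm_smul, norm_mul, norm_neg, Real.norm_of_nonneg (by linarith)]
      have := norm_add_le (o - p) (o - q)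
      have h9 : ‖o - p + (o - q)‖ ≤ 2 * R := by linarith
      calc (1 - t) * ‖(1/2:ℝ)‖ * ‖o - p + (o - q)‖ ≤ (1 - t) * (1/2) * (2 * R) := by
            have : ‖(1/2:ℝ)‖ = 1/2 := by norm_num
            rw [this]
            have : 0 ≤ 1 - t := by linarith
            gcongr
        _ = _ := by ring
    have e3 : dist (midpoint ℝ p' q') (midpoint ℝ a b) ≤ (1 - t) * R := e2
    rw [dpq]
    nlinarith
  have hDℓ : D ≤ n * ℓ := by
    have := cube_dist hN hpq
    rwa [dist_eq_norm] at this
  have hbig : (mu ω).real (closedBall p (3 * n * ℓ)) ≤ C' * (β * ℓ ^ 2) ^ n := by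
    have h1 := hw.ap_vol (x := p) (R := 3 * n * ℓ) (c := c) (by positivity) hc
      (S := cube N k (idx N k p)) (fun y hy => by
        rw [mem_closedBall]
        refine (cube_dist hN hy).trans ?_
        change (n:ℝ) * ℓ ≤ _
        nlinarith [mul_pos (by positivity : (0:ℝ) < n) hℓ]) (cube_meas hN _ _) (by
        rw [Measure.real, cube_vol hN, ENNReal.toReal_ofReal (by positivity)]
        change c * _ ≤ ℓ ^ n
        simp only [c]
        rw [mul_pow (3 * (n:ℝ)) ℓ]
        field_simp
        exact le_rfl)
    refine h1.trans ?_
    gcongr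
    exact hbad
  have cost : ∀ x y : E n, bb x y ⊆ closedBall p (3 * n * ℓ) →
      C * ((mu ω).real (bb x y)) ^ ((1:ℝ)/n) ≤ C * C' ^ ((1:ℝ)/n) * (β * ℓ ^ 2) := by
    intro x y hxy
    have h1 := (mu_real_mono hw.cont isBounded_closedBall hxy).trans hbig
    have h2 : ((mu ω).real (bb x y)) ^ ((1:ℝ)/n) ≤ (C' * (β * ℓ ^ 2) ^ n) ^ ((1:ℝ)/n) := by gcongr
    rw [Real.mul_rpow hC' (by positivity), one_div, Real.pow_rpow_inv_natCast hX (by exact_mod_cast hn0)] at h2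
    rw [mul_assoc]
    rw [one_div]
    gcongr
  have c1 := (hw.upper p p').mono (side p hpR) (cost p p' ((bb_subset p p').trans
    (closedBall_subset_closedBall (by nlinarith))))
  have c2 := (hw.upper p' q').mono mid (cost p' q' ((bb_subset p' q').trans
    (closedBall_subset_closedBall' (by rw [dist_comm p' p]; nlinarith))))
  have hsym : bb q' q = bb q q' := by unfold bb; rw [midpoint_comm, dist_comm]
  have c3 := (hw.upper q' q).mono (hsym ▸ side q hqR) (cost q' q (hsym ▸ (bb_subset q q').trans
    (closedBall_subset_closedBall' (by rw [dist_comm q p, dist_eq_norm p q]; change _ + D ≤ _; nlinarith))))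
  refine ((c1.trans hw.pos hw.cont c2).trans hw.pos hw.cont c3).mono le_rfl ?_
  nlinarith

end SA
end

section
open MeasureTheory Metric Set
open scoped ENNReal

namespace SA
variable {n : ℕ} {ω : E n → ℝ}

structure Prm.Ok (n : ℕ) (s : Prm) (β : ℝ) : Prop where
  hN : 0 < s.N
  hβ : 0 < β
  h1 : β ≤ s.β1
  h2 : β ≤ s.β2
  k1 : s.κ1 ≤ s.κ2
  hM : 4 * n * hh s.N s.κ2 * β ≤ s.M
  hM0 : 0 ≤ s.M

lemma Step.nonneg (hpos : ∀ x, 0 < ω x) {s : Prm} {β : ℝ} (hs : s.Ok n β) {p q : E n} {e : ℝ} (h : Step ω s p q e) : 0 ≤ e := by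
  have b1 := hs.hβ.trans_le hs.h1
  have b2 := hs.hβ.trans_le hs.h2
  rcases h with ⟨h1, h2, h3⟩ | ⟨h1, h2, h3⟩ | ⟨k, h1, h2, h3⟩ | ⟨k, h1, h2, h3⟩
  · exact (mul_nonneg (wt_pos hpos p).le dist_nonneg).trans (h3 p (left_mem_segment _ _ _))
  · exact (mul_nonneg (wt_pos hpos p).le dist_nonneg).trans (h3 p (left_mem_segment _ _ _))
  · exact le_trans (by positivity) h3
  · exact le_trans (by positivity) h3

lemma left_mem_bb (a b : E n) : a ∈ bb a b := by
  unfold bb; rw [mem_closedBall, dist_left_midpoint]; simp; linarith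

lemma right_mem_bb (a b : E n) : b ∈ bb a b := by
  unfold bb; rw [mem_closedBall, dist_right_midpoint]; simp; linarith

lemma exists_level {N : ℝ} (hN : 0 < N) (κ : ℕ) {t : ℝ} (ht : 0 < t) (h : t ≤ hh N κ) :
    ∃ k, κ ≤ k ∧ hh N k ≤ t ∧ t / 2 < hh N k := by
  classical
  have hex : ∃ k, κ ≤ k ∧ hh N k ≤ t := by
    obtain ⟨m, hm⟩ := exists_pow_lt_of_lt_one (y := (1/2:ℝ)) (x := t / (2*N)) (by positivity) (by norm_num)
    refine ⟨max κ m, le_max_left _ _, (hh_anti hN (le_max_right κ m)).trans ?_⟩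
    unfold hh
    rw [lt_div_iff₀ (by positivity)] at hm
    calc 2 * N / 2 ^ m = (1/2)^m * (2 * N) := by rw [one_div, inv_pow]; field_simp
      _ ≤ t := hm.le
  refine ⟨Nat.find hex, (Nat.find_spec hex).1, (Nat.find_spec hex).2, ?_⟩
  rcases (Nat.find_spec hex).1.eq_or_lt with h1 | h1
  · rw [← h1]; linarith
  · obtain ⟨k, hk⟩ : ∃ k, Nat.find hex = k + 1 := ⟨Nat.find hex - 1, by omega⟩
    have := Nat.find_min hex (m := k) (by omega)
    push Not at this
    have h2 := this (by omega)
    rw [hh_succ] at h2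
    rw [hk]; linarith

lemma bad_of_small {P KA C : ℝ} (hw : SW n ω P KA C) : ∃ c1 > 0, ∀ (N β : ℝ), 0 < N → 0 < β →
    ∀ (k : ℕ) (a b z : E n), a ≠ b → z ∈ bb a b → hh N k ≤ dist a b / (4 * n) →
    dist a b / (4 * n) / 2 < hh N k → (mu ω).real (bb a b) < (c1 * β * dist a b ^ 2) ^ n →
    BadAt ω N β k z := by
  have hn1 : (1:ℝ) ≤ n := by have := hw.hn; exact_mod_cast (by omega : 1 ≤ n)
  have hn0 : n ≠ 0 := by have := hw.hn; omega
  haveI : Nonempty (Fin n) := ⟨⟨0, by omega⟩⟩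
  set v := volume.real (closedBall (0 : E n) 1) with hvdef
  have hv : 0 < v := ENNReal.toReal_pos (measure_closedBall_pos volume (0 : E n) one_pos).ne' measure_closedBall_lt_top.ne
  let c : ℝ := v / 2 ^ n
  have hc : 0 < c := by positivity
  set C2 : ℝ := KA * (v / c) ^ P with hC2
  have hC20 : 0 ≤ C2 := by have := hw.hKA; positivity
  let D := max C2 1
  have hD1 : 1 ≤ D := le_max_right _ _
  let ρ : ℝ := 1 / (4 * n)
  refine ⟨ρ ^ 2 / 4 / D, by positivity, ?_⟩
  intro N β hN hβ k a b z hab hz hk1 hk2 hm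
  set r := dist a b with hr
  have hr0 : 0 < r := dist_pos.2 hab
  have hsub : bb a b ⊆ closedBall z r := by
    intro y hy
    rw [mem_closedBall]
    have h1 : dist y (midpoint ℝ a b) ≤ r / 2 := hy
    have h2 : dist z (midpoint ℝ a b) ≤ r / 2 := hz
    have := dist_triangle_right y z (midpoint ℝ a b)
    linarith
  have h1 := hw.ap_vol (x := z) (R := r) (c := c) hr0 hc hsub measurableSet_closedBall (by
    have h2 : volume.real (bb a b) = (r/2) ^ n * v := by
      unfold bb
      rw [Measure.real, Measure.addHaar_closedBall _ _ (by positivity), ENNReal.toReal_mul,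
        ENNReal.toReal_ofReal (by positivity)]
      simp only [finrank_euclideanSpace, Fintype.card_fin]
      congr 1
      rw [hvdef, Measure.real, Measure.addHaar_closedBall_eq_addHaar_ball]
    rw [h2]
    simp only [c]
    rw [div_pow]
    apply le_of_eq
    ring)
  have h3 : cube N k (idx N k z) ⊆ closedBall z r := by
    intro y hy
    rw [mem_closedBall]
    refine (cube_dist hN hy).trans ?_
    calc n * hh N k ≤ n * (r / (4 * n)) := by gcongr
      _ = r / 4 := by field_simp
      _ ≤ r := by linarith
  unfold BadAt
  refine (mu_real_mono hw.cont isBounded_closedBall h3).trans (h1.trans ?_)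
  calc C2 * (mu ω).real (bb a b) ≤ D * (ρ ^ 2 / 4 / D * β * r ^ 2) ^ n := by
        gcongr
        exact le_max_left _ _
    _ ≤ D ^ n * (ρ ^ 2 / 4 / D * β * r ^ 2) ^ n := by
        gcongr
        exact le_self_pow₀ hD1 hn0
    _ = (β * (r / (4 * n) / 2) ^ 2) ^ n := by
        rw [← mul_pow]; congr 1
        simp only [ρ]; field_simp; norm_num
    _ ≤ (β * hh N k ^ 2) ^ n := by gcongr

lemma lower_local {P KA C : ℝ} (hw : SW n ω P KA C) : ∃ c > 0, ∀ (s : Prm) (β : ℝ), s.Ok n β →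
    ∀ (m : ℕ) (z : ℕ → E n) (e : ℕ → ℝ), (∀ l < m, Step ω s (z l) (z (l+1)) (e l)) →
    (∀ i ≤ m, ∀ j ≤ m, dist (z i) (z j) ≤ 4 * n * hh s.N s.κ2) →
    ∀ d i j, j = i + d → j ≤ m → c * β * dist (z i) (z j) ^ 2 ≤ ∑ l ∈ Finset.Ico i j, e l := by
  obtain ⟨c1, hc1, hbad⟩ := bad_of_small hw
  obtain ⟨CJ, hCJ, hjump⟩ := jump_conn hw
  have hn1 : (1:ℝ) ≤ n := by have := hw.hn; exact_mod_cast (by omega : 1 ≤ n)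
  have hn0 : n ≠ 0 := by have := hw.hn; omega
  have hC := hw.hC
  let CJ' := max CJ 1
  have hCJ1 : 1 ≤ CJ' := le_max_right _ _
  let ρ : ℝ := 1 / (4 * n)
  let c := min (c1 / (C * CJ')) (min ((ρ/2)^2) 1)
  have hc : 0 < c := by simp only [c, ρ]; positivity
  refine ⟨c, hc, ?_⟩
  intro s β hs m z e hst hd d
  have hN := hs.hN
  have hβ := hs.hβ
  induction d using Nat.strong_induction_on with
  | _ d ih =>
  intro i j hj hjm
  have he : ∀ l < m, 0 ≤ e l := fun l hl => (hst l hl).nonneg hw.pos hs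
  set a := z i with ha
  set b := z j with hb
  have hsum0 : 0 ≤ ∑ l ∈ Finset.Ico i j, e l :=
    Finset.sum_nonneg fun l hl => he l (by have := (Finset.mem_Ico.1 hl).2; omega)
  by_cases hab : a = b
  · rw [hab, dist_self]; simpa using hsum0
  set r := dist a b with hr
  have hr0 : 0 < r := dist_pos.2 hab
  have hrh : r ≤ 4 * n * hh s.N s.κ2 := hd i (by omega) j hjm
  by_cases hsplit : ∃ l, i < l ∧ l < j ∧ r ^ 2 ≤ dist a (z l) ^ 2 + dist (z l) b ^ 2
  · obtain ⟨l, h1, h2, h3⟩ := hsplit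
    have i1 := ih (l - i) (by omega) i l (by omega) (by omega)
    have i2 := ih (j - l) (by omega) l j (by omega) (by omega)
    rw [← Finset.sum_Ico_consecutive e h1.le h2.le]
    have : c * β * r ^ 2 ≤ c * β * (dist a (z l) ^ 2 + dist (z l) b ^ 2) := by gcongr
    linarith
  push Not at hsplit
  have hin : ∀ l, i ≤ l → l ≤ j → z l ∈ bb a b := by
    intro l h1 h2
    rcases h1.eq_or_lt with rfl | h1
    · exact left_mem_bb _ _
    rcases h2.eq_or_lt with rfl | h2
    · exact right_mem_bb _ _
    exact thales (hsplit l h1 h2).le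
  by_cases hmass : (mu ω).real (bb a b) < (c1 * β * r ^ 2) ^ n
  · -- small mass
    have hρr : r / (4 * n) ≤ hh s.N s.κ2 := by
      rw [div_le_iff₀ (by positivity)]; linarith
    obtain ⟨k, hk, hk1, hk2⟩ := exists_level hN s.κ2 (t := r / (4 * n)) (by positivity) hρr
    have hB : ∀ l, i ≤ l → l ≤ j → BadAt ω s.N β k (z l) := fun l h1 h2 =>
      hbad s.N β hN hβ k a b (z l) hab (hin l h1 h2) hk1 hk2 hmass
    have hU1 : ∀ l, i ≤ l → l ≤ j → z l ∈ UU ω s.N s.β1 s.κ1 := fun l h1 h2 =>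
      ⟨k, hs.k1.trans hk, (hB l h1 h2).mono hβ.le hs.h1⟩
    have hU2 : ∀ l, i ≤ l → l ≤ j → z l ∈ UU ω s.N s.β2 s.κ2 := fun l h1 h2 =>
      ⟨k, hk, (hB l h1 h2).mono hβ.le hs.h2⟩
    have hcc : c * β * r ^ 2 ≤ β * (r / (4 * n) / 2) ^ 2 := by
      have : c ≤ (ρ/2)^2 := (min_le_right _ _).trans (min_le_left _ _)
      calc c * β * r ^ 2 ≤ (ρ/2)^2 * β * r ^ 2 := by gcongr
        _ = _ := by simp only [ρ]; field_simp
    have key : ∀ l, i ≤ l → l < j → β * (r / (4 * n) / 2) ^ 2 ≤ e l ∨ s.M * dist (z l) (z (l+1)) ≤ e l := by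
      intro l h1 h2
      rcases hst l (by omega) with ⟨h3, h4, h5⟩ | ⟨h3, h4, h5⟩ | ⟨k', h3, h4, h5⟩ | ⟨k', h3, h4, h5⟩
      · exact Or.inr h4
      · have a1 := hU1 l h1 h2.le
        have a2 := hU1 (l+1) (by omega) (by omega)
        have a3 := hU2 l h1 h2.le
        have a4 := hU2 (l+1) (by omega) (by omega)
        tauto
      · left
        have hkk : k' ≤ k := by
          by_contra hlt
          exact h3.2.2 k (hs.k1.trans hk) (by omega) ((hB l h1 h2.le).mono hβ.le hs.h1)
        have := hh_anti hN hkk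
        have h6 := hs.h1
        exact le_trans (mul_le_mul h6 (pow_le_pow_left₀ (by positivity) (by linarith) 2) (by positivity) (by linarith)) h5
      · left
        have hkk : k' ≤ k := by
          by_contra hlt
          exact h3.2.2 k hk (by omega) ((hB l h1 h2.le).mono hβ.le hs.h2)
        have := hh_anti hN hkk
        have h6 := hs.h2
        exact le_trans (mul_le_mul h6 (pow_le_pow_left₀ (by positivity) (by linarith) 2) (by positivity) (by linarith)) h5
    by_cases hbig : ∃ l, i ≤ l ∧ l < j ∧ β * (r / (4 * n) / 2) ^ 2 ≤ e l
    · obtain ⟨l, h1, h2, h3⟩ := hbig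
      refine hcc.trans (h3.trans ?_)
      exact Finset.single_le_sum (f := e) (fun l hl => he l (by have := (Finset.mem_Ico.1 hl).2; omega))
        (Finset.mem_Ico.2 ⟨h1, h2⟩)
    · push Not at hbig
      have h4 : s.M * r ≤ ∑ l ∈ Finset.Ico i j, e l := by
        have h5 : r ≤ ∑ l ∈ Finset.Ico i j, dist (z l) (z (l+1)) := dist_le_Ico_sum_dist z (by omega)
        calc s.M * r ≤ s.M * ∑ l ∈ Finset.Ico i j, dist (z l) (z (l+1)) := by
              have := hs.hM0; gcongr
          _ = ∑ l ∈ Finset.Ico i j, s.M * dist (z l) (z (l+1)) := Finset.mul_sum _ _ _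
          _ ≤ _ := by
            apply Finset.sum_le_sum
            intro l hl
            obtain ⟨h1, h2⟩ := Finset.mem_Ico.1 hl
            exact (key l h1 h2).resolve_left (not_le.2 (hbig l h1 h2))
      refine le_trans ?_ h4
      have hc1' : c ≤ 1 := (min_le_right _ _).trans (min_le_right _ _)
      calc c * β * r ^ 2 ≤ 1 * β * r ^ 2 := by gcongr
        _ = (r * β) * r := by ring
        _ ≤ (4 * n * hh s.N s.κ2 * β) * r := by gcongr
        _ ≤ s.M * r := by have := hs.hM; gcongr
  · push Not at hmass
    have hconn1 : ∀ l, i ≤ l → l < j → Conn ω (bb a b) (z l) (z (l+1)) (CJ' * e l) := by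
      intro l h1 h2
      have hel := he l (by omega)
      have hle : e l ≤ CJ' * e l := by nlinarith
      have hsegm : segment ℝ (z l) (z (l+1)) ⊆ bb a b :=
        (convex_closedBall _ _).segment_subset (hin l h1 h2.le) (hin (l+1) (by omega) (by omega))
      have hCJle : CJ * e l ≤ CJ' * e l := by gcongr; exact le_max_left _ _
      rcases hst l (by omega) with ⟨h3, h4, h5⟩ | ⟨h3, h4, h5⟩ | ⟨k', h3, h4, h5⟩ | ⟨k', h3, h4, h5⟩
      · exact Conn.segment hw.pos hw.cont hsegm fun x hx => (h5 x hx).trans hle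
      · exact Conn.segment hw.pos hw.cont hsegm fun x hx => (h5 x hx).trans hle
      · refine (hjump s.N s.β1 hN (hβ.trans_le hs.h1) k' _ _ a b (hin l h1 h2.le)
          (hin (l+1) (by omega) (by omega)) h4 h3.2.1).mono le_rfl (le_trans ?_ hCJle)
        gcongr
      · refine (hjump s.N s.β2 hN (hβ.trans_le hs.h2) k' _ _ a b (hin l h1 h2.le)
          (hin (l+1) (by omega) (by omega)) h4 h3.2.1).mono le_rfl (le_trans ?_ hCJle)
        gcongr
    have hconn : ∀ l, i + l ≤ j → Conn ω (bb a b) a (z (i + l)) (CJ' * ∑ q ∈ Finset.Ico i (i+l), e q) := by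
      intro l
      induction l with
      | zero => intro _; simpa using Conn.refl (left_mem_bb a b)
      | succ l ihl =>
        intro h
        have h1 := (ihl (by omega)).trans hw.pos hw.cont (hconn1 (i+l) (by omega) (by omega))
        rw [← add_assoc, Finset.sum_Ico_succ_top (by omega), mul_add]
        exact h1
    have h1 := hconn d (by omega)
    rw [← hj] at h1
    have h2 := hw.lower a b _ h1
    have h3 : c1 * β * r ^ 2 ≤ ((mu ω).real (bb a b)) ^ ((1:ℝ)/n) := by
      have : ((c1 * β * r ^ 2) ^ n) ^ ((1:ℝ)/n) ≤ ((mu ω).real (bb a b)) ^ ((1:ℝ)/n) := by gcongr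
      rwa [one_div, Real.pow_rpow_inv_natCast (by positivity) hn0, ← one_div] at this
    have h4 : c ≤ c1 / (C * CJ') := min_le_left _ _
    rw [le_div_iff₀ (by positivity)] at h4
    have h5 : (c * (C * CJ')) * (β * r ^ 2) ≤ C * (CJ' * ∑ l ∈ Finset.Ico i j, e l) := by
      refine le_trans ?_ (h3.trans h2)
      rw [mul_assoc c1]; gcongr
    have h6 : (C * CJ') * (c * β * r ^ 2) ≤ (C * CJ') * ∑ l ∈ Finset.Ico i j, e l := by
      calc _ = (c * (C * CJ')) * (β * r ^ 2) := by ring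
        _ ≤ _ := h5
        _ = _ := by ring
    exact le_of_mul_le_mul_left h6 (by positivity)

end SA
end

section
open MeasureTheory Metric Set
open scoped ENNReal

namespace SA
variable {n : ℕ} {ω : E n → ℝ}

lemma Step.dist_le (hn : 1 ≤ n) {s : Prm} {β : ℝ} (hs : s.Ok n β) (hk : s.κ2 ≤ s.κ1 + 1) {p q : E n} {e : ℝ}
    (h : Step ω s p q e) : dist p q ≤ 2 * n * hh s.N s.κ2 := by
  have hn1 : (1:ℝ) ≤ n := by exact_mod_cast hn
  have hp := hh_pos hs.hN s.κ2
  have aux : hh s.N s.κ2 ≤ 2 * n * hh s.N s.κ2 := by nlinarith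
  have aux2 : ∀ k, s.κ1 ≤ k → idx s.N k p = idx s.N k q → dist p q ≤ 2 * n * hh s.N s.κ2 := by
    intro k hk1 hi
    have h1 := cube_dist hs.hN hi
    have h2 := hh_anti hs.hN hk1
    have h3 := hh_succ s.N s.κ1
    have h4 := hh_anti hs.hN hk
    calc dist p q ≤ n * hh s.N k := h1
      _ ≤ n * (2 * hh s.N s.κ2) := by gcongr; linarith
      _ = _ := by ring
  rcases h with ⟨h1, h2, h3⟩ | ⟨h1, h2, h3⟩ | ⟨k, h1, h2, h3⟩ | ⟨k, h1, h2, h3⟩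
  · exact h1.trans aux
  · exact h1.trans aux
  · exact aux2 k h1.1 h2
  · exact aux2 k (hs.k1.trans h1.1) h2

lemma lower_global {P KA C : ℝ} (hw : SW n ω P KA C) : ∃ c > 0, ∀ (s : Prm) (β : ℝ), s.Ok n β →
    s.κ2 ≤ s.κ1 + 1 →
    ∀ (m : ℕ) (z : ℕ → E n) (e : ℕ → ℝ), (∀ l < m, Step ω s (z l) (z (l+1)) (e l)) →
    hh s.N s.κ2 ≤ dist (z 0) (z m) → c * β * hh s.N s.κ2 ^ 2 ≤ ∑ l ∈ Finset.range m, e l := by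
  classical
  obtain ⟨c, hc, H⟩ := lower_local hw
  have hn1 : (1:ℝ) ≤ n := by have := hw.hn; exact_mod_cast (by omega : 1 ≤ n)
  refine ⟨c, hc, ?_⟩
  intro s β hs hk m z e hst hd
  set h := hh s.N s.κ2 with hhdef
  have hp : 0 < h := hh_pos hs.hN s.κ2
  have hβ := hs.hβ
  have hex : ∃ l, h ≤ dist (z 0) (z l) := ⟨m, hd⟩
  set l0 := Nat.find hex with hl0
  have hl0m : l0 ≤ m := Nat.find_min' hex hd
  have h1 : h ≤ dist (z 0) (z l0) := Nat.find_spec hex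
  have hlt : ∀ l < l0, dist (z 0) (z l) ≤ h := fun l hl => (not_le.1 (Nat.find_min hex hl)).le
  have hl00 : l0 ≠ 0 := by
    intro h0; rw [h0, dist_self] at h1; linarith
  obtain ⟨l1, hl1⟩ : ∃ l1, l0 = l1 + 1 := ⟨l0 - 1, by omega⟩
  have hlast : dist (z 0) (z l0) ≤ h + 2 * n * h := by
    have h2 := hlt l1 (by omega)
    have h3 := (hst l1 (by omega)).dist_le (by have := hw.hn; omega) hs hk
    rw [hl1]
    exact (dist_triangle _ (z l1) _).trans (add_le_add h2 h3)
  have hle : ∀ l ≤ l0, dist (z 0) (z l) ≤ h + 2 * n * h := by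
    intro l hl
    rcases hl.eq_or_lt with rfl | hl
    · exact hlast
    · have := hlt l hl; nlinarith
  have hpair : ∀ i ≤ l0, ∀ j ≤ l0, dist (z i) (z j) ≤ 4 * n * h := by
    intro i hi j hj
    rcases hi.eq_or_lt with h2 | hi'
    · rcases hj.eq_or_lt with h3 | hj'
      · rw [h2, h3, dist_self]; positivity
      · have := dist_triangle_left (z i) (z j) (z 0)
        have a1 := hle i hi
        have a2 := hlt j hj'
        nlinarith
    · have := dist_triangle_left (z i) (z j) (z 0)
      have a1 := hlt i hi'
      have a2 := hle j hj
      nlinarith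
  have h2 := H s β hs l0 z e (fun l hl => hst l (by omega)) hpair l0 0 l0 (by omega) le_rfl
  rw [← Finset.range_eq_Ico] at h2
  calc c * β * h ^ 2 ≤ c * β * dist (z 0) (z l0) ^ 2 := by gcongr
    _ ≤ _ := h2
    _ ≤ _ := Finset.sum_le_sum_of_subset_of_nonneg (Finset.range_mono hl0m) fun l hl _ =>
      (hst l (Finset.mem_range.1 hl)).nonneg hw.pos hs

def chSet (ω : E n → ℝ) (s : Prm) (L : ℝ) (i : Fin n) (τ : ℝ) (x : E n) : Set ℝ :=
  insert L {S | ∃ (m : ℕ) (z : ℕ → E n) (e : ℕ → ℝ), z 0 = x ∧ z m i ≤ τ ∧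
    (∀ l < m, Step ω s (z l) (z (l+1)) (e l)) ∧ S = ∑ l ∈ Finset.range m, e l}

noncomputable def phi (ω : E n → ℝ) (s : Prm) (L : ℝ) (i : Fin n) (τ : ℝ) (x : E n) : ℝ :=
  sInf (chSet ω s L i τ x) / L

section
variable {s : Prm} {β L τ : ℝ} {i : Fin n}

lemma chSet_nonneg (hpos : ∀ x, 0 < ω x) (hs : s.Ok n β) (hL : 0 < L) (x : E n) :
    ∀ S ∈ chSet ω s L i τ x, 0 ≤ S := by
  rintro S (rfl | ⟨m, z, e, h1, h2, h3, rfl⟩)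
  · exact hL.le
  · exact Finset.sum_nonneg fun l hl => (h3 l (Finset.mem_range.1 hl)).nonneg hpos hs

lemma chSet_bdd (hpos : ∀ x, 0 < ω x) (hs : s.Ok n β) (hL : 0 < L) (x : E n) :
    BddBelow (chSet ω s L i τ x) := ⟨0, fun S hS => chSet_nonneg hpos hs hL x S hS⟩

lemma phi_nonneg (hpos : ∀ x, 0 < ω x) (hs : s.Ok n β) (hL : 0 < L) (x : E n) :
    0 ≤ phi ω s L i τ x :=
  div_nonneg (Real.sInf_nonneg (chSet_nonneg hpos hs hL x)) hL.le

lemma phi_le_one (hpos : ∀ x, 0 < ω x) (hs : s.Ok n β) (hL : 0 < L) (x : E n) :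
    phi ω s L i τ x ≤ 1 := by
  unfold phi
  rw [div_le_one hL]
  exact csInf_le (chSet_bdd hpos hs hL x) (mem_insert _ _)

lemma phi_lo (hpos : ∀ x, 0 < ω x) (hs : s.Ok n β) (hL : 0 < L) {x : E n} (hx : x i ≤ τ) :
    phi ω s L i τ x = 0 := by
  refine le_antisymm ?_ (phi_nonneg hpos hs hL x)
  unfold phi
  apply div_nonpos_of_nonpos_of_nonneg _ hL.le
  refine csInf_le (chSet_bdd hpos hs hL x) (Or.inr ⟨0, fun _ => x, fun _ => 0, rfl, hx, by simp, by simp⟩)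

lemma phi_step (hpos : ∀ x, 0 < ω x) (hs : s.Ok n β) (hL : 0 < L) {p q : E n} {e : ℝ}
    (h : Step ω s p q e) : phi ω s L i τ p - phi ω s L i τ q ≤ e / L := by
  have he := h.nonneg hpos hs
  unfold phi
  rw [← sub_div]
  gcongr
  rw [sub_le_iff_le_add, ← sub_le_iff_le_add']
  refine le_csInf ⟨L, mem_insert _ _⟩ ?_
  rintro S (rfl | ⟨m, z, e', h1, h2, h3, rfl⟩)
  · have := csInf_le (chSet_bdd (i := i) (τ := τ) hpos hs hL p) (mem_insert _ _)
    linarith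
  · rw [sub_le_iff_le_add]
    refine csInf_le (chSet_bdd hpos hs hL p) (Or.inr ⟨m+1, fun l => Nat.casesOn l p z, fun l => Nat.casesOn l e e', rfl, h2, ?_, ?_⟩)
    · rintro (_ | l) hl
      · change Step ω s p (z 0) e
        rw [h1]; exact h
      · exact h3 l (by omega)
    · rw [Finset.sum_range_succ']; rfl

lemma phi_step_abs (hpos : ∀ x, 0 < ω x) (hs : s.Ok n β) (hL : 0 < L) {p q : E n} {e : ℝ}
    (h : Step ω s p q e) : |phi ω s L i τ p - phi ω s L i τ q| ≤ e / L := by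
  rw [abs_le]
  have h1 := phi_step (i := i) (τ := τ) hpos hs hL h
  have h2 := phi_step (i := i) (τ := τ) hpos hs hL h.symm
  constructor <;> linarith
end

noncomputable def bt (ω : E n → ℝ) (N η : ℝ) (k : ℕ) (x0 : E n) : ℝ :=
  η * ((mu ω).real (cube N k (idx N k x0))) ^ ((1:ℝ)/n) / hh N k ^ 2

structure Adm (ω : E n → ℝ) (N η C1 : ℝ) (k : ℕ) (x0 : E n) (Φ : E n → Fin n → ℝ) : Prop where
  nonneg : ∀ x i, 0 ≤ Φ x i
  le_one : ∀ x i, Φ x i ≤ 1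
  lo : ∀ x i, x i ≤ -N + hh N k * idx N k x0 i → Φ x i = 0
  hi : ∀ x i, -N + hh N k * idx N k x0 i + hh N k ≤ x i → Φ x i = 1
  lip : ∃ K, LipschitzOnWith K Φ {x | ∀ i, |x i| ≤ N}
  good : ∀ x y A, x ∉ UU ω N (bt ω N η k x0) k → dist x y ≤ hh N (k+1) →
    (∀ z ∈ segment ℝ x y, wt ω z ≤ A) → ∀ i, |Φ x i - Φ y i| ≤
      C1 / (η * ((mu ω).real (cube N k (idx N k x0))) ^ ((1:ℝ)/n)) * A * dist x y
  jump : ∀ j p q, MaxBad ω N (bt ω N η k x0) k j p → idx N j p = idx N j q →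
    ∀ i, |Φ p i - Φ q i| ≤ C1 * (hh N j / hh N k) ^ 2

lemma cube_mass_pos {P KA C : ℝ} (hw : SW n ω P KA C) {N : ℝ} (hN : 0 < N) (k : ℕ) (j : Fin n → ℤ) :
    0 < (mu ω).real (cube N k j) := by
  have h := hh_pos hN k
  refine ENNReal.toReal_pos (mu_pos hw.pos hw.cont (cube_meas hN k j) ?_) (mu_lt_top hw.cont (cube_bdd hN k j)).ne
  rw [cube_vol hN]; simp; positivity

lemma cube_anti {N : ℝ} {k l : ℕ} (h : k ≤ l) (x0 : E n) :
    cube N l (idx N l x0) ⊆ cube N k (idx N k x0) := fun _ hy => idx_eq_of_le h hy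

lemma child_mass {P KA C : ℝ} (hw : SW n ω P KA C) : ∃ C3 ≥ 1, ∀ N, 0 < N → ∀ (k : ℕ) (x0 : E n),
    (mu ω).real (cube N k (idx N k x0)) ≤ C3 * (mu ω).real (cube N (k+1) (idx N (k+1) x0)) := by
  have hn1 : (1:ℝ) ≤ n := by have := hw.hn; exact_mod_cast (by omega : 1 ≤ n)
  let c : ℝ := 1 / (2 * n) ^ n
  have hc : 0 < c := by positivity
  refine ⟨max 1 (KA * (volume.real (closedBall (0 : E n) 1) / c) ^ P), le_max_left _ _, ?_⟩
  intro N hN k x0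
  have hk := hh_pos hN k
  have h0 : cube N k (idx N k x0) ⊆ closedBall x0 (n * hh N k) := fun y hy => cube_dist hN hy
  have h1 := hw.ap_vol (x := x0) (R := n * hh N k) (c := c) (by positivity) hc
    ((cube_anti (Nat.le_succ k) x0).trans h0) (cube_meas hN _ _) (by
      rw [Measure.real, cube_vol hN, ENNReal.toReal_ofReal (by have := hh_pos hN (k+1); positivity)]
      simp only [c]
      rw [hh_succ N k]
      apply le_of_eq
      rw [show (n:ℝ) * (2 * hh N (k+1)) = (2 * n) * hh N (k+1) by ring, mul_pow (2 * (n:ℝ))]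
      field_simp)
  refine (mu_real_mono hw.cont isBounded_closedBall h0).trans (h1.trans ?_)
  gcongr
  exact le_max_right _ _

set_option maxHeartbeats 1000000 in
theorem exists_adm {P KA C : ℝ} (hw : SW n ω P KA C) : ∃ C1 > 0, ∀ N η, 0 < N → 0 < η →
    ∀ (k : ℕ) (x0 : E n), ∃ Φ, Adm ω N η C1 k x0 Φ ∧ Adm ω N η C1 (k+1) x0 Φ := by
  obtain ⟨c0, hc0, H⟩ := lower_global hw
  obtain ⟨C3, hC3, hch⟩ := child_mass hw
  have hn1 : (1:ℝ) ≤ n := by have := hw.hn; exact_mod_cast (by omega : 1 ≤ n)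
  set θ := C3 ^ ((1:ℝ)/n) with hθ
  have hθ1 : 1 ≤ θ := Real.one_le_rpow hC3 (by positivity)
  refine ⟨16 * θ / c0, by positivity, ?_⟩
  intro N η hN hη k x0
  set a := ((mu ω).real (cube N k (idx N k x0))) ^ ((1:ℝ)/n) with ha
  set a' := ((mu ω).real (cube N (k+1) (idx N (k+1) x0))) ^ ((1:ℝ)/n) with ha'
  have ha0 : 0 < a := Real.rpow_pos_of_pos (cube_mass_pos hw hN _ _) _
  have ha0' : 0 < a' := Real.rpow_pos_of_pos (cube_mass_pos hw hN _ _) _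
  have haa : a' ≤ a := by
    have := mu_real_mono hw.cont (cube_bdd hN k (idx N k x0)) (cube_anti (Nat.le_succ k) x0)
    simp only [ha, ha']; gcongr
  have haθ : a ≤ θ * a' := by
    rw [hθ, ha', ← Real.mul_rpow (by linarith) (by positivity)]
    have := hch N hN k x0
    simp only [ha]; gcongr
  set h := hh N (k+1) with hhd
  have hh0 : 0 < h := hh_pos hN _
  have hhk : hh N k = 2 * h := hh_succ N k
  set β1 := bt ω N η k x0 with hβ1
  set β2 := bt ω N η (k+1) x0 with hβ2
  have e1 : β1 = η * a / (4 * h ^ 2) := by 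
    have : β1 = η * a / (hh N k) ^ 2 := rfl
    rw [this, hhk]; ring
  have e2 : β2 = η * a' / h ^ 2 := rfl
  have hb1 : 0 < β1 := by rw [e1]; positivity
  have hb2 : 0 < β2 := by rw [e2]; positivity
  set β := min β1 β2 with hβ
  have hβ0 : 0 < β := lt_min hb1 hb2
  have hlow : η * a / (4 * θ * h ^ 2) ≤ β := by
    apply le_min
    · rw [e1]; gcongr; nlinarith [sq_nonneg h]
    · rw [e2]
      rw [div_le_div_iff₀ (by positivity) (by positivity)]
      have : η * a * h ^ 2 ≤ η * (θ * a') * h ^ 2 := by gcongr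
      have h0 : 0 ≤ η * (θ * a') * h ^ 2 := by positivity
      nlinarith
  have hβ1le : β1 ≤ θ * β := by
    rw [e1]
    calc η * a / (4 * h ^ 2) = θ * (η * a / (4 * θ * h ^ 2)) := by field_simp
      _ ≤ θ * β := by gcongr
  have hβ2le : β2 ≤ 4 * θ * β := by
    rw [e2]
    calc η * a' / h ^ 2 ≤ η * a / h ^ 2 := by gcongr
      _ = 4 * θ * (η * a / (4 * θ * h ^ 2)) := by field_simp
      _ ≤ _ := by gcongr
  let s : Prm := ⟨N, β1, β2, 4 * n * h * β, k, k+1⟩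
  have hs : s.Ok n β := ⟨hN, hβ0, min_le_left _ _, min_le_right _ _, Nat.le_succ k, le_rfl, by
    change 0 ≤ 4 * n * h * β; positivity⟩
  set L := c0 * β * h ^ 2 with hLdef
  have hL : 0 < L := by positivity
  have hLlow : c0 * η * a / (4 * θ) ≤ L := by
    calc c0 * η * a / (4 * θ) = c0 * (η * a / (4 * θ * h ^ 2)) * h ^ 2 := by field_simp
      _ ≤ _ := by simp only [hLdef]; gcongr
  have hLi : 1 / L ≤ 16 * θ / c0 / (η * a) := by
    rw [div_div, div_le_div_iff₀ hL (by positivity)]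
    rw [div_le_iff₀ (by positivity)] at hLlow
    have : 0 < L * θ := by positivity
    nlinarith
  have hLi' : 1 / L ≤ 16 * θ / c0 / (η * a') := by
    refine hLi.trans ?_; gcongr
  let Φ : E n → Fin n → ℝ := fun x i => phi ω s L i (-N + h * idx N (k+1) x0 i) x
  have hx1 : ∀ i, -N + hh N k * idx N k x0 i ≤ -N + h * idx N (k+1) x0 i ∧
      -N + h * idx N (k+1) x0 i + h ≤ -N + hh N k * idx N k x0 i + hh N k := by
    intro i
    have h1 := idx_succ N k x0 i
    set m := idx N (k+1) x0 i
    set m' := idx N k x0 i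
    have h2 : 2 * m' ≤ m := by omega
    have h3 : m ≤ 2 * m' + 1 := by omega
    have h2' : 2 * (m':ℝ) ≤ m := by exact_mod_cast h2
    have h3' : (m:ℝ) ≤ 2 * (m':ℝ) + 1 := by exact_mod_cast h3
    rw [hhk]
    constructor <;> nlinarith
  have hlo : ∀ x i, x i ≤ -N + h * idx N (k+1) x0 i → Φ x i = 0 := fun x i hx =>
    phi_lo hw.pos hs hL hx
  have hhi : ∀ x i, -N + h * idx N (k+1) x0 i + h ≤ x i → Φ x i = 1 := by
    intro x i hx
    refine le_antisymm (phi_le_one hw.pos hs hL x) ?_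
    change 1 ≤ phi ω s L i _ x
    unfold phi
    rw [one_le_div hL]
    refine le_csInf ⟨L, mem_insert _ _⟩ ?_
    rintro S (rfl | ⟨m, z, e', h1, h2, h3, rfl⟩)
    · exact le_rfl
    · refine H s β hs le_rfl m z e' h3 ?_
      change h ≤ _
      rw [h1, dist_eq_norm]
      refine le_trans ?_ (PiLp.norm_apply_le (x - z m) i)
      rw [PiLp.sub_apply, Real.norm_eq_abs]
      exact le_trans (by linarith) (le_abs_self _)
  have hlip : ∃ K, LipschitzOnWith K Φ {x | ∀ i, |x i| ≤ N} := by
    have hbd : Bornology.IsBounded {x : E n | ∀ i, |x i| ≤ N} :=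
      isBounded_closedBall.subset (t := closedBall 0 (n * N)) fun x hx => by
        rw [mem_closedBall_zero_iff]; exact norm_le_card hx
    obtain ⟨r, hr⟩ := hbd.subset_closedBall 0
    obtain ⟨W, hW⟩ := (isCompact_closedBall (0 : E n) r).bddAbove_image (wt_cont hw.pos hw.cont).continuousOn
    have hW' : ∀ z ∈ closedBall (0 : E n) r, wt ω z ≤ W := fun z hz => hW (mem_image_of_mem _ hz)
    set B := (|W| + s.M) / L + 1 / h with hB
    have hM0 := hs.hM0
    have hB0 : 0 ≤ B := by positivity
    refine ⟨⟨B, hB0⟩, LipschitzOnWith.of_dist_le_mul fun x hx y hy => ?_⟩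
    rw [dist_pi_le_iff (by positivity)]
    intro i
    rw [Real.dist_eq]
    change _ ≤ B * dist x y
    have hd0 : 0 ≤ dist x y := dist_nonneg
    by_cases hxy : dist x y ≤ h
    · have hst : Step ω s x y ((|W| + s.M) * dist x y) := by
        refine Or.inl ⟨hxy, ?_, fun z hz => ?_⟩
        · gcongr; linarith [abs_nonneg W]
        · have h1 := hW' z ((convex_closedBall _ _).segment_subset (hr hx) (hr hy) hz)
          gcongr
          linarith [le_abs_self W]
      refine (phi_step_abs hw.pos hs hL hst).trans ?_
      have : 0 ≤ 1 / h * dist x y := by positivity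
      calc (|W| + s.M) * dist x y / L = (|W| + s.M) / L * dist x y := by ring
        _ ≤ (|W| + s.M) / L * dist x y + 1 / h * dist x y := by linarith
        _ = B * dist x y := by rw [hB, add_mul]
    · push Not at hxy
      have h1 : |Φ x i - Φ y i| ≤ 1 := by
        rw [abs_le]
        have a1 := phi_le_one (i := i) (τ := -N + h * idx N (k+1) x0 i) hw.pos hs hL x
        have a2 := phi_le_one (i := i) (τ := -N + h * idx N (k+1) x0 i) hw.pos hs hL y
        have a3 := phi_nonneg (i := i) (τ := -N + h * idx N (k+1) x0 i) hw.pos hs hL x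
        have a4 := phi_nonneg (i := i) (τ := -N + h * idx N (k+1) x0 i) hw.pos hs hL y
        constructor <;> simp only [Φ] <;> linarith
      refine h1.trans ?_
      have h2 : 1 ≤ 1 / h * dist x y := by
        rw [one_div, inv_mul_eq_div, one_le_div hh0]; exact hxy.le
      have h3 : 0 ≤ (|W| + s.M) / L * dist x y := by positivity
      rw [hB, add_mul]; linarith
  have hgood : ∀ x y A, (x ∉ UU ω N β1 k ∨ x ∉ UU ω N β2 (k+1)) → dist x y ≤ h →
      (∀ z ∈ segment ℝ x y, wt ω z ≤ A) → ∀ i, |Φ x i - Φ y i| ≤ 1 / L * (A * dist x y) := by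
    intro x y A hx hxy hA i
    have hst : Step ω s x y (A * dist x y) := by
      refine Or.inr (Or.inl ⟨hxy, ?_, fun z hz => ?_⟩)
      · rcases hx with hx | hx
        · exact Or.inl (Or.inl hx)
        · exact Or.inr (Or.inl hx)
      · have := hA z hz; gcongr
    refine (phi_step_abs hw.pos hs hL hst).trans (le_of_eq ?_)
    ring
  refine ⟨Φ, ⟨fun x i => phi_nonneg hw.pos hs hL x, fun x i => phi_le_one hw.pos hs hL x, 
      fun x i hx => hlo x i (hx.trans (hx1 i).1), fun x i hx => hhi x i ((hx1 i).2.trans hx), hlip, ?_, ?_⟩,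
    ⟨fun x i => phi_nonneg hw.pos hs hL x, fun x i => phi_le_one hw.pos hs hL x, 
      hlo, hhi, hlip, ?_, ?_⟩⟩
  · intro x y A hx hxy hA i
    have hA0 : 0 ≤ A := (wt_pos hw.pos x).le.trans (hA x (left_mem_segment _ _ _))
    refine (hgood x y A (Or.inl hx) hxy hA i).trans ?_
    rw [mul_assoc]
    gcongr
  · intro j p q hp hq i
    have hst : Step ω s p q (β1 * hh N j ^ 2) := Or.inr (Or.inr (Or.inl ⟨j, hp, hq, le_rfl⟩))
    refine (phi_step_abs hw.pos hs hL hst).trans ?_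
    rw [hhk, div_le_iff₀ hL, hLdef]
    calc β1 * hh N j ^ 2 ≤ (4 * θ * β) * hh N j ^ 2 := by gcongr; nlinarith [mul_pos (by linarith : 0 < θ) hβ0]
      _ = _ := by field_simp; norm_num; ring
  · intro x y A hx hxy hA i
    have hA0 : 0 ≤ A := (wt_pos hw.pos x).le.trans (hA x (left_mem_segment _ _ _))
    refine (hgood x y A (Or.inr hx) (hxy.trans (hh_anti hN (Nat.le_succ _))) hA i).trans ?_
    rw [mul_assoc]
    gcongr
  · intro j p q hp hq i
    have hst : Step ω s p q (β2 * hh N j ^ 2) := Or.inr (Or.inr (Or.inr ⟨j, hp, hq, le_rfl⟩))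
    refine (phi_step_abs hw.pos hs hL hst).trans ?_
    rw [div_le_iff₀ hL, hLdef]
    calc β2 * hh N j ^ 2 ≤ (16 * θ * β) * hh N j ^ 2 := by gcongr; nlinarith [mul_pos (by linarith : 0 < θ) hβ0]
      _ = 16 * θ / c0 * (hh N j / h) ^ 2 * (c0 * β * h ^ 2) := by field_simp

end SA
end

section
open MeasureTheory Metric Set
open scoped ENNReal

namespace SA

lemma det_bound {ι : Type*} [Fintype ι] [DecidableEq ι] (M : Matrix ι ι ℝ) (r c : ι → ℝ)
    (h : ∀ i j, |M i j| ≤ r i * c j) :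
    |M.det| ≤ (Fintype.card ι).factorial * ((∏ i, r i) * ∏ i, c i) := by
  rw [Matrix.det_apply]
  refine (Finset.abs_sum_le_sum_abs _ _).trans ?_
  calc ∑ σ : Equiv.Perm ι, |Equiv.Perm.sign σ • ∏ i, M (σ i) i|
      ≤ ∑ σ : Equiv.Perm ι, (∏ i, r i) * ∏ i, c i := by
        apply Finset.sum_le_sum
        intro σ _
        have : |Equiv.Perm.sign σ • ∏ i, M (σ i) i| = ∏ i, |M (σ i) i| := by
          rw [← Finset.abs_prod]
          rcases Int.units_eq_one_or (Equiv.Perm.sign σ) with h | h <;> rw [h] <;> simp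
        rw [this, ← Equiv.prod_comp σ r, ← Finset.prod_mul_distrib]
        exact Finset.prod_le_prod (fun i _ => abs_nonneg _) fun i _ => h _ _
    _ = _ := by
        rw [Finset.sum_const, Finset.card_univ, Fintype.card_perm, nsmul_eq_mul]

abbrev X (n : ℕ) := Fin n → ℝ
abbrev V (n : ℕ) := (X n × X n) × ℝ

variable {n : ℕ}

def TT (F1 F2 : X n → X n) (g : X n → ℝ) (z : V n) : V n :=
  (((1 - z.2) • F1 z.1.1 + z.2 • (F2 z.1.1 - z.1.2),
    ((1 - z.2) • F1 z.1.1 + z.2 • (F2 z.1.1 - z.1.2)) + z.1.2), g z.1.1)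

noncomputable def HT' (A1 A2 : X n →L[ℝ] X n) (a1 a2 : X n) (z : V n) : V n →L[ℝ] X n :=
  (1 - z.2) • (A1.comp ((ContinuousLinearMap.fst ℝ (X n) (X n)).comp (ContinuousLinearMap.fst ℝ _ ℝ)))
  + z.2 • (A2.comp ((ContinuousLinearMap.fst ℝ (X n) (X n)).comp (ContinuousLinearMap.fst ℝ _ ℝ))
      - (ContinuousLinearMap.snd ℝ (X n) (X n)).comp (ContinuousLinearMap.fst ℝ _ ℝ))
  + (ContinuousLinearMap.snd ℝ (X n × X n) ℝ).smulRight (a2 - z.1.2 - a1)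

noncomputable def TT' (A1 A2 : X n →L[ℝ] X n) (γ : X n →L[ℝ] ℝ) (a1 a2 : X n) (z : V n) : V n →L[ℝ] V n :=
  ((HT' A1 A2 a1 a2 z).prod (HT' A1 A2 a1 a2 z +
    (ContinuousLinearMap.snd ℝ (X n) (X n)).comp (ContinuousLinearMap.fst ℝ _ ℝ))).prod
  (γ.comp ((ContinuousLinearMap.fst ℝ (X n) (X n)).comp (ContinuousLinearMap.fst ℝ _ ℝ)))

lemma HT'_apply (A1 A2 : X n →L[ℝ] X n) (a1 a2 : X n) (z u : V n) : HT' A1 A2 a1 a2 z u =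
    (1 - z.2) • A1 u.1.1 + z.2 • (A2 u.1.1 - u.1.2) + u.2 • (a2 - z.1.2 - a1) := by
  simp [HT']

lemma hasFDeriv_TT {F1 F2 : X n → X n} {g : X n → ℝ} {A1 A2 : X n →L[ℝ] X n} {γ : X n →L[ℝ] ℝ}
    {z : V n} (h1 : HasFDerivAt F1 A1 z.1.1) (h2 : HasFDerivAt F2 A2 z.1.1)
    (h3 : HasFDerivAt g γ z.1.1) :
    HasFDerivAt (TT F1 F2 g) (TT' A1 A2 γ (F1 z.1.1) (F2 z.1.1) z) z := by
  have py : HasFDerivAt (fun z : V n => z.1.1)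
    ((ContinuousLinearMap.fst ℝ (X n) (X n)).comp (ContinuousLinearMap.fst ℝ _ ℝ)) z :=
    ((ContinuousLinearMap.fst ℝ (X n) (X n)).comp (ContinuousLinearMap.fst ℝ _ ℝ)).hasFDerivAt
  have pv : HasFDerivAt (fun z : V n => z.1.2)
    ((ContinuousLinearMap.snd ℝ (X n) (X n)).comp (ContinuousLinearMap.fst ℝ _ ℝ)) z :=
    ((ContinuousLinearMap.snd ℝ (X n) (X n)).comp (ContinuousLinearMap.fst ℝ _ ℝ)).hasFDerivAt
  have pt : HasFDerivAt (fun z : V n => z.2) (ContinuousLinearMap.snd ℝ (X n × X n) ℝ) z :=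
    (ContinuousLinearMap.snd ℝ (X n × X n) ℝ).hasFDerivAt
  have f1 := HasFDerivAt.comp z h1 py
  have f2 := HasFDerivAt.comp z h2 py
  have f3 := HasFDerivAt.comp z h3 py
  have hH : HasFDerivAt (fun z : V n => (1 - z.2) • F1 z.1.1 + z.2 • (F2 z.1.1 - z.1.2))
      (HT' A1 A2 (F1 z.1.1) (F2 z.1.1) z) z := by
    have := ((pt.const_sub 1).smul f1).add (pt.smul (f2.sub pv))
    refine this.congr_fderiv ?_
    ext u
    · simp [HT']
    · simp [HT']
    · simp [HT']; ring
  exact (hH.prodMk (hH.add pv)).prodMk f3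

noncomputable def bas (n : ℕ) : Module.Basis ((Fin n ⊕ Fin n) ⊕ Unit) ℝ (V n) :=
  ((Pi.basisFun ℝ (Fin n)).prod (Pi.basisFun ℝ (Fin n))).prod (Module.Basis.singleton Unit ℝ)

lemma det_TT' {A1 A2 : X n →L[ℝ] X n} {γ : X n →L[ℝ] ℝ} {a1 a2 : X n} {z : V n} {b G : ℝ}
    (hn : 1 ≤ n) (hb : 0 < b) (hG : 0 ≤ G)
    (h1 : ∀ i j, |A1 (Pi.single j 1) i| ≤ b) (h2 : ∀ i j, |A2 (Pi.single j 1) i| ≤ b)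
    (h3 : ∀ j, |γ (Pi.single j 1)| ≤ G) (ha1 : ∀ i, a1 i ∈ Icc (0:ℝ) 1) (ha2 : ∀ i, a2 i ∈ Icc (0:ℝ) 1)
    (hv : ∀ i, |z.1.2 i| ≤ 1) (ht : z.2 ∈ Icc (0:ℝ) 1) :
    |(TT' A1 A2 γ a1 a2 z).det| ≤ ((2*n+1).factorial * 9 ^ n) * (b ^ (n-1) * G) := by
  obtain ⟨ht0, ht1⟩ := ht
  have hX : ∀ i j, |(1 - z.2) * A1 (Pi.single j 1) i + z.2 * A2 (Pi.single j 1) i| ≤ b := by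
    intro i j
    have a := abs_le.1 (h1 i j)
    have a' := abs_le.1 (h2 i j)
    rw [abs_le]
    constructor <;> nlinarith
  have hT : ∀ i, |a2 i - z.1.2 i - a1 i| ≤ 3 := by
    intro i
    have a := abs_le.1 (hv i)
    obtain ⟨_, _⟩ := ha1 i
    obtain ⟨_, _⟩ := ha2 i
    rw [abs_le]
    constructor <;> linarith
  have hδ : ∀ i j : Fin n, |(Pi.single j 1 : Fin n → ℝ) i| ≤ 1 := by
    intro i j
    rw [Pi.single_apply]; split_ifs <;> simp
  rw [ContinuousLinearMap.det, ← LinearMap.det_toMatrix (bas n)]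
  let r : (Fin n ⊕ Fin n) ⊕ Unit → ℝ := Sum.elim (fun _ => 3) (fun _ => G / b)
  let c : (Fin n ⊕ Fin n) ⊕ Unit → ℝ := Sum.elim (Sum.elim (fun _ => b) (fun _ => 1)) (fun _ => 1)
  refine (det_bound _ r c ?_).trans ?_
  · intro i j
    rw [LinearMap.toMatrix_apply]
    rcases i with (i | i) | i <;> rcases j with (j | j) | j
    · simp [bas, TT', HT'_apply, r, c]
      exact (hX i j).trans (by linarith)
    · simp [bas, TT', HT'_apply, r, c]
      rw [abs_of_nonneg ht0]
      have := hδ i j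
      nlinarith [abs_nonneg ((Pi.single j 1 : Fin n → ℝ) i)]
    · simp [bas, TT', HT'_apply, r, c]
      exact hT i
    · simp [bas, TT', HT'_apply, r, c]
      exact (hX i j).trans (by linarith)
    · simp [bas, TT', HT'_apply, r, c]
      have e : -(z.2 * (Pi.single j 1 : Fin n → ℝ) i) + (Pi.single j 1 : Fin n → ℝ) i
        = (1 - z.2) * (Pi.single j 1 : Fin n → ℝ) i := by ring
      rw [e, abs_mul, abs_of_nonneg (by linarith)]
      have := hδ i j
      nlinarith [abs_nonneg ((Pi.single j 1 : Fin n → ℝ) i)]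
    · simp [bas, TT', HT'_apply, r, c]
      exact hT i
    · simp [bas, TT', HT'_apply, r, c]
      rw [div_mul_cancel₀ _ hb.ne']
      exact h3 j
    · simp [bas, TT', HT'_apply, r, c]
      positivity
    · simp [bas, TT', HT'_apply, r, c]
      positivity
  · have e1 : (∏ i, r i) = 9 ^ n * (G / b) := by
      simp [r, Fintype.prod_sum_type]
      left; rw [← two_mul, pow_mul]; norm_num
    have e2 : (∏ i, c i) = b ^ n := by simp [c, Fintype.prod_sum_type]
    have e3 : Fintype.card ((Fin n ⊕ Fin n) ⊕ Unit) = 2 * n + 1 := by simp; ring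
    rw [e1, e2, e3]
    obtain ⟨m, rfl⟩ : ∃ m, n = m + 1 := ⟨n - 1, by omega⟩
    simp only [Nat.add_sub_cancel]
    apply le_of_eq
    field_simp
    ring

end SA
end

section
open MeasureTheory Metric Set
open scoped ENNReal NNReal

namespace SA
variable {n : ℕ}

def JJ (n : ℕ) : Set (X n) := univ.pi fun _ => Icc (-1:ℝ) 1

lemma JJ_norm {v : X n} (hv : v ∈ JJ n) : ‖v‖ ≤ 1 := by
  rw [pi_norm_le_iff_of_nonneg zero_le_one]
  intro i
  have := hv i (mem_univ _)
  rw [Real.norm_eq_abs, abs_le]; exact this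

lemma lip_TT {O : Set (X n)} {F1 F2 : X n → X n} {g : X n → ℝ} {K : ℝ≥0}
    (h1 : LipschitzOnWith K F1 O) (h2 : LipschitzOnWith K F2 O) (h3 : LipschitzOnWith K g O)
    (b1 : ∀ y ∈ O, ‖F1 y‖ ≤ 1) (b2 : ∀ y ∈ O, ‖F2 y‖ ≤ 1) :
    LipschitzOnWith (2 * K + 5) (TT F1 F2 g) ((O ×ˢ JJ n) ×ˢ Icc (0:ℝ) 1) := by
  refine LipschitzOnWith.of_dist_le_mul ?_
  rintro ⟨⟨y, v⟩, t⟩ ⟨⟨hy, hv⟩, ht0, ht1⟩ ⟨⟨y', v'⟩, t'⟩ ⟨⟨hy', hv'⟩, ht0', ht1'⟩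
  simp only at hy hv ht0 ht1 hy' hv' ht0' ht1'
  have hK : (0:ℝ) ≤ K := K.2
  set z : V n := ((y, v), t)
  set z' : V n := ((y', v'), t')
  set d := dist z z' with hd
  have d1 : dist y y' ≤ d := le_trans (le_max_left _ _) (le_max_left _ _)
  have d2 : dist v v' ≤ d := le_trans (le_max_right _ _) (le_max_left _ _)
  have d3 : dist t t' ≤ d := le_max_right _ _
  have l1 : ‖F1 y - F1 y'‖ ≤ K * d := by
    rw [← dist_eq_norm]; exact (h1.dist_le_mul y hy y' hy').trans (by gcongr)
  have l2 : ‖F2 y - F2 y'‖ ≤ K * d := by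
    rw [← dist_eq_norm]; exact (h2.dist_le_mul y hy y' hy').trans (by gcongr)
  have l3 : dist (g y) (g y') ≤ K * d := (h3.dist_le_mul y hy y' hy').trans (by gcongr)
  rw [dist_eq_norm] at d2 d3
  have hd0 : 0 ≤ d := dist_nonneg
  have hH : dist ((1 - t) • F1 y + t • (F2 y - v)) ((1 - t') • F1 y' + t' • (F2 y' - v'))
      ≤ (2 * K + 4) * d := by
    rw [dist_eq_norm]
    have e : ((1 - t) • F1 y + t • (F2 y - v)) - ((1 - t') • F1 y' + t' • (F2 y' - v')) =
      (1 - t) • (F1 y - F1 y') + (t' - t) • F1 y' + t • ((F2 y - F2 y') - (v - v'))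
        + (t - t') • (F2 y' - v') := by module
    rw [e]
    have n1 : ‖(1 - t) • (F1 y - F1 y')‖ ≤ K * d := by
      rw [norm_smul, Real.norm_of_nonneg (by linarith)]
      calc _ ≤ 1 * ‖F1 y - F1 y'‖ := by gcongr; linarith
        _ ≤ _ := by linarith
    have n2 : ‖(t' - t) • F1 y'‖ ≤ d := by
      rw [norm_smul, norm_sub_rev]
      calc _ ≤ d * 1 := by gcongr; exact b1 y' hy'
        _ = d := mul_one _
    have n3 : ‖t • ((F2 y - F2 y') - (v - v'))‖ ≤ (K + 1) * d := by
      rw [norm_smul, Real.norm_of_nonneg ht0]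
      have := norm_sub_le (F2 y - F2 y') (v - v')
      calc _ ≤ 1 * ‖(F2 y - F2 y') - (v - v')‖ := by gcongr
        _ ≤ _ := by linarith
    have n4 : ‖(t - t') • (F2 y' - v')‖ ≤ d * 2 := by
      rw [norm_smul]
      have := norm_sub_le (F2 y') v'
      have := b2 y' hy'
      have := JJ_norm hv'
      gcongr
      linarith
    have := norm_add_le ((1 - t) • (F1 y - F1 y') + (t' - t) • F1 y' + t • ((F2 y - F2 y') - (v - v'))) ((t - t') • (F2 y' - v'))
    have := norm_add_le ((1 - t) • (F1 y - F1 y') + (t' - t) • F1 y') (t • ((F2 y - F2 y') - (v - v')))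
    have := norm_add_le ((1 - t) • (F1 y - F1 y')) ((t' - t) • F1 y')
    linarith
  have hcoe : ((2 * K + 5 : ℝ≥0) : ℝ) = 2 * K + 5 := by push_cast; ring
  rw [hcoe]
  have hKd : 0 ≤ K * d := by positivity
  refine max_le (max_le ?_ ?_) ?_
  · exact hH.trans (by nlinarith)
  · change dist (((1 - t) • F1 y + t • (F2 y - v)) + v) (((1 - t') • F1 y' + t' • (F2 y' - v')) + v') ≤ _
    refine (dist_add_add_le _ _ _ _).trans ?_
    rw [dist_eq_norm v v']
    linarith
  · exact l3.trans (by nlinarith)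

lemma haarV : (volume : Measure (V n)).IsAddHaarMeasure := by
  change (Measure.prod (Measure.prod volume volume) volume).IsAddHaarMeasure
  have h1 : (Measure.prod (volume : Measure (X n)) (volume : Measure (X n))).IsAddHaarMeasure :=
    Measure.prod.instIsAddHaarMeasure _ _
  exact Measure.prod.instIsAddHaarMeasure _ _

lemma area_link (hn : 1 ≤ n) {O S : Set (X n)} (hO : IsOpen O) (hS : MeasurableSet S) (hSO : S ⊆ O)
    {F1 F2 : X n → X n} {g : X n → ℝ} {K : ℝ≥0}
    (h1 : LipschitzOnWith K F1 O) (h2 : LipschitzOnWith K F2 O) (h3 : LipschitzOnWith K g O)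
    (b1 : ∀ y i, F1 y i ∈ Icc (0:ℝ) 1) (b2 : ∀ y i, F2 y i ∈ Icc (0:ℝ) 1)
    {b G : X n → ℝ} (hb : ∀ y, 0 < b y) (hG : ∀ y, 0 ≤ G y)
    (hmeas : Measurable fun y => ENNReal.ofReal (b y ^ (n-1) * G y))
    (d1 : ∀ y ∈ S, ∀ A : X n →L[ℝ] X n, HasFDerivAt F1 A y → ∀ i j, |A (Pi.single j 1) i| ≤ b y)
    (d2 : ∀ y ∈ S, ∀ A : X n →L[ℝ] X n, HasFDerivAt F2 A y → ∀ i j, |A (Pi.single j 1) i| ≤ b y)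
    (d3 : ∀ y ∈ S, ∀ A : X n →L[ℝ] ℝ, HasFDerivAt g A y → ∀ j, |A (Pi.single j 1)| ≤ G y) :
    volume (TT F1 F2 g '' ((S ×ˢ JJ n) ×ˢ Icc (0:ℝ) 1)) ≤
      ENNReal.ofReal ((2*n+1).factorial * 9 ^ n * 2 ^ n) * ∫⁻ y in S, ENNReal.ofReal (b y ^ (n-1) * G y) := by
  have := haarV (n := n)
  have bn1 : ∀ y, ‖F1 y‖ ≤ 1 := fun y => by
    rw [pi_norm_le_iff_of_nonneg zero_le_one]; intro i
    obtain ⟨h, h'⟩ := b1 y i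
    rwa [Real.norm_of_nonneg h]
  have bn2 : ∀ y, ‖F2 y‖ ≤ 1 := fun y => by
    rw [pi_norm_le_iff_of_nonneg zero_le_one]; intro i
    obtain ⟨h, h'⟩ := b2 y i
    rwa [Real.norm_of_nonneg h]
  let S1 : Set (X n) := S ∩ ({y | DifferentiableAt ℝ F1 y} ∩ {y | DifferentiableAt ℝ F2 y} ∩ {y | DifferentiableAt ℝ g y})
  have hS1 : MeasurableSet S1 := hS.inter (((measurableSet_of_differentiableAt ℝ F1).inter
    (measurableSet_of_differentiableAt ℝ F2)).inter (measurableSet_of_differentiableAt ℝ g))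
  have hnull : volume (S \ S1) = 0 := by
    have r1 := h1.ae_differentiableWithinAt_of_mem (μ := volume)
    have r2 := h2.ae_differentiableWithinAt_of_mem (μ := volume)
    have r3 := h3.ae_differentiableWithinAt_of_mem (μ := volume)
    have : ∀ᵐ y, y ∉ S \ S1 := by
      filter_upwards [r1, r2, r3] with y q1 q2 q3 hy
      have hyO := hSO hy.1
      have hnb := hO.mem_nhds hyO
      exact hy.2 ⟨hy.1, ⟨(q1 hyO).differentiableAt hnb, (q2 hyO).differentiableAt hnb⟩, (q3 hyO).differentiableAt hnb⟩
    rw [← compl_mem_ae_iff]; exact this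
  have hI : MeasurableSet (JJ n) := MeasurableSet.univ_pi fun _ => measurableSet_Icc
  have hJv : volume (JJ n) = ENNReal.ofReal (2 ^ n) := by
    unfold JJ
    rw [volume_pi_pi]; simp [ENNReal.ofReal_pow]; norm_num
  have hsplit : TT F1 F2 g '' ((S ×ˢ JJ n) ×ˢ Icc (0:ℝ) 1) ⊆
      TT F1 F2 g '' ((S1 ×ˢ JJ n) ×ˢ Icc (0:ℝ) 1) ∪ TT F1 F2 g '' (((S \ S1) ×ˢ JJ n) ×ˢ Icc (0:ℝ) 1) := by
    rw [← image_union]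
    apply image_mono
    rintro ⟨⟨y, v⟩, t⟩ ⟨⟨hy, hv⟩, ht⟩
    by_cases h : y ∈ S1
    · exact Or.inl ⟨⟨h, hv⟩, ht⟩
    · exact Or.inr ⟨⟨⟨hy, h⟩, hv⟩, ht⟩
  have hz : volume (TT F1 F2 g '' (((S \ S1) ×ˢ JJ n) ×ˢ Icc (0:ℝ) 1)) = 0 := by
    have hl := lip_TT h1 h2 h3 (fun y _ => bn1 y) (fun y _ => bn2 y)
    refine null_image volume (hl.mono ?_) ?_
    · exact prod_mono (prod_mono (sdiff_subset.trans hSO) le_rfl) le_rfl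
    · rw [Measure.volume_eq_prod, Measure.prod_prod, Measure.volume_eq_prod, Measure.prod_prod, hnull]
      simp
  refine (measure_mono hsplit).trans ((measure_union_le _ _).trans ?_)
  rw [hz, add_zero]
  have hm2 : MeasurableSet ((S1 ×ˢ JJ n) ×ˢ Icc (0:ℝ) 1) := (hS1.prod hI).prod measurableSet_Icc
  refine (addHaar_image_le_lintegral_abs_det_fderiv volume hm2 (f := TT F1 F2 g)
    (f' := fun z => TT' (fderiv ℝ F1 z.1.1) (fderiv ℝ F2 z.1.1) (fderiv ℝ g z.1.1) (F1 z.1.1) (F2 z.1.1) z) ?_).trans ?_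
  · rintro z ⟨⟨⟨hz1, ⟨q1, q2⟩, q3⟩, hz2⟩, hz3⟩
    exact (hasFDeriv_TT (DifferentiableAt.hasFDerivAt q1) (DifferentiableAt.hasFDerivAt q2) (DifferentiableAt.hasFDerivAt q3)).hasFDerivWithinAt
  · have hle : ∀ z ∈ (S1 ×ˢ JJ n) ×ˢ Icc (0:ℝ) 1,
      ENNReal.ofReal |(TT' (fderiv ℝ F1 z.1.1) (fderiv ℝ F2 z.1.1) (fderiv ℝ g z.1.1) (F1 z.1.1) (F2 z.1.1) z).det| ≤
        ENNReal.ofReal ((2*n+1).factorial * 9 ^ n) * ENNReal.ofReal (b z.1.1 ^ (n-1) * G z.1.1) := by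
      rintro z ⟨⟨⟨hz1, ⟨q1, q2⟩, q3⟩, hz2⟩, hz3⟩
      rw [← ENNReal.ofReal_mul (by positivity)]
      apply ENNReal.ofReal_le_ofReal
      apply det_TT' hn (hb _) (hG _) (d1 _ hz1 _ (DifferentiableAt.hasFDerivAt q1))
        (d2 _ hz1 _ (DifferentiableAt.hasFDerivAt q2)) (d3 _ hz1 _ (DifferentiableAt.hasFDerivAt q3)) (b1 _) (b2 _) _ hz3
      intro i
      have := hz2 i (mem_univ _)
      rw [abs_le]; exact this
    refine (setLIntegral_mono' hm2 hle).trans ?_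
    have hm3 : Measurable fun z : V n => ENNReal.ofReal (b z.1.1 ^ (n-1) * G z.1.1) :=
      hmeas.comp (measurable_fst.comp measurable_fst)
    have hm4 : Measurable fun z : X n × X n => ENNReal.ofReal (b z.1 ^ (n-1) * G z.1) :=
      hmeas.comp measurable_fst
    rw [lintegral_const_mul _ hm3]
    rw [Measure.volume_eq_prod, ← Measure.prod_restrict, Measure.volume_eq_prod, ← Measure.prod_restrict]
    rw [lintegral_prod _ hm3.aemeasurable]
    simp only [lintegral_const, Measure.restrict_apply MeasurableSet.univ, univ_inter, Real.volume_Icc, sub_zero, ENNReal.ofReal_one, mul_one]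
    rw [lintegral_prod _ hm4.aemeasurable]
    simp only [lintegral_const, Measure.restrict_apply MeasurableSet.univ, univ_inter, hJv]
    rw [lintegral_mul_const _ hmeas]
    rw [ENNReal.ofReal_mul (p := (2*n+1).factorial * 9 ^ n) (by positivity), mul_assoc, mul_comm (ENNReal.ofReal (2 ^ n))]
    gcongr
    exact inter_subset_left

end SA
end

section
open MeasureTheory Metric Set
open scoped ENNReal NNReal

namespace SA
variable {n : ℕ}

def II (n : ℕ) : Set (X n) := Set.pi univ fun _ => Icc (0:ℝ) 1
lemma vol_II : volume (II n) = 1 := by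
  rw [II, volume_pi_pi]; simp

lemma meas_II : MeasurableSet (II n) := MeasurableSet.univ_pi fun _ => measurableSet_Icc

def BS (a a' : X n) (t d : ℝ) : Set (X n × X n) :=
  {z | z.1 ∈ II n ∧ z.2 ∈ II n ∧ ∀ i, |(1-t) * (a i - z.1 i) + t * (a' i - z.2 i)| ≤ d}

lemma BS_closed (a a' : X n) (t d : ℝ) : IsClosed (BS a a' t d) := by
  have hc : IsClosed (II n) := isClosed_set_pi fun _ _ => isClosed_Icc
  have : BS a a' t d = Prod.fst ⁻¹' (II n) ∩ (Prod.snd ⁻¹' (II n) ∩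
      ⋂ i, {z : X n × X n | |(1-t) * (a i - z.1 i) + t * (a' i - z.2 i)| ≤ d}) := by
    ext z; simp [BS]
  rw [this]
  refine (hc.preimage continuous_fst).inter ((hc.preimage continuous_snd).inter
    (isClosed_iInter fun i => isClosed_le (by fun_prop) (by fun_prop)))

lemma BS_vol1 (a a' : X n) {t d : ℝ} (ht : t ≤ 1/2) (hd : 0 ≤ d) :
    volume (BS a a' t d) ≤ ENNReal.ofReal ((4 * d) ^ n) := by
  rw [Measure.volume_eq_prod, Measure.prod_apply_symm (BS_closed a a' t d).measurableSet]
  calc ∫⁻ y, volume ((fun x => (x, y)) ⁻¹' BS a a' t d)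
      ≤ ∫⁻ y, (II n).indicator (fun _ => ENNReal.ofReal ((4 * d) ^ n)) y := by
        apply lintegral_mono
        intro y
        by_cases hy : y ∈ II n
        · rw [indicator_of_mem hy]
          set c : X n := fun i => a i + t / (1-t) * (a' i - y i)
          have hsub : (fun x => (x, y)) ⁻¹' BS a a' t d ⊆ closedBall c (2 * d) := by
            intro x hx
            rw [mem_closedBall, dist_pi_le_iff (by positivity)]
            intro i
            have h1 := hx.2.2 i
            simp only at h1
            have h2 : 0 < 1 - t := by linarith
            have h3 : (1-t) * (a i - x i) + t * (a' i - y i) = (1 - t) * (c i - x i) := by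
              simp only [c]; field_simp; ring
            rw [h3, abs_mul, abs_of_pos h2, abs_sub_comm] at h1
            rw [Real.dist_eq]
            nlinarith [abs_nonneg (x i - c i)]
          refine (measure_mono hsub).trans ?_
          rw [Real.volume_pi_closedBall _ (by positivity)]
          simp only [Fintype.card_fin]
          apply le_of_eq; congr 2; ring
        · rw [indicator_of_notMem hy]
          have : (fun x => (x, y)) ⁻¹' BS a a' t d = ∅ := by
            ext x; simp [BS, hy]
          simp only [this]; simp
    _ ≤ _ := by
        rw [lintegral_indicator meas_II, setLIntegral_const, vol_II, mul_one]

lemma BS_vol (a a' : X n) {t d : ℝ} (hd : 0 ≤ d) :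
    volume (BS a a' t d) ≤ ENNReal.ofReal ((4 * d) ^ n) := by
  by_cases ht : t ≤ 1/2
  · exact BS_vol1 a a' ht hd
  · have h1 : BS a a' t d = Prod.swap ⁻¹' BS a' a (1-t) d := by
      ext z
      simp only [BS, mem_ofPred_eq, mem_preimage, Prod.fst_swap, Prod.snd_swap]
      constructor
      · rintro ⟨h1, h2, h3⟩
        exact ⟨h2, h1, fun i => by have := h3 i; rw [add_comm]; convert this using 3; ring⟩
      · rintro ⟨h1, h2, h3⟩
        exact ⟨h2, h1, fun i => by have := h3 i; rw [add_comm]; convert this using 3; ring⟩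
    rw [h1]
    have hm : MeasurePreserving (Prod.swap : X n × X n → X n × X n) volume volume :=
      Measure.measurePreserving_swap
    rw [hm.measure_preimage (BS_closed _ _ _ _).measurableSet.nullMeasurableSet]
    exact BS_vol1 a' a (by push Not at ht; linarith) hd

/-- volume of parameters for which a small piece meets the link zero set -/
lemma bad_one (hn : 1 ≤ n) {a a' : X n} (ha : a ∈ II n) (ha' : a' ∈ II n) {d : ℝ} (hd : 0 < d) :
    volume {z : X n × X n | z.1 ∈ II n ∧ z.2 ∈ II n ∧ ∃ t ∈ Icc (0:ℝ) 1,
      ∀ i, |(1-t) * (a i - z.1 i) + t * (a' i - z.2 i)| ≤ d} ≤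
      ENNReal.ofReal (2 * 12 ^ n * d ^ (n-1)) := by
  rcases le_or_gt d 1 with h1 | h1
  · set M := ⌊1/d⌋₊
    have hsub : {z : X n × X n | z.1 ∈ II n ∧ z.2 ∈ II n ∧ ∃ t ∈ Icc (0:ℝ) 1,
      ∀ i, |(1-t) * (a i - z.1 i) + t * (a' i - z.2 i)| ≤ d} ⊆
      ⋃ m ∈ Finset.range (M+1), BS a a' (m * d) (3 * d) := by
      rintro z ⟨hz1, hz2, t, ht, h⟩
      simp only [mem_iUnion]
      refine ⟨⌊t/d⌋₊, ?_, hz1, hz2, fun i => ?_⟩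
      · rw [Finset.mem_range]
        have : ⌊t/d⌋₊ ≤ M := Nat.floor_mono (by gcongr; exact ht.2)
        omega
      · have e1 : (⌊t/d⌋₊ : ℝ) ≤ t / d := Nat.floor_le (div_nonneg ht.1 hd.le)
        have e2 : t / d < (⌊t/d⌋₊ : ℝ) + 1 := Nat.lt_floor_add_one _
        set q : ℝ := (⌊t/d⌋₊ : ℝ) * d
        have f1 : q ≤ t := by rwa [le_div_iff₀ hd] at e1
        have f2 : t < q + d := by rw [div_lt_iff₀ hd] at e2; simp only [q]; linarith
        have g1 := hz1 i (mem_univ i); have g2 := hz2 i (mem_univ i)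
        have g3 := ha i (mem_univ i); have g4 := ha' i (mem_univ i)
        simp only [mem_Icc] at g1 g2 g3 g4
        have h2 := h i
        have h3 : (1-q) * (a i - z.1 i) + q * (a' i - z.2 i) =
          ((1-t) * (a i - z.1 i) + t * (a' i - z.2 i)) + (t - q) * ((a i - z.1 i) - (a' i - z.2 i)) := by ring
        have h4 : |(a i - z.1 i) - (a' i - z.2 i)| ≤ 2 := by
          rw [abs_le]; constructor <;> linarith
        have h5 : |(t - q) * ((a i - z.1 i) - (a' i - z.2 i))| ≤ d * 2 := by
          rw [abs_mul]
          gcongr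
          rw [abs_le]; constructor <;> linarith
        rw [h3]
        refine (abs_add_le _ _).trans ?_
        linarith
    refine (measure_mono hsub).trans ((measure_biUnion_finset_le _ _).trans ?_)
    refine (Finset.sum_le_sum fun m _ => BS_vol a a' (by positivity : (0:ℝ) ≤ 3 * d)).trans ?_
    rw [Finset.sum_const, Finset.card_range, nsmul_eq_mul, ← ENNReal.ofReal_natCast,
      ← ENNReal.ofReal_mul (by positivity)]
    apply ENNReal.ofReal_le_ofReal
    have e1 : (M : ℝ) ≤ 1/d := Nat.floor_le (by positivity)
    have e2 : (1:ℝ) ≤ 1/d := by rw [le_div_iff₀ hd]; linarith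
    have e3 : ((M+1 : ℕ) : ℝ) ≤ 2 / d := by push_cast; rw [show 2/d = 1/d+1/d by ring]; linarith
    calc ((M+1 : ℕ) : ℝ) * (4 * (3 * d))^n ≤ 2 / d * (4 * (3 * d))^n := by gcongr
      _ = _ := by
        obtain ⟨k, rfl⟩ : ∃ k, n = k + 1 := ⟨n-1, by omega⟩
        simp only [Nat.add_sub_cancel]
        rw [show 4 * (3 * d) = 12 * d by ring, mul_pow, pow_succ d]
        field_simp
  · have : {z : X n × X n | z.1 ∈ II n ∧ z.2 ∈ II n ∧ ∃ t ∈ Icc (0:ℝ) 1,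
      ∀ i, |(1-t) * (a i - z.1 i) + t * (a' i - z.2 i)| ≤ d} ⊆ (II n) ×ˢ (II n) :=
      fun z hz => ⟨hz.1, hz.2.1⟩
    refine (measure_mono this).trans ?_
    rw [Measure.volume_eq_prod, Measure.prod_prod, vol_II, one_mul, ← ENNReal.ofReal_one]
    apply ENNReal.ofReal_le_ofReal
    have e1 : (1:ℝ) ≤ d ^ (n-1) := one_le_pow₀ h1.le
    have e2 : (1:ℝ) ≤ 12 ^ n := one_le_pow₀ (by norm_num)
    nlinarith
end SA
end

section
open MeasureTheory Metric Set
open scoped ENNReal NNReal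

namespace SA
variable {n : ℕ} {ω : E n → ℝ}

lemma small_vol {P KA C : ℝ} (hw : SW n ω P KA C) {ε : ℝ} (hε : 0 < ε) : ∃ θ > 0, ∀ N, 0 < N →
    ∀ (k : ℕ) (x0 : E n) (S : Set (E n)), S ⊆ cube N k (idx N k x0) → MeasurableSet S →
    (mu ω).real S ≤ θ * (mu ω).real (cube N k (idx N k x0)) → volume.real S ≤ ε * hh N k ^ n := by
  have hn1 : (1:ℝ) ≤ n := by have := hw.hn; exact_mod_cast (by omega : 1 ≤ n)
  let c : ℝ := ε / n ^ n
  have hc : 0 < c := by positivity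
  set A := KA * (volume.real (closedBall (0 : E n) 1) / c) ^ P with hA
  have hA0 : 0 ≤ A := mul_nonneg hw.hKA.le (by positivity)
  refine ⟨1 / (2 * (A + 1)), by positivity, ?_⟩
  intro N hN k x0 S hS hSm hm
  by_contra hcon
  push Not at hcon
  have hk := hh_pos hN k
  have hsub : cube N k (idx N k x0) ⊆ closedBall x0 (n * hh N k) := fun y hy => cube_dist hN hy
  have h1 := hw.ap_vol (x := x0) (R := n * hh N k) (by positivity) hc (hS.trans hsub) hSm (by
    simp only [c]; rw [mul_pow]; field_simp; linarith)
  rw [← hA] at h1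
  have h2 := mu_real_mono hw.cont isBounded_closedBall hsub
  have h3 := cube_mass_pos hw hN k (idx N k x0)
  have h4 : A * (mu ω).real S ≤ A * (1 / (2 * (A + 1)) * (mu ω).real (cube N k (idx N k x0))) := by gcongr
  have h5 : A * (1 / (2 * (A + 1))) < 1 := by
    rw [mul_one_div, div_lt_one (by positivity)]; linarith
  have h6 : A * (1 / (2 * (A + 1)) * (mu ω).real (cube N k (idx N k x0))) <
     (mu ω).real (cube N k (idx N k x0)) := by
    rw [← mul_assoc]; nlinarith
  linarith

def TB (ω : E n → ℝ) (N β : ℝ) (k : ℕ) (x0 : E n) : Set (ℕ × (Fin n → ℤ)) :=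
  {q | ∃ p ∈ cube N k (idx N k x0), MaxBad ω N β k q.1 p ∧ idx N q.1 p = q.2}

lemma TB_disj {N β : ℝ} {k : ℕ} {x0 : E n} :
    Pairwise (Function.onFun Disjoint fun q : TB ω N β k x0 => cube (n := n) N q.1.1 q.1.2) := by
  rintro ⟨⟨j, m⟩, p, hp, hb, he⟩ ⟨⟨j', m'⟩, p', hp', hb', he'⟩ hne
  simp only [Function.onFun]
  rw [Set.disjoint_left]
  intro z hz hz'
  simp only at he he' hb hb' hz hz'
  have h1 : MaxBad ω N β k j z := hb.congr (he.trans hz.symm)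
  have h2 : MaxBad ω N β k j' z := hb'.congr (he'.trans hz'.symm)
  have hjj : j = j' := by
    rcases lt_trichotomy j j' with h | h | h
    · exact absurd h1.2.1 (h2.2.2 j h1.1 h)
    · exact h
    · exact absurd h2.2.1 (h1.2.2 j' h2.1 h)
  subst hjj
  apply hne
  have : m = m' := hz.symm.trans hz'
  subst this
  rfl

lemma TB_sub {N β : ℝ} {k : ℕ} {x0 : E n} (q : TB ω N β k x0) :
    cube (n := n) N q.1.1 q.1.2 ⊆ cube N k (idx N k x0) := by
  obtain ⟨⟨j, m⟩, p, hp, hb, he⟩ := q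
  intro z hz
  have : idx N k z = idx N k p := idx_eq_of_le hb.1 (hz.trans he.symm)
  exact this.trans hp

lemma TB_sum {P KA C : ℝ} (hw : SW n ω P KA C) {ε : ℝ} (hε : 0 < ε) : ∃ η > 0, ∀ N, 0 < N →
    ∀ (k : ℕ) (x0 : E n), ∑' q : TB ω N (bt ω N η k x0) k x0, ENNReal.ofReal ((hh N q.1.1 / hh N k) ^ n) ≤
      ENNReal.ofReal ε := by
  obtain ⟨θ, hθ, H⟩ := small_vol hw hε
  have hn1 : 1 ≤ n := by have := hw.hn; omega
  refine ⟨min 1 θ, by positivity, ?_⟩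
  intro N hN k x0
  set η := min 1 θ
  have hη : 0 < η := by positivity
  set β := bt ω N η k x0 with hβ
  have hk := hh_pos hN k
  set R := cube N k (idx N k x0)
  set M := (mu ω).real R with hM
  have hM0 : 0 < M := cube_mass_pos hw hN k _
  let W : Set (E n) := ⋃ q : TB ω N β k x0, cube (n := n) N q.1.1 q.1.2
  have hWm : MeasurableSet W := MeasurableSet.iUnion fun q => cube_meas hN _ _
  have hWR : W ⊆ R := iUnion_subset fun q => TB_sub q
  have hWv : volume W = ∑' q : TB ω N β k x0, ENNReal.ofReal (hh N q.1.1 ^ n) := by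
    simp only [W]
    rw [measure_iUnion TB_disj fun q => cube_meas hN _ _]
    simp_rw [cube_vol hN]
  have e0 : ∀ q : TB ω N β k x0, ENNReal.ofReal ((hh N q.1.1 / hh N k) ^ n) =
      ENNReal.ofReal (hh N q.1.1 ^ n) * ENNReal.ofReal ((hh N k ^ n)⁻¹) := fun q => by
    rw [← ENNReal.ofReal_mul (by have := hh_pos hN q.1.1; positivity), div_pow, div_eq_mul_inv]
  have e1 : ∑' q : TB ω N β k x0, ENNReal.ofReal ((hh N q.1.1 / hh N k) ^ n) =
      volume W * ENNReal.ofReal ((hh N k ^ n)⁻¹) := by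
    rw [hWv, ← ENNReal.tsum_mul_right]
    exact tsum_congr e0
  have hWR' : volume W ≤ ENNReal.ofReal (hh N k ^ n) := by
    rw [← cube_vol hN k (idx N k x0)]; exact measure_mono hWR
  have e2 : ∑' q : TB ω N β k x0, ENNReal.ofReal ((hh N q.1.1 / hh N k) ^ n) ≤ 1 := by
    rw [e1]
    calc _ ≤ ENNReal.ofReal (hh N k ^ n) * ENNReal.ofReal ((hh N k ^ n)⁻¹) := by gcongr
      _ = 1 := by
        rw [← ENNReal.ofReal_mul (by positivity), mul_inv_cancel₀ (by positivity), ENNReal.ofReal_one]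
  have e3 : mu ω W ≤ ENNReal.ofReal (θ * M) := by
    simp only [W]
    rw [measure_iUnion TB_disj fun q => cube_meas hN _ _]
    have : ∀ q : TB ω N β k x0, mu ω (cube (n := n) N q.1.1 q.1.2) ≤
        ENNReal.ofReal (θ * M) * ENNReal.ofReal ((hh N q.1.1 / hh N k) ^ n) := by
      rintro ⟨⟨j, m⟩, p, hp, hb, he⟩
      simp only
      have hj := hh_pos hN j
      have hb2 : (mu ω).real (cube N j (idx N j p)) ≤ (β * hh N j ^ 2) ^ n := hb.2.1
      simp only at he
      rw [he] at hb2
      rw [← ENNReal.ofReal_toReal (mu_lt_top hw.cont (cube_bdd hN j m)).ne,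
        ← ENNReal.ofReal_mul (by positivity)]
      apply ENNReal.ofReal_le_ofReal
      refine hb2.trans ?_
      set r := hh N j / hh N k
      have hr0 : 0 < r := by positivity
      have hr1 : r ≤ 1 := (div_le_one hk).2 (hh_anti hN hb.1)
      have f1 : β * hh N j ^ 2 = η * M ^ ((1:ℝ)/n) * r ^ 2 := by
        rw [hβ, bt]; simp only [r]; field_simp; rfl
      have f2 : (M ^ ((1:ℝ)/n)) ^ n = M := by
        rw [← Real.rpow_natCast, ← Real.rpow_mul hM0.le]
        have : (n:ℝ) ≠ 0 := by positivity
        field_simp; simp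
      rw [f1, mul_pow, mul_pow, f2, ← pow_mul]
      have f3 : η ^ n ≤ θ := by
        calc η ^ n ≤ η ^ 1 := pow_le_pow_of_le_one hη.le (min_le_left _ _) hn1
          _ ≤ θ := by rw [pow_one]; exact min_le_right _ _
      have f4 : r ^ (2 * n) ≤ r ^ n := pow_le_pow_of_le_one hr0.le hr1 (by omega)
      gcongr
    refine (ENNReal.tsum_le_tsum this).trans ?_
    rw [ENNReal.tsum_mul_left]
    calc _ ≤ ENNReal.ofReal (θ * M) * 1 := by gcongr
      _ = _ := mul_one _
  have e4 : (mu ω).real W ≤ θ * M := ENNReal.toReal_le_of_le_ofReal (by positivity) e3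
  have e5 := H N hN k x0 W hWR hWm e4
  have e6 : volume W ≤ ENNReal.ofReal (ε * hh N k ^ n) := by
    rw [Measure.real] at e5
    rwa [← ENNReal.le_ofReal_iff_toReal_le (hWR'.trans_lt ENNReal.ofReal_lt_top).ne (by positivity)] at e5
  rw [e1]
  calc _ ≤ ENNReal.ofReal (ε * hh N k ^ n) * ENNReal.ofReal ((hh N k ^ n)⁻¹) := by gcongr
    _ = _ := by
      rw [← ENNReal.ofReal_mul (by positivity), mul_assoc, mul_inv_cancel₀ (by positivity), mul_one]

def Lk (Φ1 Φ2 : E n → Fin n → ℝ) (s s' : X n) (x : E n) : Prop :=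
  ∃ t ∈ Icc (0:ℝ) 1, ∀ i, (1-t) * (Φ1 x i - s i) + t * (Φ2 x i - s' i) = 0

lemma bad_total {P KA C : ℝ} (hw : SW n ω P KA C) {C1 : ℝ} (hC1 : 0 < C1) : ∃ η > 0, ∀ N, 0 < N →
    ∀ (k : ℕ) (x0 : E n) (Φ1 Φ2 : E n → Fin n → ℝ), Adm ω N η C1 k x0 Φ1 → Adm ω N η C1 k x0 Φ2 →
    volume {z : X n × X n | z.1 ∈ II n ∧ z.2 ∈ II n ∧ ∃ x ∈ cube N k (idx N k x0),
      x ∈ UU ω N (bt ω N η k x0) k ∧ Lk Φ1 Φ2 z.1 z.2 x} ≤ ENNReal.ofReal (1/20) := by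
  set D : ℝ := 2 * 12 ^ n * C1 ^ (n-1) with hD
  have hD0 : 0 < D := by positivity
  have hn := hw.hn
  obtain ⟨η, hη, H⟩ := TB_sum hw (ε := 1 / 20 / D) (by positivity)
  refine ⟨η, hη, fun N hN k x0 Φ1 Φ2 h1 h2 => ?_⟩
  have hk := hh_pos hN k
  specialize H N hN k x0
  set β := bt ω N η k x0
  let pt : TB ω N β k x0 → E n := fun q => q.2.choose
  have hpt : ∀ q : TB ω N β k x0, MaxBad ω N β k q.1.1 (pt q) ∧ idx N q.1.1 (pt q) = q.1.2 :=
    fun q => q.2.choose_spec.2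
  let d : TB ω N β k x0 → ℝ := fun q => C1 * (hh N q.1.1 / hh N k) ^ 2
  have hd : ∀ q, 0 < d q := fun q => by have := hh_pos hN q.1.1; simp only [d]; positivity
  have hsub : {z : X n × X n | z.1 ∈ II n ∧ z.2 ∈ II n ∧ ∃ x ∈ cube N k (idx N k x0),
      x ∈ UU ω N β k ∧ Lk Φ1 Φ2 z.1 z.2 x} ⊆ ⋃ q : TB ω N β k x0,
      {z : X n × X n | z.1 ∈ II n ∧ z.2 ∈ II n ∧ ∃ t ∈ Icc (0:ℝ) 1,
      ∀ i, |(1-t) * (Φ1 (pt q) i - z.1 i) + t * (Φ2 (pt q) i - z.2 i)| ≤ d q} := by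
    rintro z ⟨hz1, hz2, x, hx, hxU, t, ht, he⟩
    obtain ⟨j, hj⟩ := exists_maxBad hxU
    let q : TB ω N β k x0 := ⟨(j, idx N j x), x, hx, hj, rfl⟩
    rw [mem_iUnion]
    refine ⟨q, hz1, hz2, t, ht, fun i => ?_⟩
    have g1 := h1.jump j (pt q) x (hpt q).1 (hpt q).2 i
    have g2 := h2.jump j (pt q) x (hpt q).1 (hpt q).2 i
    have g3 := he i
    have g4 : (1-t) * (Φ1 (pt q) i - z.1 i) + t * (Φ2 (pt q) i - z.2 i) =
      (1-t) * (Φ1 (pt q) i - Φ1 x i) + t * (Φ2 (pt q) i - Φ2 x i) := by linarith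
    have t0 := ht.1
    have t1 : 0 ≤ 1 - t := by linarith [ht.2]
    have g5 : d q = (1-t) * (C1 * (hh N j / hh N k) ^ 2) + t * (C1 * (hh N j / hh N k) ^ 2) := by
      simp only [d, q]; ring
    rw [g4, g5]
    refine (abs_add_le _ _).trans ?_
    rw [abs_mul, abs_mul, abs_of_nonneg t0, abs_of_nonneg t1]
    gcongr
  refine (measure_mono hsub).trans ((measure_iUnion_le _).trans ?_)
  have h3 : ∀ q : TB ω N β k x0, volume {z : X n × X n | z.1 ∈ II n ∧ z.2 ∈ II n ∧ ∃ t ∈ Icc (0:ℝ) 1,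
      ∀ i, |(1-t) * (Φ1 (pt q) i - z.1 i) + t * (Φ2 (pt q) i - z.2 i)| ≤ d q} ≤
      ENNReal.ofReal D * ENNReal.ofReal ((hh N q.1.1 / hh N k) ^ n) := by
    intro q
    refine (bad_one (by omega) (fun i _ => ⟨h1.nonneg _ i, h1.le_one _ i⟩)
      (fun i _ => ⟨h2.nonneg _ i, h2.le_one _ i⟩) (hd q)).trans ?_
    rw [← ENNReal.ofReal_mul hD0.le]
    apply ENNReal.ofReal_le_ofReal
    simp only [d]
    set r := hh N q.1.1 / hh N k
    have hr0 : 0 < r := by have := hh_pos hN q.1.1; positivity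
    have hr1 : r ≤ 1 := (div_le_one hk).2 (hh_anti hN (hpt q).1.1)
    have f4 : r ^ (2 * (n-1)) ≤ r ^ n := pow_le_pow_of_le_one hr0.le hr1 (by omega)
    rw [mul_pow, ← pow_mul, ← mul_assoc]
    gcongr
  refine (ENNReal.tsum_le_tsum h3).trans ?_
  rw [ENNReal.tsum_mul_left]
  calc _ ≤ ENNReal.ofReal D * ENNReal.ofReal (1 / 20 / D) := by gcongr
    _ = _ := by rw [← ENNReal.ofReal_mul hD0.le]; congr 1; field_simp

end SA
end

section
open MeasureTheory Metric Set
open scoped ENNReal NNReal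

namespace SA
variable {n : ℕ} {ω : E n → ℝ}

def tl (y : X n) : E n := WithLp.toLp 2 y

lemma tl_cont : Continuous (tl : X n → E n) := PiLp.continuous_toLp 2 _

lemma tl_vp : MeasurePreserving (tl : X n → E n) volume volume := PiLp.volume_preserving_toLp (Fin n)

def ee (j : Fin n) : E n := tl (Pi.single j 1)

lemma ee_norm (j : Fin n) : ‖ee j‖ = 1 := by
  have : ee j = EuclideanSpace.single j (1:ℝ) := rfl
  rw [this, PiLp.norm_single]; simp

lemma tl_line (y : X n) (τ : ℝ) (j : Fin n) : tl (y + τ • Pi.single j 1) = tl y + τ • ee j := rfl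

lemma UU_meas {N : ℝ} (hN : 0 < N) (β : ℝ) (κ : ℕ) : MeasurableSet (UU ω N β κ) := by
  have : UU ω N β κ = ⋃ q : {q : ℕ × (Fin n → ℤ) | κ ≤ q.1 ∧
      (mu ω).real (cube N q.1 q.2) ≤ (β * hh N q.1 ^ 2) ^ n}, cube N q.1.1 q.1.2 := by
    ext x
    simp only [UU, mem_ofPred_eq, mem_iUnion, BadAt, cube]
    constructor
    · rintro ⟨k, h1, h2⟩
      exact ⟨⟨(k, idx N k x), h1, h2⟩, rfl⟩
    · rintro ⟨⟨⟨k, m⟩, h1, h2⟩, h3⟩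
      simp only at h3
      exact ⟨k, h1, by rw [h3]; exact h2⟩
  rw [this]
  exact MeasurableSet.iUnion fun q => cube_meas hN _ _

lemma deriv_bd {φ : E n → ℝ} {x : X n} {w : E n → ℝ} (hw : Continuous w) (hwp : ∀ x, 0 < w x) {r c : ℝ} (hr : 0 < r)
    (hc : 0 < c)
    (h : ∀ y A, dist (tl x) y ≤ r → (∀ z ∈ segment ℝ (tl x) y, w z ≤ A) →
      |φ (tl x) - φ y| ≤ c * A * dist (tl x) y)
    {L : X n →L[ℝ] ℝ} (hL : HasFDerivAt (fun y => φ (tl y)) L x) (j : Fin n) :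
    |L (Pi.single j 1)| ≤ c * w (tl x) := by
  apply le_of_forall_pos_le_add
  intro ε hε
  have h1 : HasDerivAt (fun τ : ℝ => x + τ • (Pi.single j 1 : X n)) (Pi.single j 1) 0 := by
    have := ((hasDerivAt_id (0:ℝ)).smul_const (Pi.single j 1 : X n)).const_add x
    simpa using this
  have h2 : HasDerivAt (fun τ : ℝ => φ (tl (x + τ • (Pi.single j 1 : X n)))) (L (Pi.single j 1)) 0 := by
    have hL' : HasFDerivAt (fun y => φ (tl y)) L (x + (0:ℝ) • (Pi.single j 1 : X n)) := by simpa using hL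
    exact hL'.comp_hasDerivAt (0:ℝ) h1
  have h3 := h2.le_of_lip' (C := c * (w (tl x) + ε / c)) (by have := hwp (tl x); positivity) ?_
  · rw [Real.norm_eq_abs] at h3
    refine h3.trans (le_of_eq ?_)
    field_simp
  · have h4 : ∀ᶠ z in nhds (tl x), w z < w (tl x) + ε / c :=
      hw.continuousAt.eventually_lt_const (by have : 0 < ε / c := by positivity
                                              linarith)
    obtain ⟨δ, hδ, hδ'⟩ := Metric.eventually_nhds_iff.1 h4
    rw [Metric.eventually_nhds_iff]
    refine ⟨min δ r, by positivity, fun τ hτ => ?_⟩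
    rw [tl_line, tl_line]
    simp only [zero_smul, add_zero, sub_zero]
    rw [Real.dist_eq, sub_zero, lt_min_iff] at hτ
    have hd : dist (tl x) (tl x + τ • ee j) = |τ| := by
      rw [dist_self_add_right, norm_smul, ee_norm, mul_one, Real.norm_eq_abs]
    have := h (tl x + τ • ee j) (w (tl x) + ε / c) (by rw [hd]; exact hτ.2.le) (fun z hz => by
      apply (hδ' _).le
      have h5 := (convex_ball (tl x) δ).segment_subset (mem_ball_self hδ)
        (by rw [mem_ball, dist_comm, hd]; exact hτ.1) hz
      exact h5)
    rw [hd] at this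
    rw [Real.norm_eq_abs, Real.norm_eq_abs, abs_sub_comm]
    exact this

lemma fderiv_bd {f : E n → ℝ} {x : X n} {L : X n →L[ℝ] ℝ} (hL : HasFDerivAt (fun y => f (tl y)) L x)
    (j : Fin n) : |L (Pi.single j 1)| ≤ ‖fderiv ℝ f (tl x)‖ := by
  have h1 : HasFDerivAt (fun z : E n => WithLp.ofLp z) (EuclideanSpace.equiv (Fin n) ℝ : E n →L[ℝ] X n) (tl x) :=
    (EuclideanSpace.equiv (Fin n) ℝ : E n →L[ℝ] X n).hasFDerivAt
  have h2 : HasFDerivAt f (L.comp (EuclideanSpace.equiv (Fin n) ℝ : E n →L[ℝ] X n)) (tl x) :=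
    HasFDerivAt.comp (g := fun y => f (tl y)) (tl x) hL h1
  rw [h2.fderiv]
  have h3 := (L.comp (EuclideanSpace.equiv (Fin n) ℝ : E n →L[ℝ] X n)).le_opNorm (ee j)
  rw [ee_norm, mul_one] at h3
  exact h3

lemma markov {α : Type*} [MeasurableSpace α] {μ : Measure α} {h : α → ℝ≥0∞} (hm : Measurable h)
    {a : ℝ≥0∞} (ha : ∫⁻ x, h x ∂μ ≤ a) : μ {x | 20 * a < h x} ≤ ENNReal.ofReal (1/20) := by
  rcases eq_or_ne a 0 with h0 | h0
  · subst h0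
    have h1 : ∫⁻ x, h x ∂μ = 0 := le_antisymm ha zero_le
    rw [lintegral_eq_zero_iff hm] at h1
    have : μ {x | 20 * 0 < h x} = 0 := by
      rw [Filter.EventuallyEq, ae_iff] at h1
      refine measure_mono_null (fun x hx => ?_) h1
      simp only [mul_zero, mem_ofPred_eq] at hx
      exact hx.ne'
    rw [this]; exact zero_le
  rcases eq_or_ne a ∞ with h1 | h1
  · subst h1
    have : {x | 20 * ∞ < h x} = ∅ := by
      ext x; simp [ENNReal.mul_top]
    rw [this]; simp
  · have e0 : (20 : ℝ≥0∞) * a ≠ 0 := by simp [h0]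
    have e1 : (20 : ℝ≥0∞) * a ≠ ∞ := ENNReal.mul_ne_top (by norm_num) h1
    refine (measure_mono (fun x (hx : 20 * a < h x) => hx.le)).trans
      ((meas_ge_le_lintegral_div hm.aemeasurable e0 e1).trans ?_)
    rw [ENNReal.div_le_iff e0 e1]
    refine ha.trans (le_of_eq ?_)
    rw [← mul_assoc]
    have : ENNReal.ofReal (1/20) * 20 = 1 := by
      rw [show (20:ℝ≥0∞) = ENNReal.ofReal 20 by norm_num, ← ENNReal.ofReal_mul (by norm_num)]; norm_num
    rw [this, one_mul]

def OO (n : ℕ) : Set (X n) := univ.pi fun _ => Ioo (0:ℝ) 1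

lemma OO_sub : OO n ⊆ II n := pi_mono fun _ _ => Ioo_subset_Icc_self

noncomputable def nu (ω : E n → ℝ) (f : E n → ℝ) (S : Set (E n)) : ℝ≥0∞ :=
  ∫⁻ x in S, ENNReal.ofReal (wt ω x ^ (n-1) * ‖fderiv ℝ f x‖)

/-- open box -/
def OB (N : ℝ) (k : ℕ) (x0 : E n) : Set (E n) :=
  {x | ∀ i, -N + hh N k * idx N k x0 i < x i ∧ x i < -N + hh N k * idx N k x0 i + hh N k}

lemma Lk_OB {N η C1 : ℝ} {k : ℕ} {x0 : E n} {Φ1 Φ2 : E n → Fin n → ℝ} (h1 : Adm ω N η C1 k x0 Φ1)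
    (h2 : Adm ω N η C1 k x0 Φ2) {s s' : X n} (hs : s ∈ OO n) (hs' : s' ∈ OO n) {x : E n}
    (h : Lk Φ1 Φ2 s s' x) : x ∈ OB N k x0 := by
  obtain ⟨t, ht, h⟩ := h
  intro i
  have g1 := hs i (mem_univ i); have g2 := hs' i (mem_univ i)
  have h3 := h i
  have t0 := ht.1; have t1 := ht.2
  constructor
  · by_contra hc
    push Not at hc
    rw [h1.lo x i hc, h2.lo x i hc] at h3
    have := g1.1; have := g2.1
    rcases le_or_gt t (1/2) with ht' | ht' <;> nlinarith
  · by_contra hc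
    push Not at hc
    rw [h1.hi x i hc, h2.hi x i hc] at h3
    have := g1.2; have := g2.2
    rcases le_or_gt t (1/2) with ht' | ht' <;> nlinarith

lemma OB_cube {N : ℝ} (hN : 0 < N) {k : ℕ} {x0 : E n} : OB N k x0 ⊆ cube N k (idx N k x0) := by
  intro x hx
  rw [mem_cube_iff hN]
  exact fun i => ⟨(hx i).1.le, (hx i).2⟩

lemma OB_open {N : ℝ} {k : ℕ} {x0 : E n} : IsOpen (OB N k x0) := by
  have : OB N k x0 = ⋂ i, {x : E n | -N + hh N k * idx N k x0 i < x i} ∩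
      {x : E n | x i < -N + hh N k * idx N k x0 i + hh N k} := by
    ext x; simp [OB]
  rw [this]
  refine isOpen_iInter_of_finite fun i => (isOpen_lt (by fun_prop) (by fun_prop)).inter
    (isOpen_lt (by fun_prop) (by fun_prop))

lemma cube_zero {N : ℝ} (hN : 0 < N) {x0 x : E n} (h0 : ∀ i, |x0 i| < N) {k : ℕ} (hx : x ∈ cube N k (idx N k x0)) :
    ∀ i, |x i| ≤ N := by
  have h1 : x ∈ cube N 0 (idx N 0 x0) := cube_anti (Nat.zero_le k) x0 hx
  have h2 : x0 ∈ cube N 0 (fun _ => 0) := by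
    rw [mem_cube_iff hN]
    intro i
    have := h0 i
    rw [abs_lt] at this
    simp [hh]; constructor <;> linarith
  have h3 : idx N 0 x0 = fun _ => 0 := h2
  rw [h3, mem_cube_iff hN] at h1
  intro i
  have := h1 i
  simp [hh] at this
  rw [abs_le]; constructor <;> linarith

end SA
end

section
open MeasureTheory Metric Set
open scoped ENNReal NNReal

namespace SA
variable {n : ℕ} {ω : E n → ℝ}

noncomputable def mm (ω : E n → ℝ) (N : ℝ) (k : ℕ) (x0 : E n) : ℝ :=
  ((mu ω).real (cube N k (idx N k x0))) ^ ((1:ℝ)/n)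

lemma good_vol {P KA C : ℝ} (hw : SW n ω P KA C) {η C1 : ℝ} (hη : 0 < η) (hC1 : 0 < C1) :
    ∃ C4 > 0, ∀ N, 0 < N → ∀ (k : ℕ) (x0 : E n), (∀ i, |x0 i| < N) → ∀ Φ1 Φ2 : E n → Fin n → ℝ,
    Adm ω N η C1 k x0 Φ1 → Adm ω N η C1 k x0 Φ2 → ∀ f : E n → ℝ, (∃ K, LipschitzWith K f) →
    volume (TT (fun y => Φ1 (tl y)) (fun y => Φ2 (tl y)) (fun y => f (tl y)) ''
      (((tl ⁻¹' (OB N k x0 \ UU ω N (bt ω N η k x0) k)) ×ˢ JJ n) ×ˢ Icc (0:ℝ) 1)) ≤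
      ENNReal.ofReal (C4 / mm ω N k x0 ^ (n-1)) * nu ω f (cube N k (idx N k x0)) := by
  have hn := hw.hn
  set D : ℝ := (2*n+1).factorial * 9 ^ n * 2 ^ n with hD
  have hD0 : 0 < D := by positivity
  refine ⟨D * (C1 / η) ^ (n-1), by positivity, ?_⟩
  intro N hN k x0 hx0 Φ1 Φ2 h1 h2 f ⟨Kf, hf⟩
  have hm : 0 < mm ω N k x0 := Real.rpow_pos_of_pos (cube_mass_pos hw hN k _) _
  set c : ℝ := C1 / (η * mm ω N k x0) with hc
  have hc0 : 0 < c := by positivity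
  obtain ⟨K1, hK1⟩ := h1.lip
  obtain ⟨K2, hK2⟩ := h2.lip
  have htl := PiLp.lipschitzWith_toLp 2 (fun _ : Fin n => ℝ)
  set Kt : ℝ≥0 := (Fintype.card (Fin n) : ℝ≥0) ^ (1 / (2:ℝ≥0∞)).toReal
  set O : Set (X n) := tl ⁻¹' (OB N k x0)
  have hmaps : MapsTo (tl : X n → E n) O {x | ∀ i, |x i| ≤ N} := fun y hy =>
    cube_zero hN hx0 (OB_cube hN hy)
  have hO : IsOpen O := OB_open.preimage tl_cont
  have L1 : LipschitzOnWith (K1 * Kt) (fun y : X n => Φ1 (tl y)) O := hK1.comp htl.lipschitzOnWith hmaps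
  have L2 : LipschitzOnWith (K2 * Kt) (fun y : X n => Φ2 (tl y)) O := hK2.comp htl.lipschitzOnWith hmaps
  have L3 : LipschitzOnWith (Kf * Kt) (fun y : X n => f (tl y)) O := (hf.comp htl).lipschitzOnWith
  set KK := max (K1 * Kt) (max (K2 * Kt) (Kf * Kt))
  set S : Set (E n) := OB N k x0 \ UU ω N (bt ω N η k x0) k with hS
  have hSm : MeasurableSet S := OB_open.measurableSet.diff (UU_meas hN _ _)
  have hwc := wt_cont hw.pos hw.cont
  have hwp := wt_pos hw.pos
  have hG : Measurable fun x : E n => ENNReal.ofReal ((c * wt ω x) ^ (n-1) * ‖fderiv ℝ f x‖) := by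
    have h := measurable_fderiv ℝ f
    have h' : Measurable fun x : E n => (c * wt ω x) ^ (n-1) := (Continuous.measurable (by fun_prop))
    exact (h'.mul h.norm).ennreal_ofReal
  have dd : ∀ Φ : E n → Fin n → ℝ, Adm ω N η C1 k x0 Φ → ∀ y ∈ (tl ⁻¹' S : Set (X n)), ∀ A : X n →L[ℝ] X n,
      HasFDerivAt (fun y => Φ (tl y)) A y → ∀ i j, |A (Pi.single j 1) i| ≤ c * wt ω (tl y) := by
    intro Φ hΦ y hy A hA i j
    have := deriv_bd (φ := fun x => Φ x i) (x := y) hwc hwp (hh_pos hN (k+1)) hc0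
      (fun z A' hz hz' => hΦ.good (tl y) z A' hy.2 hz hz' i)
      (L := (ContinuousLinearMap.proj i).comp A) (by
        have := (ContinuousLinearMap.proj (R := ℝ) (φ := fun _ : Fin n => ℝ) i).hasFDerivAt (x := Φ (tl y))
        exact this.comp y hA) j
    exact this
  have key := area_link (n := n) (by omega) (O := O) (S := tl ⁻¹' S) hO (hSm.preimage tl_vp.measurable)
    (fun y hy => hy.1) (F1 := fun y => Φ1 (tl y)) (F2 := fun y => Φ2 (tl y)) (g := fun y => f (tl y)) (K := KK)
    (L1.weaken (le_max_left _ _)) (L2.weaken ((le_max_left _ _).trans (le_max_right _ _)))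
    (L3.weaken ((le_max_right _ _).trans (le_max_right _ _)))
    (fun y i => ⟨h1.nonneg _ i, h1.le_one _ i⟩) (fun y i => ⟨h2.nonneg _ i, h2.le_one _ i⟩)
    (b := fun y => c * wt ω (tl y)) (G := fun y => ‖fderiv ℝ f (tl y)‖)
    (fun y => mul_pos hc0 (hwp _)) (fun y => norm_nonneg _) (hG.comp tl_vp.measurable)
    (dd Φ1 h1) (dd Φ2 h2) (fun y hy A hA j => fderiv_bd hA j)
  refine key.trans ?_
  rw [tl_vp.setLIntegral_comp_preimage hSm hG]
  have e1 : ∀ x : E n, ENNReal.ofReal ((c * wt ω x) ^ (n-1) * ‖fderiv ℝ f x‖) =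
      ENNReal.ofReal (c ^ (n-1)) * ENNReal.ofReal (wt ω x ^ (n-1) * ‖fderiv ℝ f x‖) := fun x => by
    rw [← ENNReal.ofReal_mul (by positivity), mul_pow, mul_assoc]
  simp_rw [e1]
  rw [lintegral_const_mul' _ _ ENNReal.ofReal_ne_top, ← mul_assoc, ← ENNReal.ofReal_mul hD0.le]
  have e2 : D * c ^ (n-1) = D * (C1 / η) ^ (n-1) / mm ω N k x0 ^ (n-1) := by
    rw [hc, ← div_div, div_pow (C1/η), mul_div_assoc]
  rw [e2]
  gcongr
  exact lintegral_mono_set (sdiff_subset.trans (OB_cube hN))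

lemma link {P KA C : ℝ} (hw : SW n ω P KA C) : ∃ η C1 C4 : ℝ, 0 < η ∧ 0 < C4 ∧
    (∀ N, 0 < N → ∀ k x0, ∃ Φ, Adm ω N η C1 k x0 Φ ∧ Adm ω N η C1 (k+1) x0 Φ) ∧
    ∀ N, 0 < N → ∀ (k : ℕ) (x0 : E n), (∀ i, |x0 i| < N) → ∀ Φ1 Φ2 : E n → Fin n → ℝ,
    Adm ω N η C1 k x0 Φ1 → Adm ω N η C1 k x0 Φ2 → ∀ f : E n → ℝ, (∃ K, LipschitzWith K f) →
    volume {z : X n × X n | z.1 ∈ OO n ∧ z.2 ∈ OO n ∧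
      ENNReal.ofReal (C4 / mm ω N k x0 ^ (n-1)) * nu ω f (cube N k (idx N k x0)) <
        volume (f '' {x | Lk Φ1 Φ2 z.1 z.2 x})} ≤ ENNReal.ofReal (1/10) := by
  obtain ⟨C1, hC1, hadm⟩ := exists_adm hw
  obtain ⟨η, hη, hbad⟩ := bad_total hw hC1
  obtain ⟨C4, hC4, hgood⟩ := good_vol hw hη hC1
  refine ⟨η, C1, 20 * C4, hη, by positivity, fun N hN => hadm N η hN hη, ?_⟩
  intro N hN k x0 hx0 Φ1 Φ2 h1 h2 f hf
  have hb := hbad N hN k x0 Φ1 Φ2 h1 h2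
  have hg := hgood N hN k x0 hx0 Φ1 Φ2 h1 h2 f hf
  set A := TT (fun y => Φ1 (tl y)) (fun y => Φ2 (tl y)) (fun y => f (tl y)) ''
      (((tl ⁻¹' (OB N k x0 \ UU ω N (bt ω N η k x0) k)) ×ˢ JJ n) ×ˢ Icc (0:ℝ) 1) with hA
  set a := ENNReal.ofReal (C4 / mm ω N k x0 ^ (n-1)) * nu ω f (cube N k (idx N k x0)) with ha
  have ea : ENNReal.ofReal (20 * C4 / mm ω N k x0 ^ (n-1)) * nu ω f (cube N k (idx N k x0)) = 20 * a := by
    rw [ha, mul_div_assoc, ENNReal.ofReal_mul (by norm_num), mul_assoc]; norm_num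
  rw [ea]
  set A' := toMeasurable volume A
  have hA'm : MeasurableSet A' := measurableSet_toMeasurable _ _
  have hA'v : volume A' ≤ a := (measure_toMeasurable _).trans_le hg
  have hint : ∫⁻ z : X n × X n, volume (Prod.mk z ⁻¹' A') ≤ a := by
    rw [← Measure.prod_apply hA'm]; exact hA'v
  have hmk := markov (measurable_measure_prodMk_left hA'm) hint
  have hsub : {z : X n × X n | z.1 ∈ OO n ∧ z.2 ∈ OO n ∧ 20 * a < volume (f '' {x | Lk Φ1 Φ2 z.1 z.2 x})} ⊆
      {z : X n × X n | z.1 ∈ II n ∧ z.2 ∈ II n ∧ ∃ x ∈ cube N k (idx N k x0),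
      x ∈ UU ω N (bt ω N η k x0) k ∧ Lk Φ1 Φ2 z.1 z.2 x} ∪
      {z | 20 * a < volume (Prod.mk z ⁻¹' A')} := by
    rintro ⟨s, s'⟩ ⟨hs, hs', hlt⟩
    simp only at hs hs' hlt
    by_cases hz : ∃ x ∈ cube N k (idx N k x0), x ∈ UU ω N (bt ω N η k x0) k ∧ Lk Φ1 Φ2 s s' x
    · exact Or.inl ⟨OO_sub hs, OO_sub hs', hz⟩
    · right
      refine hlt.trans_le (measure_mono ?_)
      rintro _ ⟨x, hx, rfl⟩
      have hxO := Lk_OB h1 h2 hs hs' hx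
      have hxU : x ∉ UU ω N (bt ω N η k x0) k := fun h => hz ⟨x, OB_cube hN hxO, h, hx⟩
      obtain ⟨t, ht, he⟩ := hx
      apply subset_toMeasurable volume A
      have hH : (1 - t) • Φ1 x + t • (Φ2 x - (s' - s)) = s := by
        ext i
        have := he i
        simp only [Pi.add_apply, Pi.smul_apply, Pi.sub_apply, smul_eq_mul]
        linarith
      refine ⟨((WithLp.ofLp x, s' - s), t), ⟨⟨⟨hxO, hxU⟩, fun i _ => ?_⟩, ht⟩, ?_⟩
      · have g1 := hs i (mem_univ i); have g2 := hs' i (mem_univ i)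
        simp only [Pi.sub_apply, mem_Icc]
        constructor <;> linarith [g1.1, g1.2, g2.1, g2.2]
      · have e : tl (WithLp.ofLp x) = x := rfl
        simp only [TT, e, hH]
        simp
  refine (measure_mono hsub).trans ((measure_union_le _ _).trans ?_)
  refine (add_le_add hb hmk).trans (le_of_eq ?_)
  rw [← ENNReal.ofReal_add (by norm_num) (by norm_num)]; norm_num

end SA
end

section
open MeasureTheory Metric Set
open scoped ENNReal NNReal

namespace SA
variable {n : ℕ} {ω : E n → ℝ}

lemma vol_OO : volume (OO n) = 1 := by
  rw [OO, volume_pi_pi]; simp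

lemma meas_OO : MeasurableSet (OO n) := MeasurableSet.univ_pi fun _ => measurableSet_Ioo

lemma greedy (Bad : ℕ → Set (X n × X n))
    (hBad : ∀ j, volume {z | z.1 ∈ OO n ∧ z.2 ∈ OO n ∧ z ∈ Bad j} ≤ ENNReal.ofReal (1/10)) :
    ∃ s : ℕ → X n, ∀ j, s j ∈ OO n ∧ (s j, s (j+1)) ∉ Bad j := by
  let B : ℕ → Set (X n × X n) := fun j => toMeasurable volume {z | z.1 ∈ OO n ∧ z.2 ∈ OO n ∧ z ∈ Bad j}
  have hBm : ∀ j, MeasurableSet (B j) := fun j => measurableSet_toMeasurable _ _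
  have hBv : ∀ j, volume (B j) ≤ ENNReal.ofReal (1/10) := fun j => (measure_toMeasurable _).trans_le (hBad j)
  let D : ℕ → Set (X n) := fun j => {s | ENNReal.ofReal (1/2) ≤ volume (Prod.mk s ⁻¹' B j)}
  have hD : ∀ j, volume (D j) ≤ ENNReal.ofReal (1/5) := by
    intro j
    refine (meas_ge_le_lintegral_div (measurable_measure_prodMk_left (hBm j)).aemeasurable
      (by simp) ENNReal.ofReal_ne_top).trans ?_
    rw [← Measure.prod_apply (hBm j), ENNReal.div_le_iff (by simp) ENNReal.ofReal_ne_top,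
      ← ENNReal.ofReal_mul (by norm_num)]
    refine (hBv j).trans (le_of_eq ?_)
    norm_num
  have ex : ∀ S : Set (X n), volume S < 1 → ∃ s ∈ OO n, s ∉ S := by
    intro S hS
    by_contra hcon
    push Not at hcon
    have : (1:ℝ≥0∞) ≤ volume S := by rw [← vol_OO (n := n)]; exact measure_mono hcon
    exact absurd hS (not_lt.2 this)
  have hstart : ∃ s, s ∈ OO n ∧ s ∉ D 0 := by
    obtain ⟨s, h1, h2⟩ := ex (D 0) ((hD 0).trans_lt (by
      rw [← ENNReal.ofReal_one]; exact ENNReal.ofReal_lt_ofReal_iff (by norm_num) |>.2 (by norm_num)))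
    exact ⟨s, h1, h2⟩
  have hstep : ∀ j, ∀ s : {s // s ∈ OO n ∧ s ∉ D j}, ∃ s' : {s // s ∈ OO n ∧ s ∉ D (j+1)},
      (s.1, s'.1) ∉ Bad j := by
    rintro j ⟨s, hs, hsD⟩
    have h1 : volume (Prod.mk s ⁻¹' B j) < ENNReal.ofReal (1/2) := not_le.1 hsD
    obtain ⟨s', h2, h3⟩ := ex (Prod.mk s ⁻¹' B j ∪ D (j+1)) (by
      refine (measure_union_le _ _).trans_lt ?_
      refine (add_le_add h1.le (hD (j+1))).trans_lt ?_
      rw [← ENNReal.ofReal_add (by norm_num) (by norm_num), ← ENNReal.ofReal_one]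
      exact ENNReal.ofReal_lt_ofReal_iff (by norm_num) |>.2 (by norm_num))
    rw [mem_union, not_or] at h3
    refine ⟨⟨s', h2, h3.2⟩, fun hb => h3.1 ?_⟩
    exact subset_toMeasurable volume {z | z.1 ∈ OO n ∧ z.2 ∈ OO n ∧ z ∈ Bad j} ⟨hs, h2, hb⟩
  choose g hg using hstep
  obtain ⟨s0, h0⟩ := hstart
  let q : (j : ℕ) → {s // s ∈ OO n ∧ s ∉ D j} := fun j => Nat.rec ⟨s0, h0⟩ (fun j s => g j s) j
  exact ⟨fun j => (q j).1, fun j => ⟨(q j).2.1, hg j (q j)⟩⟩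

def tent (j : ℕ) (t : ℝ) : ℝ := max 0 (1 - |t - j|)

lemma tent_nonneg (j : ℕ) (t : ℝ) : 0 ≤ tent j t := le_max_left _ _

lemma tent_le_one (j : ℕ) (t : ℝ) : tent j t ≤ 1 := max_le zero_le_one (by linarith [abs_nonneg (t - j)])

lemma tent_lip (j : ℕ) (t t' : ℝ) : |tent j t - tent j t'| ≤ |t - t'| := by
  unfold tent
  refine (abs_max_sub_max_le_max _ _ _ _).trans ?_
  rw [sub_self, abs_zero]
  refine max_le (abs_nonneg _) ?_
  have : 1 - |t - j| - (1 - |t' - j|) = |t' - j| - |t - j| := by ring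
  rw [this]
  refine (abs_abs_sub_abs_le _ _).trans (le_of_eq ?_)
  rw [abs_sub_comm]; congr 1; ring

lemma tent_sum {m : ℕ} (v : ℕ → X n) {i : ℕ} (hi : i < m) {τ : ℝ} (h : τ ∈ Icc (0:ℝ) 1) :
    ∑ j ∈ Finset.range (m+1), tent j (i + τ) • v j = (1-τ) • v i + τ • v (i+1) := by
  obtain ⟨h0, h1⟩ := h
  have hne : i ≠ i + 1 := by omega
  rw [← Finset.sum_subset (s₁ := {i, i+1})]
  · rw [Finset.sum_pair hne]
    congr 2
    · unfold tent
      rw [add_sub_cancel_left, abs_of_nonneg h0, max_eq_right (by linarith)]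
    · unfold tent
      push_cast
      rw [show (i:ℝ) + τ - (i + 1) = -(1 - τ) by ring, abs_neg, abs_of_nonneg (by linarith),
        max_eq_right (by linarith)]; ring
  · intro j hj; simp only [Finset.mem_insert, Finset.mem_singleton] at hj
    rw [Finset.mem_range]; omega
  · intro j _ hj
    simp only [Finset.mem_insert, Finset.mem_singleton, not_or] at hj
    have : tent j (i + τ) = 0 := by
      unfold tent
      apply max_eq_left
      have : j < i ∨ i + 1 < j := by omega
      rcases this with h | h
      · have : (j:ℝ) + 1 ≤ i := by exact_mod_cast h
        rw [abs_of_nonneg (by linarith)]; linarith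
      · have : (i:ℝ) + 1 + 1 ≤ j := by exact_mod_cast h
        rw [abs_of_nonpos (by linarith)]; linarith
    rw [this, zero_smul]

lemma idx_lo {N : ℝ} (hN : 0 < N) {y : E n} (hy : ∀ i, |y i| < N) (k : ℕ) (i : Fin n) :
    (0:ℝ) ≤ hh N k * idx N k y i := by
  have hk := hh_pos hN k
  have : 0 ≤ idx N k y i := by
    unfold idx
    apply Int.floor_nonneg.2
    have := (abs_lt.1 (hy i)).1
    exact div_nonneg (by linarith) hk.le
  have : (0:ℝ) ≤ idx N k y i := by exact_mod_cast this
  positivity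

lemma idx_hi {N : ℝ} (hN : 0 < N) {y : E n} (hy : ∀ i, |y i| < N) (k : ℕ) (i : Fin n) :
    -N + hh N k * idx N k y i + hh N k ≤ N := by
  have hk := hh_pos hN k
  have h1 : idx N k y i < 2 ^ k := by
    unfold idx
    rw [Int.floor_lt]
    push_cast
    rw [div_lt_iff₀ hk]
    have := (abs_lt.1 (hy i)).2
    unfold hh
    field_simp
    linarith
  have h2 : (idx N k y i : ℝ) + 1 ≤ 2 ^ k := by exact_mod_cast h1
  have h3 : hh N k * (idx N k y i + 1) ≤ hh N k * 2 ^ k := by gcongr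
  have h4 : hh N k * 2 ^ k = 2 * N := by unfold hh; field_simp
  linarith

lemma chain {N η C1 : ℝ} (hN : 0 < N) (κ : ℕ → ℕ) (y : ℕ → E n) (hy : ∀ j i, |y j i| < N)
    (Φ : ℕ → E n → Fin n → ℝ) (h1 : ∀ j, Adm ω N η C1 (κ j) (y j) (Φ j))
    (h2 : ∀ j, Adm ω N η C1 (κ (j+1)) (y (j+1)) (Φ j)) (f : E n → ℝ) (hf : ∃ K, LipschitzWith K f)
    (s : ℕ → X n) (hs : ∀ j, s j ∈ OO n) (m : ℕ) (hm : 0 < m) {a : ℝ}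
    (hf0 : ∀ x ∈ cube N (κ 0) (idx N (κ 0) (y 0)), f x ≤ 0)
    (hf1 : ∀ x ∈ cube N (κ (m+1)) (idx N (κ (m+1)) (y (m+1))), a ≤ f x) :
    ENNReal.ofReal a ≤ ∑ j ∈ Finset.range m, volume (f '' {x | Lk (Φ j) (Φ (j+1)) (s j) (s (j+1)) x}) := by
  obtain ⟨Kf, hKf⟩ := hf
  choose KΦ hKΦ using fun j => (h1 j).lip
  let H : E n × ℝ → (Fin n → ℝ) := fun z => ∑ j ∈ Finset.range (m+1), tent j z.2 • (Φ j z.1 - s j)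
  have hle : ∀ j x, ‖Φ j x - s j‖ ≤ 1 := by
    intro j x
    rw [pi_norm_le_iff_of_nonneg zero_le_one]
    intro i
    have g1 := hs j i (mem_univ i)
    have g2 := (h1 j).nonneg x i
    have g3 := (h1 j).le_one x i
    rw [Real.norm_eq_abs, abs_le, Pi.sub_apply]
    constructor <;> linarith [g1.1, g1.2]
  have hH : LipschitzOnWith (∑ j ∈ Finset.range (m+1), (KΦ j + 1)) H
      {z | (∀ i, |z.1 i| ≤ N) ∧ z.2 ∈ Icc (0:ℝ) m} := by
    apply LipschitzOnWith.of_dist_le_mul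
    rintro ⟨x, t⟩ ⟨hx, ht⟩ ⟨x', t'⟩ ⟨hx', ht'⟩
    rw [dist_eq_norm]
    simp only [H]
    rw [← Finset.sum_sub_distrib, NNReal.coe_sum, Finset.sum_mul]
    refine (norm_sum_le _ _).trans (Finset.sum_le_sum fun j _ => ?_)
    have e : tent j t • (Φ j x - s j) - tent j t' • (Φ j x' - s j) =
      tent j t • (Φ j x - Φ j x') + (tent j t - tent j t') • (Φ j x' - s j) := by module
    rw [e]
    refine (norm_add_le _ _).trans ?_
    rw [norm_smul, norm_smul, Real.norm_of_nonneg (tent_nonneg j t), Real.norm_eq_abs]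
    have d1 : dist x x' ≤ dist (x, t) (x', t') := le_max_left _ _
    have d2 : dist t t' ≤ dist (x, t) (x', t') := le_max_right _ _
    have g1 : ‖Φ j x - Φ j x'‖ ≤ KΦ j * dist x x' := by
      rw [← dist_eq_norm]; exact (hKΦ j).dist_le_mul x hx x' hx'
    have g2 := tent_lip j t t'
    rw [← Real.dist_eq t] at g2
    have g3 : tent j t * ‖Φ j x - Φ j x'‖ ≤ 1 * (KΦ j * dist (x, t) (x', t')) := by
      gcongr
      · exact tent_le_one j t
      · exact g1.trans (by gcongr)
    have g4 : |tent j t - tent j t'| * ‖Φ j x' - s j‖ ≤ dist (x, t) (x', t') * 1 := by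
      gcongr
      · exact g2.trans d2
      · exact hle j x'
    push_cast
    linarith
  have hmr : (0:ℝ) < m := by exact_mod_cast hm
  have hH0 : ∀ x, H (x, 0) = Φ 0 x - s 0 := by
    intro x
    have := tent_sum (fun j => Φ j x - s j) hm (τ := 0) (by simp)
    simpa [H] using this
  have hHm : ∀ x, H (x, m) = Φ m x - s m := by
    intro x
    obtain ⟨k, rfl⟩ : ∃ k, m = k + 1 := ⟨m-1, by omega⟩
    have := tent_sum (fun j => Φ j x - s j) (Nat.lt_succ_self k) (τ := 1) (by simp)
    simpa [H] using this
  have Lk_of : ∀ j x, Φ j x - s j = 0 → Lk (Φ j) (Φ j) (s j) (s j) x := by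
    intro j x h
    refine ⟨0, by simp, fun i => ?_⟩
    have := congrFun h i
    simp only [Pi.sub_apply, Pi.zero_apply] at this
    rw [this]; ring
  have key : Ioo 0 a ⊆ ⋃ j ∈ Finset.range m, f '' {x | Lk (Φ j) (Φ (j+1)) (s j) (s (j+1)) x} := by
    intro τ hτ
    obtain ⟨x, hx, t, ht, hz, hG⟩ := continuation hN hmr H (fun x => f x - τ) (K' := Kf) hH
      (LipschitzOnWith.of_dist_le_mul fun u _ v _ => by
        have := hKf.dist_le_mul u v
        rw [Real.dist_eq] at this ⊢
        simpa using this)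
      (fun x hx t ht i hi => by
        simp only [H, Finset.sum_apply, Pi.smul_apply, smul_eq_mul, Pi.sub_apply]
        apply Finset.sum_nonpos
        intro j _
        have := (h1 j).lo x i (by rw [hi]; linarith [idx_lo hN (hy j) (κ j) i])
        rw [this]
        have g := (hs j i (mem_univ i)).1
        exact mul_nonpos_of_nonneg_of_nonpos (tent_nonneg _ _) (by linarith))
      (fun x hx t ht i hi => by
        simp only [H, Finset.sum_apply, Pi.smul_apply, smul_eq_mul, Pi.sub_apply]
        apply Finset.sum_nonneg
        intro j _
        have := (h1 j).hi x i (by rw [hi]; exact idx_hi hN (hy j) (κ j) i)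
        rw [this]
        have g := (hs j i (mem_univ i)).2
        exact mul_nonneg (tent_nonneg _ _) (by linarith))
      (fun x hx h => by
        rw [hH0] at h
        have := hf0 x (OB_cube hN (Lk_OB (h1 0) (h1 0) (hs 0) (hs 0) (Lk_of 0 x h)))
        linarith [hτ.1])
      (fun x hx h => by
        rw [hHm] at h
        have := hf1 x (OB_cube hN (Lk_OB (h2 m) (h2 m) (hs m) (hs m) (Lk_of m x h)))
        linarith [hτ.2])
    have hfx : f x = τ := by linarith
    have hex : ∃ j, j < m ∧ ∃ τ' ∈ Icc (0:ℝ) 1, t = j + τ' := by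
      rcases eq_or_lt_of_le ht.2 with h | h
      · exact ⟨m-1, by omega, 1, by simp, by
          rw [h, Nat.cast_sub (by omega)]; simp⟩
      · refine ⟨⌊t⌋₊, (Nat.floor_lt ht.1).2 h, t - ⌊t⌋₊, ⟨?_, ?_⟩, by ring⟩
        · linarith [Nat.floor_le ht.1]
        · linarith [Nat.lt_floor_add_one t]
    obtain ⟨j, hj, τ', hτ', rfl⟩ := hex
    simp only [H] at hz
    rw [tent_sum (fun j => Φ j x - s j) hj hτ'] at hz
    simp only [mem_iUnion]
    refine ⟨j, Finset.mem_range.2 hj, x, ⟨τ', hτ', fun i => ?_⟩, hfx⟩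
    have := congrFun hz i
    simpa using this
  have e : ENNReal.ofReal a = volume (Ioo 0 a) := by simp
  rw [e]
  exact (measure_mono key).trans (measure_biUnion_finset_le _ _)

end SA
end

section
open MeasureTheory Metric Set
open scoped ENNReal NNReal

namespace SA
variable {n : ℕ} {ω : E n → ℝ}

lemma Adm.congr {N η C1 : ℝ} {k : ℕ} {x0 y0 : E n} {Φ : E n → Fin n → ℝ} (h : Adm ω N η C1 k x0 Φ)
    (e : idx N k x0 = idx N k y0) : Adm ω N η C1 k y0 Φ := by
  have hb : bt ω N η k x0 = bt ω N η k y0 := by simp only [bt, e]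
  refine ⟨h.nonneg, h.le_one, ?_, ?_, h.lip, ?_, ?_⟩
  · rw [← e]; exact h.lo
  · rw [← e]; exact h.hi
  · rw [← e, ← hb]; exact h.good
  · rw [← hb]; exact h.jump

lemma idx_zero {N : ℝ} (hN : 0 < N) {x : E n} (hx : ∀ i, |x i| < N) : idx N 0 x = fun _ => 0 := by
  have : x ∈ cube N 0 (fun _ => 0) := by
    rw [mem_cube_iff hN]
    intro i
    have := hx i
    rw [abs_lt] at this
    simp [hh]; constructor <;> linarith
  exact this

noncomputable def lam (ω f : E n → ℝ) (N : ℝ) (k : ℕ) (x : E n) : ℝ≥0∞ :=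
  ENNReal.ofReal (1 / mm ω N k x ^ (n-1)) * nu ω f (cube N k (idx N k x))

lemma potential {P KA C : ℝ} (hw : SW n ω P KA C) : ∃ C5 : ℝ, 0 < C5 ∧ ∀ N, 0 < N → ∀ f : E n → ℝ,
    (∃ K, LipschitzWith K f) → (∀ x, f x ≠ 0 → ∀ i, |x i| < N / 2) → ∀ x, (∀ i, |x i| < N) →
    ENNReal.ofReal (f x) ≤ ENNReal.ofReal C5 * ∑' k, lam ω f N k x := by
  obtain ⟨η, C1, C4, hη, hC4, hadm, hlink⟩ := link hw
  obtain ⟨C3, hC3, hchild⟩ := child_mass hw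
  have hn := hw.hn
  refine ⟨C4 * (C3 ^ ((1:ℝ)/n)) ^ (n-1) + C4, by positivity, ?_⟩
  intro N hN f hf hsupp x hx
  let c : E n := tl fun _ => -(3 * N / 4)
  have hci : ∀ i, c i = -(3 * N / 4) := fun i => rfl
  have hcN : ∀ i, |c i| < N := fun i => by
    rw [hci, abs_neg, abs_of_pos (by positivity)]; linarith
  have h0eq : idx N 0 c = idx N 0 x := by rw [idx_zero hN hcN, idx_zero hN hx]
  have h2c : idx N 2 c = fun _ => 0 := by
    have : c ∈ cube N 2 (fun _ => 0) := by
      rw [mem_cube_iff hN]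
      intro i
      rw [hci]
      simp [hh]; constructor <;> linarith
    exact this
  choose Ψ hΨ1 hΨ2 using fun k x0 => hadm N hN k x0
  let κ : ℕ → ℕ := fun j => match j with | 0 => 2 | 1 => 1 | (j+2) => j
  let y : ℕ → E n := fun j => match j with | 0 => c | 1 => c | (j+2) => x
  let Φ : ℕ → E n → Fin n → ℝ := fun j => match j with | 0 => Ψ 1 c | 1 => Ψ 0 c | (j+2) => Ψ j x
  have hy : ∀ j i, |y j i| < N := fun j => by
    match j with
    | 0 => exact hcN
    | 1 => exact hcN
    | (j+2) => exact hx
  have h1 : ∀ j, Adm ω N η C1 (κ j) (y j) (Φ j) := fun j => by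
    match j with
    | 0 => exact hΨ2 1 c
    | 1 => exact hΨ2 0 c
    | (j+2) => exact hΨ1 j x
  have h2 : ∀ j, Adm ω N η C1 (κ (j+1)) (y (j+1)) (Φ j) := fun j => by
    match j with
    | 0 => exact hΨ1 1 c
    | 1 => exact (hΨ1 0 c).congr h0eq
    | (j+2) => exact hΨ2 j x
  let L : ℕ → ℝ≥0∞ := fun j => ENNReal.ofReal (C4 / mm ω N (κ (j+1)) (y (j+1)) ^ (n-1)) *
    nu ω f (cube N (κ (j+1)) (idx N (κ (j+1)) (y (j+1))))
  obtain ⟨s, hs⟩ := greedy (fun j => {z : X n × X n | L j < volume (f '' {x | Lk (Φ j) (Φ (j+1)) z.1 z.2 x})})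
    (fun j => hlink N hN _ _ (hy (j+1)) _ _ (h2 j) (h1 (j+1)) f hf)
  have hfin : ∀ a, a < f x → ENNReal.ofReal a ≤ ∑' j, L j := by
    intro a ha
    obtain ⟨K, hK⟩ := hf
    have hev : ∃ m, 0 < m ∧ ∀ z ∈ cube N m (idx N m x), a ≤ f z := by
      have h3 : ∀ᶠ z in nhds x, a < f z := hK.continuous.continuousAt.eventually_const_lt ha
      obtain ⟨δ, hδ, h4⟩ := Metric.eventually_nhds_iff.1 h3
      have h5 : Filter.Tendsto (fun m : ℕ => n * (2 * N * (1/2 : ℝ)^m)) Filter.atTop (nhds (n * (2 * N * 0))) :=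
        ((tendsto_pow_atTop_nhds_zero_of_lt_one (by norm_num) (by norm_num)).const_mul _).const_mul _
      rw [mul_zero, mul_zero] at h5
      obtain ⟨m, hm, hm'⟩ := ((h5.eventually (gt_mem_nhds hδ)).and (Filter.eventually_gt_atTop 0)).exists
      refine ⟨m, hm', fun z hz => (h4 ?_).le⟩
      refine (cube_dist hN hz).trans_lt (lt_of_le_of_lt (le_of_eq ?_) hm)
      unfold hh; rw [one_div, inv_pow]; ring
    obtain ⟨m, hm, hm'⟩ := hev
    have := chain hN κ y hy Φ h1 h2 f ⟨K, hK⟩ s (fun j => (hs j).1) (m+1) (by omega) (a := a) (by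
      intro z hz
      change z ∈ cube N 2 (idx N 2 c) at hz
      rw [h2c, mem_cube_iff hN] at hz
      by_contra hcon
      push Not at hcon
      have i0 : Fin n := ⟨0, by omega⟩
      have g1 := hsupp z hcon.ne' i0
      have g2 := hz i0
      simp [hh] at g2
      rw [abs_lt] at g1
      linarith [g2.2, g1.1]) hm'
    refine this.trans ((Finset.sum_le_sum fun j _ => ?_).trans (ENNReal.sum_le_tsum (Finset.range (m+1))))
    exact not_lt.1 (hs j).2
  have hfin2 : ENNReal.ofReal (f x) ≤ ∑' j, L j := by
    refine le_of_forall_lt fun b hb => ?_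
    have hbt : b ≠ ∞ := (hb.trans_le le_top).ne
    have hb' : b.toReal < f x := by
      rw [ENNReal.lt_ofReal_iff_toReal_lt hbt] at hb; exact hb
    obtain ⟨a, ha1, ha2⟩ := exists_between hb'
    refine lt_of_lt_of_le ?_ (hfin a ha2)
    rw [ENNReal.lt_ofReal_iff_toReal_lt hbt]; exact ha1
  refine hfin2.trans ?_
  rw [tsum_eq_zero_add' ENNReal.summable]
  have hL1 : ∀ j, L (j+1) = ENNReal.ofReal C4 * lam ω f N j x := fun j => by
    change ENNReal.ofReal (C4 / mm ω N j x ^ (n-1)) * nu ω f (cube N j (idx N j x)) = _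
    have : 0 ≤ mm ω N j x ^ (n-1) := by unfold mm; positivity
    rw [lam, ← mul_assoc, ← ENNReal.ofReal_mul hC4.le, mul_one_div]
  have hL0 : L 0 ≤ ENNReal.ofReal (C4 * (C3 ^ ((1:ℝ)/n)) ^ (n-1)) * lam ω f N 0 x := by
    change ENNReal.ofReal (C4 / mm ω N 1 c ^ (n-1)) * nu ω f (cube N 1 (idx N 1 c)) ≤ _
    rw [lam, ← mul_assoc, ← ENNReal.ofReal_mul (by positivity), mul_one_div]
    have e1 : mm ω N 0 x ≤ C3 ^ ((1:ℝ)/n) * mm ω N 1 c := by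
      unfold mm
      rw [← h0eq, ← Real.mul_rpow (by linarith) (by positivity)]
      exact Real.rpow_le_rpow (by positivity) (hchild N hN 0 c) (by positivity)
    have p0 : 0 < mm ω N 0 x := Real.rpow_pos_of_pos (cube_mass_pos hw hN _ _) _
    have p1 : 0 < mm ω N 1 c := Real.rpow_pos_of_pos (cube_mass_pos hw hN _ _) _
    gcongr ENNReal.ofReal ?_ * ?_
    · rw [div_le_div_iff₀ (by positivity) (by positivity), mul_assoc, ← mul_pow]
      gcongr
    · unfold nu
      apply lintegral_mono_set
      rw [← h0eq]
      exact cube_anti (Nat.zero_le 1) c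
  simp_rw [hL1]
  rw [ENNReal.tsum_mul_left, ENNReal.ofReal_add (by positivity) (by positivity), add_mul]
  gcongr
  exact hL0.trans (by gcongr; exact ENNReal.le_tsum 0)

end SA
end

section
open MeasureTheory Metric Set
open scoped ENNReal NNReal

namespace SA
variable {n : ℕ} {ω : E n → ℝ}

noncomputable def psi (u : ℝ) : ℝ := if u ≤ 1 then u else 2 - 1 / u

lemma psi_nonneg {u : ℝ} (h : 0 < u) : 0 ≤ psi u := by
  unfold psi; split_ifs with h1
  · exact h.le
  · push Not at h1
    have : 1 / u ≤ 1 := by rw [div_le_one h]; exact h1.le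
    linarith

lemma psi_le {u : ℝ} (h : 0 < u) : psi u ≤ 2 := by
  unfold psi; split_ifs with h1
  · linarith
  · have : 0 < 1 / u := by positivity
    linarith

lemma psi_mono {u v : ℝ} (h : 0 < u) (huv : u ≤ v) : psi u ≤ psi v := by
  have hv : 0 < v := h.trans_le huv
  unfold psi; split_ifs with h1 h2 h2
  · exact huv
  · push Not at h2
    have : 1 / v ≤ 1 := by rw [div_le_one hv]; exact h2.le
    linarith
  · linarith
  · have := one_div_le_one_div_of_le h huv
    linarith

lemma psi_step {u r : ℝ} (h : 0 < u) (hr : 0 < r) (hr1 : r < 1) :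
    (1 - r) * min u (1/u) ≤ psi u - psi (r * u) := by
  have hru : 0 < r * u := by positivity
  have hlt : r * u < u := by nlinarith
  unfold psi
  rcases le_or_gt u 1 with h1 | h1
  · rw [if_pos h1, if_pos (by linarith)]
    have : min u (1/u) ≤ u := min_le_left _ _
    nlinarith
  · rw [if_neg (not_le.2 h1)]
    have h2 : min u (1/u) ≤ 1/u := min_le_right _ _
    have h3 : (1 - r) * min u (1/u) ≤ (1 - r) * (1/u) := by gcongr
    refine h3.trans ?_
    have hv : 0 < 1 / u := by positivity
    have huv : u * (1/u) = 1 := by field_simp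
    set v := 1 / u
    split_ifs with h4
    · have : r ≤ v := by nlinarith
      have h5 : v < 1 := by nlinarith
      nlinarith [mul_nonneg (sub_nonneg.2 this) (by linarith : (0:ℝ) ≤ u - v), sq_nonneg (1 - v)]
    · have h5 : 1 / (r * u) = v / r := by simp only [v]; field_simp
      rw [h5]
      have h6 : (1 - r) * v ≤ v / r - v := by
        rw [le_sub_iff_add_le, le_div_iff₀ hr]
        nlinarith [mul_nonneg hv.le (sq_nonneg (1 - r))]
      linarith

lemma geo_sum {u : ℕ → ℝ} (hu : ∀ k, 0 < u k) {r : ℝ} (hr : 0 < r) (hr1 : r < 1)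
    (hs : ∀ k, u (k+1) ≤ r * u k) (K : ℕ) : ∑ k ∈ Finset.range K, min (u k) (1 / u k) ≤ 2 / (1 - r) := by
  have h1r : 0 < 1 - r := by linarith
  have key : (1 - r) * ∑ k ∈ Finset.range K, min (u k) (1 / u k) ≤ psi (u 0) - psi (u K) := by
    induction K with
    | zero => simp
    | succ K ih =>
      rw [Finset.sum_range_succ, mul_add]
      have h1 := psi_step (hu K) hr hr1
      have h2 := psi_mono (hu (K+1)) (hs K)
      linarith
  rw [le_div_iff₀ h1r]
  have := psi_nonneg (hu K)
  have := psi_le (hu 0)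
  linarith

lemma rev_doubling {P KA C : ℝ} (hw : SW n ω P KA C) : ∃ q : ℝ, 0 < q ∧ q < 1 ∧ ∀ N, 0 < N →
    ∀ (k : ℕ) (x : E n), (mu ω).real (cube N (k+1) (idx N (k+1) x)) ≤ q * (mu ω).real (cube N k (idx N k x)) := by
  obtain ⟨θ, hθ, H⟩ := small_vol hw (ε := 1/4) (by norm_num)
  refine ⟨max (1-θ) (1/2), by positivity, max_lt (by linarith) (by norm_num), ?_⟩
  intro N hN k x
  have hk := hh_pos hN (k+1)
  set Q := cube N k (idx N k x)
  set Q' := cube N (k+1) (idx N (k+1) x)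
  have hsub : Q' ⊆ Q := cube_anti (Nat.le_succ k) x
  have hQ' : MeasurableSet Q' := cube_meas hN _ _
  have hvol : volume.real (Q \ Q') = hh N k ^ n - hh N (k+1) ^ n := by
    rw [measureReal_diff hsub hQ' (by rw [cube_vol hN]; simp), Measure.real, Measure.real, cube_vol hN, cube_vol hN,
      ENNReal.toReal_ofReal (by have := hh_pos hN k; positivity), ENNReal.toReal_ofReal (by positivity)]
  have h1 : ¬ (mu ω).real (Q \ Q') ≤ θ * (mu ω).real Q := by
    intro h
    have := H N hN k x (Q \ Q') sdiff_subset ((cube_meas hN _ _).diff hQ') h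
    rw [hvol, hh_succ N k, mul_pow] at this
    have h2 : (2:ℝ) ≤ 2 ^ n := by
      calc (2:ℝ) = 2 ^ 1 := by norm_num
        _ ≤ 2 ^ n := pow_le_pow_right₀ (by norm_num) (by have := hw.hn; omega)
    have h3 : 0 < hh N (k+1) ^ n := by positivity
    nlinarith
  push Not at h1
  rw [measureReal_diff hsub hQ' (mu_lt_top hw.cont (cube_bdd hN _ _)).ne] at h1
  have h2 : (1 - θ) * (mu ω).real Q ≤ max (1-θ) (1/2) * (mu ω).real Q := by
    gcongr; exact le_max_left _ _
  linarith

lemma idx_meas (N : ℝ) (k : ℕ) : Measurable (idx (n := n) N k) := by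
  rw [measurable_pi_iff]
  intro i
  unfold idx
  refine Int.measurable_floor.comp ?_
  exact Continuous.measurable (by fun_prop)

lemma lint_idx (ρ : Measure (E n)) (N : ℝ) (k : ℕ) (F : (Fin n → ℤ) → ℝ≥0∞) :
    ∫⁻ x, F (idx N k x) ∂ρ = ∑' j, F j * ρ (cube N k j) := by
  rw [← lintegral_map (f := F) (Measurable.of_discrete) (idx_meas N k), lintegral_countable']
  refine tsum_congr fun j => ?_
  rw [Measure.map_apply (idx_meas N k) (measurableSet_singleton j)]
  rfl

/-- key dyadic sum estimate -/
lemma dy_sum {P KA C : ℝ} (hw : SW n ω P KA C) : ∃ C6 : ℝ, 0 < C6 ∧ ∀ N, 0 < N → ∀ (y : E n) (A : Set (E n)) (m : ℝ),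
    0 < m → mu ω A ≤ ENNReal.ofReal m →
    ∑' k, ENNReal.ofReal (1 / mm ω N k y ^ (n-1)) * mu ω (A ∩ cube N k (idx N k y)) ≤
      ENNReal.ofReal (C6 * m ^ ((1:ℝ)/n)) := by
  obtain ⟨q, hq, hq1, H⟩ := rev_doubling hw
  have hn := hw.hn
  have hnr : (0:ℝ) < n := by positivity
  set r := q ^ ((1:ℝ)/n)
  have hr : 0 < r := Real.rpow_pos_of_pos hq _
  have hr1 : r < 1 := Real.rpow_lt_one hq.le hq1 (by positivity)
  have h1r : 0 < 1 - r := by linarith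
  refine ⟨2 / (1 - r), by positivity, ?_⟩
  intro N hN y A m hm hA
  set s := m ^ ((1:ℝ)/n)
  have hs : 0 < s := Real.rpow_pos_of_pos hm _
  have hb : ∀ k, 0 < mm ω N k y := fun k => Real.rpow_pos_of_pos (cube_mass_pos hw hN _ _) _
  have pw : ∀ a : ℝ, 0 < a → (a ^ ((1:ℝ)/n)) ^ n = a := fun a ha => by
    rw [← Real.rpow_natCast, ← Real.rpow_mul ha.le]
    field_simp; simp
  have hstep : ∀ k, mm ω N (k+1) y / s ≤ r * (mm ω N k y / s) := fun k => by
    rw [← mul_div_assoc]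
    gcongr
    unfold mm
    rw [← Real.mul_rpow hq.le measureReal_nonneg]
    exact Real.rpow_le_rpow measureReal_nonneg (H N hN k y) (by positivity)
  have hterm : ∀ k, ENNReal.ofReal (1 / mm ω N k y ^ (n-1)) * mu ω (A ∩ cube N k (idx N k y)) ≤
      ENNReal.ofReal (s * min (mm ω N k y / s) (1 / (mm ω N k y / s))) := by
    intro k
    set b := mm ω N k y with hbdef
    have hb0 : 0 < b := hb k
    have e1 : mu ω (A ∩ cube N k (idx N k y)) ≤ ENNReal.ofReal (min (s^n) (b^n)) := by
      rw [pw m hm, hbdef, mm, pw _ (cube_mass_pos hw hN _ _)]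
      rw [ENNReal.ofReal_min]
      refine le_min ((measure_mono inter_subset_left).trans hA) ((measure_mono inter_subset_right).trans ?_)
      rw [Measure.real, ENNReal.ofReal_toReal (mu_lt_top hw.cont (cube_bdd hN _ _)).ne]
    calc _ ≤ ENNReal.ofReal (1 / b ^ (n-1)) * ENNReal.ofReal (min (s^n) (b^n)) := by gcongr
      _ = ENNReal.ofReal (1 / b ^ (n-1) * min (s^n) (b^n)) := by rw [← ENNReal.ofReal_mul (by positivity)]
      _ ≤ _ := by
        apply ENNReal.ofReal_le_ofReal
        obtain ⟨l, rfl⟩ : ∃ l, n = l + 1 := ⟨n-1, by omega⟩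
        simp only [Nat.add_sub_cancel]
        rw [mul_min_of_nonneg _ _ hs.le, one_div_div]
        refine le_min ?_ ?_
        · calc 1 / b ^ l * min (s^(l+1)) (b^(l+1)) ≤ 1 / b ^ l * b^(l+1) := by
                gcongr; exact min_le_right _ _
            _ = s * (b / s) := by rw [pow_succ]; field_simp
        · rcases le_or_gt s b with hsb | hsb
          · calc 1 / b ^ l * min (s^(l+1)) (b^(l+1)) ≤ 1 / b ^ l * s^(l+1) := by
                  gcongr; exact min_le_left _ _
              _ = s * (s / b) ^ l := by rw [pow_succ, div_pow]; field_simp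
              _ ≤ s * (s / b) ^ 1 := by
                  gcongr ?_ * ?_
                  exact pow_le_pow_of_le_one (by positivity) ((div_le_one hb0).2 hsb) (by omega)
              _ = _ := by rw [pow_one]
          · calc 1 / b ^ l * min (s^(l+1)) (b^(l+1)) ≤ 1 / b ^ l * b^(l+1) := by
                  gcongr; exact min_le_right _ _
              _ = b := by rw [pow_succ]; field_simp
              _ ≤ s * (s / b) := by
                  rw [← mul_div_assoc, le_div_iff₀ hb0]; nlinarith
  rw [ENNReal.tsum_eq_iSup_nat]
  refine iSup_le fun K => ?_
  refine (Finset.sum_le_sum fun k _ => hterm k).trans ?_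
  rw [← ENNReal.ofReal_sum_of_nonneg (fun k _ => by have := hb k; positivity)]
  apply ENNReal.ofReal_le_ofReal
  rw [← Finset.mul_sum, mul_comm]
  gcongr
  exact geo_sum (fun k => by have := hb k; positivity) hr hr1 hstep K

end SA
end

section
open MeasureTheory Metric Set
open scoped ENNReal NNReal

namespace SA
variable {n : ℕ} {ω : E n → ℝ}

lemma swap_idx (ρ₁ ρ₂ : Measure (E n)) (N : ℝ) (k : ℕ) (F : (Fin n → ℤ) → ℝ≥0∞) :
    ∫⁻ x, F (idx N k x) * ρ₂ (cube N k (idx N k x)) ∂ρ₁ =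
      ∫⁻ x, F (idx N k x) * ρ₁ (cube N k (idx N k x)) ∂ρ₂ := by
  rw [lint_idx ρ₁ N k (fun j => F j * ρ₂ (cube N k j)), lint_idx ρ₂ N k (fun j => F j * ρ₁ (cube N k j))]
  exact tsum_congr fun j => by ring

lemma weak_type {P KA C : ℝ} (hw : SW n ω P KA C) : ∃ C7 : ℝ, 0 < C7 ∧ ∀ f : E n → ℝ,
    (∃ K, LipschitzWith K f) → HasCompactSupport f → ∀ l : ℝ, 0 < l →
    ENNReal.ofReal l * (mu ω {x | l ≤ f x}) ^ (1 - (1:ℝ)/n) ≤ ENNReal.ofReal C7 * nu ω f univ := by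
  obtain ⟨C5, h5, H5⟩ := potential hw
  obtain ⟨C6, h6, H6⟩ := dy_sum hw
  refine ⟨C5 * C6, by positivity, fun f hL hf l hl => ?_⟩
  have hn := hw.hn
  have hn1 : (1:ℝ)/n < 1 := by
    rw [div_lt_one (by positivity)]; exact_mod_cast (by omega : 1 < n)
  have hfc : Continuous f := hL.choose_spec.continuous
  set A := {x | l ≤ f x} with hA
  have hAm : MeasurableSet A := measurableSet_le measurable_const hfc.measurable
  have hAs : A ⊆ tsupport f := fun x hx => subset_tsupport f (by
    have : l ≤ f x := hx
    simp only [Function.mem_support]; linarith)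
  have hAb : Bornology.IsBounded A := hf.isCompact.isBounded.subset hAs
  have hfin : mu ω A < ∞ := mu_lt_top hw.cont hAb
  rcases eq_or_ne (mu ω A) 0 with h0 | h0
  · rw [h0, ENNReal.zero_rpow_of_pos (by linarith)]; simp
  obtain ⟨R, hR⟩ := hf.isCompact.isBounded.exists_norm_le
  set N : ℝ := 2 * (|R| + 1) with hNd
  have hN : 0 < N := by positivity
  have hsup : ∀ x, f x ≠ 0 → ∀ i, |x i| < N / 2 := by
    intro x hx i
    have h1 := hR x (subset_tsupport f hx)
    have h2 : |x i| ≤ ‖x‖ := by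
      have := PiLp.norm_apply_le x i
      simpa using this
    have := le_abs_self R
    rw [hNd]; linarith
  set m := (mu ω).real A with hm
  have hmA : mu ω A = ENNReal.ofReal m := by rw [hm, Measure.real, ENNReal.ofReal_toReal hfin.ne]
  have hm0 : 0 < m := ENNReal.toReal_pos h0 hfin.ne
  set ρ₁ := (mu ω).restrict A with hρ1
  set ρ₂ : Measure (E n) := volume.withDensity fun x => ENNReal.ofReal (wt ω x ^ (n-1) * ‖fderiv ℝ f x‖) with hρ2
  have hnu : ∀ S, MeasurableSet S → nu ω f S = ρ₂ S := fun S hS => by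
    rw [hρ2, withDensity_apply _ hS]; rfl
  have key : ENNReal.ofReal l * mu ω A ≤ ENNReal.ofReal (C5 * C6) * nu ω f univ * ENNReal.ofReal (m ^ ((1:ℝ)/n)) := by
    calc ENNReal.ofReal l * mu ω A = ∫⁻ x in A, ENNReal.ofReal l ∂(mu ω) := by rw [setLIntegral_const]
      _ ≤ ∫⁻ x in A, ENNReal.ofReal C5 * ∑' k, lam ω f N k x ∂(mu ω) := by
          refine setLIntegral_mono' hAm fun x hx => ?_
          have hx' : l ≤ f x := hx
          refine (ENNReal.ofReal_le_ofReal hx').trans (H5 N hN f hL hsup x fun i => ?_)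
          have := hsup x (by linarith) i
          linarith
      _ = ENNReal.ofReal C5 * ∑' k, ∫⁻ x, lam ω f N k x ∂ρ₁ := by
          have hlm : ∀ k, Measurable (lam ω f N k) := fun k =>
            (Measurable.of_discrete (f := fun j : Fin n → ℤ =>
              ENNReal.ofReal (1 / (((mu ω).real (cube N k j)) ^ ((1:ℝ)/n)) ^ (n-1)) * nu ω f (cube N k j))).comp (idx_meas N k)
          rw [lintegral_const_mul _ (Measurable.tsum hlm), lintegral_tsum fun k => (hlm k).aemeasurable]
      _ = ENNReal.ofReal C5 * ∑' k, ∫⁻ x, ENNReal.ofReal (1 / mm ω N k x ^ (n-1)) * mu ω (A ∩ cube N k (idx N k x)) ∂ρ₂ := by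
          congr 1
          refine tsum_congr fun k => ?_
          have := swap_idx ρ₁ ρ₂ N k (fun j => ENNReal.ofReal (1 / (((mu ω).real (cube N k j)) ^ ((1:ℝ)/n)) ^ (n-1)))
          unfold lam mm
          simp_rw [hnu _ (cube_meas hN k _)]
          rw [this]
          refine lintegral_congr fun x => ?_
          rw [hρ1, Measure.restrict_apply (cube_meas hN k _), inter_comm]
      _ = ENNReal.ofReal C5 * ∫⁻ x, ∑' k, ENNReal.ofReal (1 / mm ω N k x ^ (n-1)) * mu ω (A ∩ cube N k (idx N k x)) ∂ρ₂ := by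
          have hlm : ∀ k, Measurable (fun x => ENNReal.ofReal (1 / mm ω N k x ^ (n-1)) * mu ω (A ∩ cube N k (idx N k x))) := fun k =>
            (Measurable.of_discrete (f := fun j : Fin n → ℤ =>
              ENNReal.ofReal (1 / (((mu ω).real (cube N k j)) ^ ((1:ℝ)/n)) ^ (n-1)) * mu ω (A ∩ cube N k j))).comp (idx_meas N k)
          rw [lintegral_tsum fun k => (hlm k).aemeasurable]
      _ ≤ ENNReal.ofReal C5 * ∫⁻ x, ENNReal.ofReal (C6 * m ^ ((1:ℝ)/n)) ∂ρ₂ := by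
          gcongr with x
          exact H6 N hN x A m hm0 hmA.le
      _ = _ := by
          rw [lintegral_const, hnu _ MeasurableSet.univ, ENNReal.ofReal_mul h6.le, ENNReal.ofReal_mul h5.le]
          ring
  have hm1 : 0 < m ^ ((1:ℝ)/n) := by positivity
  rw [← ENNReal.mul_le_mul_iff_left (c := ENNReal.ofReal (m ^ ((1:ℝ)/n))) (by simpa using hm1) ENNReal.ofReal_ne_top]
  refine le_trans (le_of_eq ?_) key
  rw [mul_assoc]
  congr 1
  rw [hmA, ENNReal.ofReal_rpow_of_pos hm0, ← ENNReal.ofReal_mul (by positivity), ← Real.rpow_add hm0]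
  simp
end SA
end

section
open MeasureTheory Metric Set
open scoped ENNReal NNReal

namespace SA
variable {n : ℕ} {ω : E n → ℝ}

def tr (u : E n → ℝ) (c : ℝ) (x : E n) : ℝ := min (max (u x - c) 0) c

lemma tr_low {u : E n → ℝ} {c : ℝ} (hc : 0 < c) {x : E n} (h : u x ≤ c) : fderiv ℝ (tr u c) x = 0 := by
  refine IsLocalMin.fderiv_eq_zero (Filter.Eventually.of_forall fun y => ?_)
  have : tr u c x = 0 := by
    unfold tr; rw [max_eq_right (by linarith), min_eq_left hc.le]
  rw [this]; exact le_min (le_max_right _ _) hc.le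

lemma tr_high {u : E n → ℝ} {c : ℝ} {x : E n} (h : 2 * c ≤ u x) (hc : 0 < c) : fderiv ℝ (tr u c) x = 0 := by
  refine IsLocalMax.fderiv_eq_zero (Filter.Eventually.of_forall fun y => ?_)
  have : tr u c x = c := by
    unfold tr; rw [max_eq_left (by linarith), min_eq_right (by linarith)]
  rw [this]; exact min_le_right _ _

lemma tr_mid {u : E n → ℝ} (hu : Continuous u) {c : ℝ} {x : E n} (h : c < u x) (h' : u x < 2 * c) :
    fderiv ℝ (tr u c) x = fderiv ℝ u x := by
  have : tr u c =ᶠ[nhds x] fun y => u y - c := by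
    filter_upwards [hu.continuousAt.eventually (Ioo_mem_nhds h h')] with y hy
    unfold tr; rw [max_eq_left (by linarith [hy.1]), min_eq_left (by linarith [hy.2])]
  rw [this.fderiv_eq, fderiv_sub_const]

lemma tsum_rpow_le {ι : Type*} (b : ι → ℝ≥0∞) {q : ℝ} (hq : 1 ≤ q) : ∑' j, b j ^ q ≤ (∑' j, b j) ^ q := by
  have h : ∀ a : ℝ≥0∞, a ^ q = a * a ^ (q - 1) := fun a => by
    conv_lhs => rw [show q = 1 + (q - 1) by ring]
    rw [ENNReal.rpow_add_of_nonneg _ _ zero_le_one (by linarith), ENNReal.rpow_one]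
  calc ∑' j, b j ^ q ≤ ∑' j, b j * (∑' j, b j) ^ (q - 1) := by
        refine ENNReal.tsum_le_tsum fun j => ?_
        rw [h]
        exact mul_le_mul_right (ENNReal.rpow_le_rpow (ENNReal.le_tsum j) (by linarith)) _
    _ = _ := by rw [ENNReal.tsum_mul_right, ← h]

lemma tr_sum (hpos : ∀ x, 0 < ω x) (hc : Continuous ω) {u : E n → ℝ} (hu : Continuous u) (hu0 : ∀ x, 0 ≤ u x) :
    ∑' j : ℤ, nu ω (tr u ((2:ℝ) ^ j)) univ ≤ nu ω u univ := by
  unfold nu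
  rw [← lintegral_tsum]
  · refine lintegral_mono fun x => ?_
    have hw : 0 ≤ wt ω x ^ (n-1) := pow_nonneg (wt_pos hpos x).le _
    have : ∃ j0 : ℤ, (∀ j, j ≠ j0 → fderiv ℝ (tr u ((2:ℝ) ^ j)) x = 0) ∧
        ‖fderiv ℝ (tr u ((2:ℝ) ^ j0)) x‖ ≤ ‖fderiv ℝ u x‖ := by
      have hp : ∀ j : ℤ, (0:ℝ) < 2 ^ j := fun j => by positivity
      rcases (hu0 x).eq_or_lt with h0 | h0
      · have hz : ∀ j : ℤ, fderiv ℝ (tr u ((2:ℝ) ^ j)) x = 0 := fun j =>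
          tr_low (hp j) (by rw [← h0]; exact (hp j).le)
        exact ⟨0, fun j _ => hz j, by rw [hz, norm_zero]; exact norm_nonneg _⟩
      · obtain ⟨j0, hj⟩ := exists_mem_Ico_zpow h0 (one_lt_two (α := ℝ))
        refine ⟨j0, fun j hne => ?_, ?_⟩
        · rcases lt_or_gt_of_ne hne with h | h
          · refine tr_high ?_ (hp j)
            have : (2:ℝ) ^ (j+1) ≤ 2 ^ j0 := zpow_le_zpow_right₀ one_le_two (by omega)
            rw [zpow_add_one₀ two_ne_zero] at this
            linarith [hj.1]
          · refine tr_low (hp j) ?_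
            have : (2:ℝ) ^ (j0+1) ≤ 2 ^ j := zpow_le_zpow_right₀ one_le_two (by omega)
            linarith [hj.2]
        · rcases hj.1.eq_or_lt with h | h
          · rw [tr_low (hp j0) h.symm.le, norm_zero]; exact norm_nonneg _
          · have h2 := hj.2
            rw [zpow_add_one₀ two_ne_zero] at h2
            rw [tr_mid hu h (by linarith)]
    obtain ⟨j0, h1, h2⟩ := this
    rw [tsum_eq_single j0 fun j hj => by simp [h1 j hj]]
    exact ENNReal.ofReal_le_ofReal (mul_le_mul_of_nonneg_left h2 hw)
  · intro j
    exact ((((wt_cont hpos hc).measurable.pow_const _).mul (measurable_fderiv ℝ _).norm).ennreal_ofReal).aemeasurable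

lemma strong_type {P KA C : ℝ} (hw : SW n ω P KA C) : ∃ C8 : ℝ, 0 < C8 ∧ ∀ u : E n → ℝ, (∀ x, 0 ≤ u x) →
    (∃ K, LipschitzWith K u) → HasCompactSupport u →
    ∫⁻ x, ENNReal.ofReal (u x ^ ((n:ℝ)/(n-1))) ∂(mu ω) ≤ (ENNReal.ofReal C8 * nu ω u univ) ^ ((n:ℝ)/(n-1)) := by
  obtain ⟨C7, h7, H7⟩ := weak_type hw
  refine ⟨4 * C7, by positivity, fun u hu0 hL hs => ?_⟩
  have hn := hw.hn
  have hn2 : (2:ℝ) ≤ n := by exact_mod_cast hn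
  set q : ℝ := (n:ℝ)/(n-1) with hq
  have hq1 : 1 ≤ q := by rw [hq, le_div_iff₀ (by linarith)]; linarith
  have hq0 : 0 < q := by linarith
  have hqi : (1 - (1:ℝ)/n) * q = 1 := by
    have : (n:ℝ) - 1 ≠ 0 := by linarith
    rw [hq]; field_simp
  obtain ⟨K, hK⟩ := hL
  have huc : Continuous u := hK.continuous
  have hwk : ∀ j : ℤ, ENNReal.ofReal ((2:ℝ)^j) * (mu ω {x | (2:ℝ)^(j+1) ≤ u x}) ^ (1 - (1:ℝ)/n) ≤
      ENNReal.ofReal C7 * nu ω (tr u ((2:ℝ)^j)) univ := by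
    intro j
    have hp : (0:ℝ) < 2 ^ j := by positivity
    have h := H7 (tr u ((2:ℝ)^j)) ⟨K, ?_⟩ ?_ ((2:ℝ)^j) hp
    · convert h using 5
      ext x
      unfold tr
      rw [zpow_add_one₀ two_ne_zero]
      simp only [mem_ofPred_eq, le_min_iff, le_max_iff, le_refl, and_true]
      constructor
      · intro h; left; linarith
      · rintro (h | h) <;> linarith
    · have h1 : LipschitzWith K fun x => u x - (2:ℝ)^j := by
        refine LipschitzWith.of_dist_le_mul fun x y => ?_
        rw [dist_sub_right]; exact hK.dist_le_mul x y
      exact (h1.max_const 0).min_const _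
    · refine hs.mono fun x hx => ?_
      simp only [Function.mem_support] at hx ⊢
      intro h0; apply hx
      unfold tr; rw [h0, max_eq_right (by linarith), min_eq_left hp.le]
  set S : ℤ → Set (E n) := fun j => {x | (2:ℝ)^(j+1) ≤ u x ∧ u x < (2:ℝ)^(j+2)} with hS
  have hSm : ∀ j, MeasurableSet (S j) := fun j =>
    (measurableSet_le measurable_const huc.measurable).inter (measurableSet_lt huc.measurable measurable_const)
  calc ∫⁻ x, ENNReal.ofReal (u x ^ q) ∂(mu ω)
      = ∫⁻ x in ⋃ j, S j, ENNReal.ofReal (u x ^ q) ∂(mu ω) := by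
        rw [← lintegral_indicator (MeasurableSet.iUnion hSm)]
        refine lintegral_congr fun x => ?_
        by_cases hx : x ∈ ⋃ j, S j
        · rw [indicator_of_mem hx]
        · rw [indicator_of_notMem hx]
          rcases (hu0 x).eq_or_lt with h0 | h0
          · rw [← h0, Real.zero_rpow hq0.ne', ENNReal.ofReal_zero]
          · exfalso; apply hx
            obtain ⟨j0, hj⟩ := exists_mem_Ico_zpow h0 (one_lt_two (α := ℝ))
            refine mem_iUnion.2 ⟨j0 - 1, ?_, ?_⟩
            · rw [sub_add_cancel]; exact hj.1
            · rw [show j0 - 1 + 2 = j0 + 1 by ring]; exact hj.2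
    _ ≤ ∑' j, ∫⁻ x in S j, ENNReal.ofReal (u x ^ q) ∂(mu ω) := lintegral_iUnion_le _ _
    _ ≤ ∑' j : ℤ, (ENNReal.ofReal (4 * C7) * nu ω (tr u ((2:ℝ)^j)) univ) ^ q := by
        refine ENNReal.tsum_le_tsum fun j => ?_
        calc ∫⁻ x in S j, ENNReal.ofReal (u x ^ q) ∂(mu ω)
            ≤ ∫⁻ x in S j, ENNReal.ofReal (4 * (2:ℝ)^j) ^ q ∂(mu ω) := by
              refine setLIntegral_mono' (hSm j) fun x hx => ?_
              rw [ENNReal.ofReal_rpow_of_nonneg (by positivity) hq0.le]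
              refine ENNReal.ofReal_le_ofReal (Real.rpow_le_rpow (hu0 x) ?_ hq0.le)
              have := hx.2
              rw [zpow_add₀ two_ne_zero] at this
              norm_num at this; linarith
          _ ≤ ENNReal.ofReal (4 * (2:ℝ)^j) ^ q * mu ω {x | (2:ℝ)^(j+1) ≤ u x} := by
              rw [setLIntegral_const]
              gcongr
              exact fun x hx => hx.1
          _ = (ENNReal.ofReal 4 * (ENNReal.ofReal ((2:ℝ)^j) * (mu ω {x | (2:ℝ)^(j+1) ≤ u x}) ^ (1 - (1:ℝ)/n))) ^ q := by
              rw [← mul_assoc, ← ENNReal.ofReal_mul (by norm_num), ENNReal.mul_rpow_of_nonneg _ _ hq0.le,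
                ← ENNReal.rpow_mul, hqi, ENNReal.rpow_one]
          _ ≤ _ := by
              refine ENNReal.rpow_le_rpow ?_ hq0.le
              rw [ENNReal.ofReal_mul (by norm_num), mul_assoc]
              exact mul_le_mul_right (hwk j) _
    _ ≤ (∑' j : ℤ, ENNReal.ofReal (4 * C7) * nu ω (tr u ((2:ℝ)^j)) univ) ^ q := tsum_rpow_le _ hq1
    _ ≤ _ := by
        refine ENNReal.rpow_le_rpow ?_ hq0.le
        rw [ENNReal.tsum_mul_left]
        gcongr
        exact tr_sum hw.pos hw.cont huc hu0
end SA
end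

section
open MeasureTheory Metric Set
open scoped ENNReal NNReal

namespace SA
variable {n : ℕ} {ω : E n → ℝ}

lemma pw_fderiv {f : E n → ℝ} (hf : Differentiable ℝ f) {γ : ℝ} (hγ : 1 ≤ γ) (x : E n) :
    ‖fderiv ℝ (fun y => |f y| ^ γ) x‖ ≤ γ * |f x| ^ (γ - 1) * ‖fderiv ℝ f x‖ := by
  have hnn : 0 ≤ γ * |f x| ^ (γ - 1) * ‖fderiv ℝ f x‖ := by positivity
  by_cases h0 : f x = 0
  · have : fderiv ℝ (fun y => |f y| ^ γ) x = 0 := by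
      refine IsLocalMin.fderiv_eq_zero (Filter.Eventually.of_forall fun y => ?_)
      simp only [h0, abs_zero]
      rw [Real.zero_rpow (by linarith)]; positivity
    rw [this, norm_zero]; exact hnn
  have hx : 0 < |f x| := abs_pos.2 h0
  have h1 : HasDerivAt (fun t : ℝ => |t| ^ γ) ((SignType.sign (f x) : ℝ) * γ * |f x| ^ (γ - 1)) (f x) :=
    (hasDerivAt_abs h0).rpow_const (Or.inl hx.ne')
  have h2 := h1.comp_hasFDerivAt x (hf x).hasFDerivAt
  rw [show (fun y => |f y| ^ γ) = (fun t : ℝ => |t| ^ γ) ∘ f from rfl, h2.fderiv, norm_smul]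
  refine mul_le_mul_of_nonneg_right ?_ (norm_nonneg _)
  rw [norm_mul, norm_mul, Real.norm_of_nonneg (by linarith : 0 ≤ γ), Real.norm_of_nonneg (by positivity : 0 ≤ |f x| ^ (γ-1))]
  have : ‖(SignType.sign (f x) : ℝ)‖ ≤ 1 := by
    rcases lt_or_gt_of_ne h0 with h | h <;> simp [h]
  have h3 : 0 ≤ γ * |f x| ^ (γ-1) := by positivity
  rw [mul_assoc]
  nlinarith

lemma pw_lip {f : E n → ℝ} (hf : ContDiff ℝ (⊤ : ℕ∞) f) (hs : HasCompactSupport f) {γ : ℝ} (hγ : 1 ≤ γ) :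
    ∃ K, LipschitzWith K (fun y => |f y| ^ γ) := by
  obtain ⟨K, hK⟩ := hf.lipschitzWith_of_hasCompactSupport hs (by simp)
  obtain ⟨M, hM⟩ := hs.exists_bound_of_continuous hf.continuous
  rcases hγ.eq_or_lt with h | h
  · refine ⟨K, LipschitzWith.of_dist_le_mul fun x y => ?_⟩
    simp only [← h, Real.rpow_one]
    exact (abs_abs_sub_abs_le _ _).trans (hK.dist_le_mul x y)
  · have hd : Differentiable ℝ (fun y => |f y| ^ γ) := fun x =>
      ((hasDerivAt_abs_rpow (f x) h).comp_hasFDerivAt x (hf.differentiable (by simp) x).hasFDerivAt).differentiableAt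
    have hM0 : 0 ≤ M := (norm_nonneg _).trans (hM 0)
    refine ⟨(γ * M ^ (γ - 1) * K).toNNReal, lipschitzWith_of_nnnorm_fderiv_le hd fun x => ?_⟩
    rw [← NNReal.coe_le_coe, coe_nnnorm, Real.coe_toNNReal _ (by positivity)]
    refine (pw_fderiv (hf.differentiable (by simp)) hγ x).trans ?_
    have h1 : ‖fderiv ℝ f x‖ ≤ K := norm_fderiv_le_of_lipschitz ℝ hK
    have h2 : |f x| ^ (γ - 1) ≤ M ^ (γ - 1) := Real.rpow_le_rpow (abs_nonneg _) (hM x) (by linarith)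
    gcongr

lemma rp_cont (hpos : ∀ x, 0 < ω x) (hc : Continuous ω) (a : ℝ) : Continuous fun x => ω x ^ a :=
  hc.rpow_const fun x => Or.inl (hpos x).ne'

lemma holder_fin (hpos : ∀ x, 0 < ω x) (hc : Continuous ω) {f : E n → ℝ} (hf : ContDiff ℝ (⊤ : ℕ∞) f)
    (hs : HasCompactSupport f) {p : ℝ} (hp : 1 ≤ p) (hpn : p < n) :
    ∫ x, wt ω x ^ (n-1) * (|f x| ^ (p * (n-1) / (n-p) - 1) * ‖fderiv ℝ f x‖) ≤
      (∫ x, |f x| ^ ((n:ℝ) * p / (n-p)) * ω x) ^ (1 - 1/p) *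
      (∫ x, (ω x ^ (-(1:ℝ)/n) * ‖fderiv ℝ f x‖) ^ p * ω x) ^ (1/p) := by
  have hn0 : 0 < (n:ℝ) := by linarith
  have hn1 : 1 ≤ n := by exact_mod_cast hn0
  have hnp : 0 < (n:ℝ) - p := by linarith
  have hwt : ∀ x, wt ω x ^ (n-1) = ω x ^ (-(1:ℝ)/n) * ω x := by
    intro x
    unfold wt
    rw [← Real.rpow_natCast, ← Real.rpow_mul (hpos x).le, ← Real.rpow_add_one (hpos x).ne']
    congr 1
    rw [Nat.cast_sub hn1]; field_simp; push_cast; ring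
  have hgc : Continuous fun x => ‖fderiv ℝ f x‖ := (hf.continuous_fderiv (by simp)).norm
  rcases hp.eq_or_lt with h | h
  · subst h
    have : (n:ℝ) - 1 ≠ 0 := hnp.ne'
    simp only [one_mul, div_self this, sub_self, Real.rpow_zero, one_div_one, Real.rpow_one]
    refine le_of_eq (integral_congr_ae (Filter.Eventually.of_forall fun x => ?_))
    simp only [hwt]; ring
  · have hpq : (p / (p-1)).HolderConjugate p := (Real.HolderConjugate.conjExponent h).symm
    have hp0 : 0 < p := by linarith
    have hp1 : 0 < p - 1 := by linarith
    have hg0 : 0 < p * (n-1) / (n-p) - 1 := by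
      rw [sub_pos, lt_div_iff₀ hnp]; nlinarith
    set a := p * (n-1) / (n-p) - 1 with ha
    set F : E n → ℝ := fun x => |f x| ^ a * ω x ^ ((p-1)/p) with hF
    set G : E n → ℝ := fun x => ω x ^ (-(1:ℝ)/n) * ‖fderiv ℝ f x‖ * ω x ^ (1/p) with hG
    have hFc : Continuous F := (hf.continuous.abs.rpow_const fun x => Or.inr hg0.le).mul (rp_cont hpos hc _)
    have hGc : Continuous G := ((rp_cont hpos hc _).mul hgc).mul (rp_cont hpos hc _)
    have hFs : HasCompactSupport F := hs.mono fun x hx => by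
      simp only [Function.mem_support] at hx ⊢
      intro h0; apply hx; simp only [hF, h0, abs_zero, Real.zero_rpow hg0.ne', zero_mul]
    have hGs : HasCompactSupport G := (hs.fderiv ℝ).mono fun x hx => by
      simp only [Function.mem_support] at hx ⊢
      intro h0; apply hx; simp only [hG, h0, norm_zero, mul_zero, zero_mul]
    have hF0 : ∀ x, 0 ≤ F x := fun x => mul_nonneg (by positivity) (Real.rpow_nonneg (hpos x).le _)
    have hG0 : ∀ x, 0 ≤ G x := fun x => mul_nonneg (mul_nonneg (Real.rpow_nonneg (hpos x).le _) (norm_nonneg _)) (Real.rpow_nonneg (hpos x).le _)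
    have H := integral_mul_le_Lp_mul_Lq_of_nonneg (μ := (volume : Measure (E n))) hpq
      (Filter.Eventually.of_forall hF0) (Filter.Eventually.of_forall hG0)
      (hFc.memLp_of_hasCompactSupport hFs) (hGc.memLp_of_hasCompactSupport hGs)
    convert H using 1
    · refine integral_congr_ae (Filter.Eventually.of_forall fun x => ?_)
      simp only [hF, hG, hwt]
      have : ω x = ω x ^ ((p-1)/p) * ω x ^ (1/p) := by
        rw [← Real.rpow_add (hpos x)]
        conv_lhs => rw [← Real.rpow_one (ω x)]
        congr 1; field_simp; ring
      conv_lhs => rw [this]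
      conv_lhs => enter [1,1]; rw [← this]
      ring
    · congr 1
      · congr 1
        · refine integral_congr_ae (Filter.Eventually.of_forall fun x => ?_)
          simp only [hF]
          rw [Real.mul_rpow (by positivity) (Real.rpow_nonneg (hpos x).le _), ← Real.rpow_mul (abs_nonneg _),
            ← Real.rpow_mul (hpos x).le]
          congr 2
          · rw [ha]; field_simp; ring
          · rw [show (p-1)/p * (p/(p-1)) = 1 by field_simp, Real.rpow_one]
        · field_simp
      · congr 1
        refine integral_congr_ae (Filter.Eventually.of_forall fun x => ?_)
        simp only [hG]
        rw [Real.mul_rpow (mul_nonneg (Real.rpow_nonneg (hpos x).le _) (norm_nonneg _)) (Real.rpow_nonneg (hpos x).le _), ← Real.rpow_mul (hpos x).le (1/p),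
          one_div_mul_cancel hp0.ne', Real.rpow_one]

lemma sobolev_main {P KA C : ℝ} (hw : SW n ω P KA C) {p : ℝ} (hp : 1 ≤ p) (hpn : p < n) :
    ∃ C9 : ℝ, 0 < C9 ∧ ∀ f : E n → ℝ, ContDiff ℝ (⊤ : ℕ∞) f → HasCompactSupport f →
      (∫ x, |f x| ^ ((n:ℝ) * p / (n-p)) * ω x) ^ (((n:ℝ)-p)/(n*p)) ≤
      C9 * (∫ x, (ω x ^ (-(1:ℝ)/n) * ‖fderiv ℝ f x‖) ^ p * ω x) ^ (1/p) := by
  obtain ⟨C8, h8, H8⟩ := strong_type hw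
  have hn2 : (2:ℝ) ≤ n := by exact_mod_cast hw.hn
  have hn1 : 0 < (n:ℝ) - 1 := by linarith
  have hnp : 0 < (n:ℝ) - p := by linarith
  have hp0 : 0 < p := by linarith
  set γ : ℝ := p * (n-1) / (n-p) with hγ
  have hγ1 : 1 ≤ γ := by
    rw [hγ, le_div_iff₀ hnp]; nlinarith
  refine ⟨C8 * γ, by positivity, fun f hf hs => ?_⟩
  have hpos := hw.pos
  have hc := hw.cont
  have H := H8 (fun x => |f x| ^ γ) (fun x => by positivity) (pw_lip hf hs hγ1) (by
    refine hs.mono fun x hx => ?_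
    simp only [Function.mem_support] at hx ⊢
    intro h0; apply hx; rw [h0, abs_zero, Real.zero_rpow (by linarith)])
  have hps0 : 0 < (n:ℝ) * p / (n-p) := by positivity
  have hZ : ∫⁻ x, ENNReal.ofReal ((|f x| ^ γ) ^ ((n:ℝ)/(n-1))) ∂(mu ω) =
      ENNReal.ofReal (∫ x, |f x| ^ ((n:ℝ) * p / (n-p)) * ω x) := by
    have hfc : Continuous fun x => |f x| ^ ((n:ℝ) * p / (n-p)) := hf.continuous.abs.rpow_const fun x => Or.inr hps0.le
    rw [ofReal_integral_eq_lintegral_ofReal]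
    · unfold mu
      rw [lintegral_withDensity_eq_lintegral_mul _ hc.measurable.ennreal_ofReal]
      · refine lintegral_congr fun x => ?_
        simp only [Pi.mul_apply]
        rw [← ENNReal.ofReal_mul (hpos x).le, mul_comm, ← Real.rpow_mul (abs_nonneg _)]
        congr 3
        rw [hγ]; field_simp
      · have : Continuous fun x => (|f x| ^ γ) ^ ((n:ℝ)/(n-1)) :=
          (hf.continuous.abs.rpow_const fun x => Or.inr (by linarith)).rpow_const fun x => Or.inr (by positivity)
        exact this.measurable.ennreal_ofReal
    · refine (hfc.mul hc).integrable_of_hasCompactSupport (hs.mono fun x hx => ?_)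
      simp only [Function.mem_support] at hx ⊢
      intro h0; apply hx; simp only [Pi.mul_apply]; rw [h0, abs_zero, Real.zero_rpow hps0.ne', zero_mul]
    · exact Filter.Eventually.of_forall fun x => mul_nonneg (by positivity) (hpos x).le
  set I := ∫ x, wt ω x ^ (n-1) * (|f x| ^ (γ - 1) * ‖fderiv ℝ f x‖) with hI
  have hgc : Continuous fun x => ‖fderiv ℝ f x‖ := (hf.continuous_fderiv (by simp)).norm
  have hI0 : 0 ≤ I := integral_nonneg fun x => mul_nonneg (pow_nonneg (wt_pos hpos x).le _) (by positivity)
  have hnu : nu ω (fun x => |f x| ^ γ) univ ≤ ENNReal.ofReal (γ * I) := by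
    unfold nu
    rw [hI, ← integral_const_mul, Measure.restrict_univ, ofReal_integral_eq_lintegral_ofReal]
    · refine lintegral_mono fun x => ENNReal.ofReal_le_ofReal ?_
      have := pw_fderiv (hf.differentiable (by simp)) hγ1 x
      have hw0 : 0 ≤ wt ω x ^ (n-1) := pow_nonneg (wt_pos hpos x).le _
      calc _ ≤ wt ω x ^ (n-1) * (γ * |f x| ^ (γ - 1) * ‖fderiv ℝ f x‖) := mul_le_mul_of_nonneg_left this hw0
        _ = _ := by ring
    · refine Integrable.const_mul ?_ _
      have hcc : Continuous fun x => wt ω x ^ (n-1) * (|f x| ^ (γ - 1) * ‖fderiv ℝ f x‖) :=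
        ((wt_cont hpos hc).pow _).mul ((hf.continuous.abs.rpow_const fun x => Or.inr (by linarith)).mul hgc)
      refine hcc.integrable_of_hasCompactSupport ((hs.fderiv ℝ).mono fun x hx => ?_)
      simp only [Function.mem_support] at hx ⊢
      intro h0; apply hx; rw [h0, norm_zero, mul_zero, mul_zero]
    · exact Filter.Eventually.of_forall fun x => mul_nonneg (by linarith) (mul_nonneg (pow_nonneg (wt_pos hpos x).le _) (by positivity))
  have hHo := holder_fin hpos hc hf hs hp hpn
  rw [← hγ, ← hI] at hHo
  have hq0 : 0 < (n:ℝ)/(n-1) := by positivity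
  rw [hZ] at H
  set Z := ∫ x, |f x| ^ ((n:ℝ) * p / (n-p)) * ω x with hZd
  set W := (∫ x, (ω x ^ (-(1:ℝ)/n) * ‖fderiv ℝ f x‖) ^ p * ω x) ^ (1/p) with hW
  have hW0 : 0 ≤ W := Real.rpow_nonneg (integral_nonneg fun x => mul_nonneg (Real.rpow_nonneg (mul_nonneg (Real.rpow_nonneg (hpos x).le _) (norm_nonneg _)) _) (hpos x).le) _
  have hZ0 : 0 ≤ Z := integral_nonneg fun x => mul_nonneg (by positivity) (hpos x).le
  have H2 : Z ≤ (C8 * (γ * I)) ^ ((n:ℝ)/(n-1)) := by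
    rw [← ENNReal.ofReal_le_ofReal_iff (by positivity)]
    refine H.trans ?_
    rw [← ENNReal.ofReal_rpow_of_nonneg (by positivity) hq0.le, ENNReal.ofReal_mul h8.le]
    gcongr
  rcases hZ0.eq_or_lt with h0 | h0
  · rw [← h0, Real.zero_rpow (by positivity)]; positivity
  have H3 : Z ^ (((n:ℝ)-1)/n) ≤ C8 * (γ * (Z ^ (1 - 1/p) * W)) := by
    calc Z ^ (((n:ℝ)-1)/n) ≤ ((C8 * (γ * I)) ^ ((n:ℝ)/(n-1))) ^ (((n:ℝ)-1)/n) :=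
          Real.rpow_le_rpow hZ0 H2 (by positivity)
      _ = C8 * (γ * I) := by
          rw [← Real.rpow_mul (by positivity), show (n:ℝ)/(n-1) * ((n-1)/n) = 1 by field_simp, Real.rpow_one]
      _ ≤ _ := by gcongr
  have hz : 0 < Z ^ (1 - 1/p) := by positivity
  refine le_of_mul_le_mul_right ?_ hz
  calc Z ^ (((n:ℝ)-p)/(n*p)) * Z ^ (1 - 1/p) = Z ^ (((n:ℝ)-1)/n) := by
        rw [← Real.rpow_add h0]; congr 1; field_simp; ring
    _ ≤ _ := H3
    _ = _ := by ring
end SA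
end

/-- (David–Semmes) A strong `A_∞` weight satisfies the weighted
Sobolev inequality for every `1 ≤ p < n`, with `p* = np/(n-p)`. -/
theorem sobolev_of_strongAinfty
    (n : ℕ) (hn : 2 ≤ n)
    (ω : EuclideanSpace ℝ (Fin n) → ℝ)
    (hωpos : ∀ x, 0 < ω x) (hωcont : Continuous ω)
    (p₀ K C₀ : ℝ) (hp₀ : 1 < p₀) (hAp : IsApWeight n p₀ K ω)
    (hstrong : ∀ x y : EuclideanSpace ℝ (Fin n),
      C₀⁻¹ * deltaW n ω x y ≤ dW n ω x y ∧ dW n ω x y ≤ C₀ * deltaW n ω x y)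
    (p : ℝ) (hp1 : 1 ≤ p) (hpn : p < n) :
    ∃ C : ℝ, 0 < C ∧
      ∀ f : EuclideanSpace ℝ (Fin n) → ℝ,
        ContDiff ℝ (⊤ : ℕ∞) f → HasCompactSupport f →
        (∫ x, |f x| ^ ((n : ℝ) * p / ((n : ℝ) - p)) * ω x) ^ (((n : ℝ) - p) / ((n : ℝ) * p)) ≤
          C * (∫ x, ((ω x) ^ (-(1 : ℝ) / n) * ‖gradient f x‖) ^ p * ω x) ^ (1 / p) := by
  obtain ⟨KA, C, hw⟩ := SA.SW.mk' n hn ω hωpos hωcont p₀ K C₀ hp₀ hAp hstrong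
  obtain ⟨C9, h9, H⟩ := SA.sobolev_main hw hp1 hpn
  refine ⟨C9, h9, fun f hf hs => ?_⟩
  have hg : ∀ x, ‖gradient f x‖ = ‖fderiv ℝ f x‖ := fun x => by
    rw [gradient, LinearIsometryEquiv.norm_map]
  simp only [hg]
  exact H f hf hs
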